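/- For every positive natural number n there exists a constant C > 0, depending only on n, such that the following holds. Let R > 0, T > 0, let B̄_R denote the closed ball of radius R centered at the origin in ℝⁿ, and let u : [0,T] × B̄_R → ℝ be everywhere positive, twice continuously differentiable in the space variable and once continuously differentiable in the time variable, satisfying the heat equation ∂_t u = Δu on (0,T] × B̄_R. Then for every real α > 1, all points x₁, x₂ ∈ B̄_{R/2} and all times 0 < t₁ < t₂ ≤ T: u(x₁, t₁) ≤ u(x₂, t₂) · (t₂/t₁)^{nα/2} · exp( α²‖x₁ - x₂‖²/(4(t₂ - t₁)) + (Cα/R²)·(1 + α²/(α-1))·(t₂ - t₁) ). -/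

import Mathlib

open MeasureTheory Real
open scoped BigOperators RealInnerProductSpace

noncomputable section

/-- The Euclidean Laplacian `Δf(x) = Σᵢ ∂²f/∂xᵢ²(x)` of `f : ℝⁿ → ℝ`. -/
def lap {n : ℕ} (f : EuclideanSpace ℝ (Fin n) → ℝ) (x : EuclideanSpace ℝ (Fin n)) : ℝ :=
  ∑ i : Fin n,
    fderiv ℝ (fun y => fderiv ℝ f y (EuclideanSpace.single i 1)) x (EuclideanSpace.single i 1)

section HeatHarnack

open Set Filter Metric
open scoped Topology

variable {n : ℕ}

local notation "𝔼" => EuclideanSpace ℝ (Fin n)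

/-- The coordinate vector `eᵢ`. -/
local notation "𝐞" i:max => (EuclideanSpace.single i (1 : ℝ) : EuclideanSpace ℝ (Fin n))

/-! ### The Laplacian -/

lemma contDiff_fderiv_apply {f : 𝔼 → ℝ} (hf : ContDiff ℝ 2 f) (v : 𝔼) :
    ContDiff ℝ 1 (fun y => fderiv ℝ f y v) :=
  (hf.fderiv_right (m := 1) (by norm_num)).clm_apply contDiff_const

lemma contDiffOn_fderiv_apply {f : 𝔼 → ℝ} {S : Set 𝔼} (hS : IsOpen S) (hf : ContDiffOn ℝ 2 f S)
    (v : 𝔼) : ContDiffOn ℝ 1 (fun y => fderiv ℝ f y v) S :=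
  (hf.fderiv_of_isOpen hS (m := 1) (by norm_num)).clm_apply contDiffOn_const

lemma continuous_lap {f : 𝔼 → ℝ} (hf : ContDiff ℝ 2 f) : Continuous (lap f) := by
  unfold lap
  refine continuous_finsetSum _ fun i _ => ?_
  exact ((contDiff_fderiv_apply hf _).continuous_fderiv (by norm_num)).clm_apply continuous_const

lemma continuousOn_lap {f : 𝔼 → ℝ} {S : Set 𝔼} (hS : IsOpen S) (hf : ContDiffOn ℝ 2 f S) :
    ContinuousOn (lap f) S := by
  unfold lap
  refine continuousOn_finsetSum _ fun i _ => ?_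
  exact ((contDiffOn_fderiv_apply hS hf _).continuousOn_fderiv_of_isOpen hS
    (by norm_num)).clm_apply continuousOn_const

lemma tsupport_lap_subset (f : 𝔼 → ℝ) : tsupport (lap f) ⊆ tsupport f := by
  refine closure_minimal (fun y hy => ?_) (isClosed_tsupport f)
  by_contra hyf
  refine hy (Finset.sum_eq_zero fun i _ => ?_)
  have h1 : y ∉ tsupport (fun y => fderiv ℝ (fun y => fderiv ℝ f y (𝐞 i)) y (𝐞 i)) := fun h =>
    hyf (tsupport_fderiv_apply_subset ℝ _ (tsupport_fderiv_apply_subset ℝ _ h))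
  exact image_eq_zero_of_notMem_tsupport (f := fun y => fderiv ℝ (fun y => fderiv ℝ f y (𝐞 i)) y (𝐞 i)) h1

lemma fderiv_comp_const_sub {g : 𝔼 → ℝ} (hg : Differentiable ℝ g) (x z : 𝔼) :
    fderiv ℝ (fun z => g (x - z)) z = -fderiv ℝ g (x - z) := by
  have h := (hg (x - z)).hasFDerivAt.comp z ((hasFDerivAt_id z).const_sub x)
  rw [show (fun z => g (x - z)) = g ∘ HSub.hSub x from rfl, h.fderiv]
  ext v
  simp

lemma lap_comp_sub {f : 𝔼 → ℝ} (hf : ContDiff ℝ 2 f) (x y : 𝔼) :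
    lap (fun z => f (x - z)) y = lap f (x - y) := by
  unfold lap
  refine Finset.sum_congr rfl fun i _ => ?_
  have h2 : (fun z => fderiv ℝ (fun z => f (x - z)) z (𝐞 i))
      = -fun z => (fun w => fderiv ℝ f w (𝐞 i)) (x - z) := by
    funext z
    simp [fderiv_comp_const_sub (hf.differentiable (by norm_num))]
  rw [h2, fderiv_neg, fderiv_comp_const_sub ((contDiff_fderiv_apply hf _).differentiable
    (by norm_num))]
  simp

lemma hasFDerivAt_radial {G : ℝ → ℝ} {G' : ℝ} {x y : 𝔼} (hG : HasDerivAt G G' (‖y - x‖ ^ 2)) :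
    HasFDerivAt (fun z => G (‖z - x‖ ^ 2)) (G' • (2 : ℝ) • innerSL ℝ (y - x)) y := by
  have h1 : HasFDerivAt (fun z : 𝔼 => ‖z - x‖ ^ 2) ((2 : ℝ) • innerSL ℝ (y - x)) y := by
    have := ((hasFDerivAt_id y).sub_const x).norm_sq
    refine this.congr_fderiv ?_
    ext v
    simp
  exact hG.comp_hasFDerivAt y h1

lemma lap_radial {G G' G'' : ℝ → ℝ} (hG : ∀ q, HasDerivAt G (G' q) q)
    (hG' : ∀ q, HasDerivAt G' (G'' q) q) (x y : 𝔼) :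
    lap (fun z => G (‖z - x‖ ^ 2)) y
      = 4 * ‖y - x‖ ^ 2 * G'' (‖y - x‖ ^ 2) + 2 * n * G' (‖y - x‖ ^ 2) := by
  unfold lap
  have h1 : ∀ i : Fin n, (fun z : 𝔼 => fderiv ℝ (fun z => G (‖z - x‖ ^ 2)) z (𝐞 i))
      = fun z => G' (‖z - x‖ ^ 2) * (2 * (z i - x i)) := by
    intro i; funext z
    rw [(hasFDerivAt_radial (hG _)).fderiv]
    simp [EuclideanSpace.inner_single_right]
  have h2 : ∀ i : Fin n, fderiv ℝ (fun z : 𝔼 => G' (‖z - x‖ ^ 2) * (2 * (z i - x i))) y (𝐞 i)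
      = 4 * (y i - x i) ^ 2 * G'' (‖y - x‖ ^ 2) + 2 * G' (‖y - x‖ ^ 2) := by
    intro i
    have h3 : HasFDerivAt (fun z : 𝔼 => 2 * (z i - x i))
        ((2 : ℝ) • (EuclideanSpace.proj i : 𝔼 →L[ℝ] ℝ)) y := by
      have := ((EuclideanSpace.proj i : 𝔼 →L[ℝ] ℝ).hasFDerivAt
        (x := y)).sub_const (x i)
      exact this.const_mul 2
    have h4 := (hasFDerivAt_radial (x := x) (hG' (‖y - x‖ ^ 2))).fun_mul h3
    rw [h4.fderiv]
    simp [EuclideanSpace.inner_single_right]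
    ring
  simp only [h1, h2]
  rw [Finset.sum_add_distrib, ← Finset.sum_mul, ← Finset.mul_sum, EuclideanSpace.norm_sq_eq]
  simp
  ring

lemma contDiff_radial {G : ℝ → ℝ} {m : WithTop ℕ∞} (hG : ContDiff ℝ m G) (x : 𝔼) :
    ContDiff ℝ m (fun z => G (‖z - x‖ ^ 2)) :=
  hG.comp ((contDiff_id.sub contDiff_const).norm_sq ℝ)

/-! ### Test functions and pairings -/

/-- `C²` functions with compact support in `S`. -/
structure IsTest (S : Set 𝔼) (φ : 𝔼 → ℝ) : Prop where
  contDiff : ContDiff ℝ 2 φ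
  compact : HasCompactSupport φ
  subset : tsupport φ ⊆ S

lemma IsTest.mono {S S' : Set 𝔼} {φ : 𝔼 → ℝ} (h : IsTest S φ) (hS : S ⊆ S') : IsTest S' φ :=
  ⟨h.contDiff, h.compact, h.subset.trans hS⟩

lemma isTest_of_eq_zero {S K : Set 𝔼} {φ : 𝔼 → ℝ} (hφ : ContDiff ℝ 2 φ) (hK : IsCompact K)
    (hKS : K ⊆ S) (h0 : ∀ y ∉ K, φ y = 0) : IsTest S φ := by
  have h1 : tsupport φ ⊆ K := closure_minimal (fun y hy => by
    by_contra h; exact hy (h0 y h)) hK.isClosed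
  exact ⟨hφ, HasCompactSupport.intro hK h0, h1.trans hKS⟩

lemma continuous_mul_of_eq_zero {S K : Set 𝔼} {f φ : 𝔼 → ℝ} (hS : IsOpen S)
    (hf : ContinuousOn f S) (hφ : Continuous φ) (hK : IsCompact K) (hKS : K ⊆ S)
    (h0 : ∀ y ∉ K, φ y = 0) : Continuous (fun y => f y * φ y) := by
  refine ContinuousOn.continuous_of_tsupport_subset (hf.mul hφ.continuousOn) hS ?_
  refine (closure_minimal (fun y hy => ?_) hK.isClosed).trans hKS
  by_contra h
  exact hy (by simp [h0 y h])

lemma integrable_mul_of_eq_zero {S K : Set 𝔼} {f φ : 𝔼 → ℝ} (hS : IsOpen S)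
    (hf : ContinuousOn f S) (hφ : Continuous φ) (hK : IsCompact K) (hKS : K ⊆ S)
    (h0 : ∀ y ∉ K, φ y = 0) : Integrable (fun y => f y * φ y) :=
  (continuous_mul_of_eq_zero hS hf hφ hK hKS h0).integrable_of_hasCompactSupport
    (HasCompactSupport.intro hK fun y hy => by simp [h0 y hy])

lemma eq_zero_of_notMem_tsupport {φ : 𝔼 → ℝ} : ∀ y ∉ tsupport φ, φ y = 0 :=
  fun _ hy => image_eq_zero_of_notMem_tsupport hy

lemma integrable_mul_of_tsupport {S : Set 𝔼} {f φ : 𝔼 → ℝ} (hS : IsOpen S)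
    (hf : ContinuousOn f S) (hφ : Continuous φ) (hc : HasCompactSupport φ) (hs : tsupport φ ⊆ S) :
    Integrable (fun y => f y * φ y) :=
  integrable_mul_of_eq_zero hS hf hφ hc hs eq_zero_of_notMem_tsupport

lemma IsTest.integrable_mul_lap {S : Set 𝔼} {f φ : 𝔼 → ℝ} (hS : IsOpen S) (h : IsTest S φ)
    (hf : ContinuousOn f S) : Integrable (fun y => f y * lap φ y) :=
  integrable_mul_of_eq_zero hS hf (continuous_lap h.contDiff) h.compact h.subset
    fun y hy => eq_zero_of_notMem_tsupport y fun hy' => hy (tsupport_lap_subset φ hy')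

/-- The Green identity against a test function. -/
lemma integral_lap_mul {S : Set 𝔼} (hS : IsOpen S) {f φ : 𝔼 → ℝ} (hf : ContDiffOn ℝ 2 f S)
    (hφ : IsTest S φ) : ∫ y, lap f y * φ y = ∫ y, f y * lap φ y := by
  have hd : ∀ i : Fin n, ContDiffOn ℝ 1 (fun y => fderiv ℝ f y (𝐞 i)) S := fun i =>
    contDiffOn_fderiv_apply hS hf _
  have hdd : ∀ i : Fin n,
      ContinuousOn (fun y => fderiv ℝ (fun y => fderiv ℝ f y (𝐞 i)) y (𝐞 i)) S := fun i =>
    ((hd i).continuousOn_fderiv_of_isOpen hS (by norm_num)).clm_apply continuousOn_const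
  have pd : ∀ i : Fin n, ContDiff ℝ 1 (fun y => fderiv ℝ φ y (𝐞 i)) := fun i =>
    contDiff_fderiv_apply hφ.contDiff _
  have pz : ∀ i : Fin n, ∀ y ∉ tsupport φ, fderiv ℝ φ y (𝐞 i) = 0 := fun i y hy =>
    eq_zero_of_notMem_tsupport (φ := fun y => fderiv ℝ φ y (𝐞 i)) y
      fun h => hy (tsupport_fderiv_apply_subset ℝ _ h)
  have pdd : ∀ i : Fin n,
      Continuous (fun y => fderiv ℝ (fun y => fderiv ℝ φ y (𝐞 i)) y (𝐞 i)) := fun i =>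
    ((pd i).continuous_fderiv (by norm_num)).clm_apply continuous_const
  have pzz : ∀ i : Fin n, ∀ y ∉ tsupport φ,
      fderiv ℝ (fun y => fderiv ℝ φ y (𝐞 i)) y (𝐞 i) = 0 := fun i y hy =>
    eq_zero_of_notMem_tsupport (φ := fun y => fderiv ℝ (fun y => fderiv ℝ φ y (𝐞 i)) y (𝐞 i)) y
      fun h => hy (tsupport_fderiv_apply_subset ℝ _ (tsupport_fderiv_apply_subset ℝ _ h))
  have I : ∀ {g ψ : 𝔼 → ℝ}, ContinuousOn g S → Continuous ψ → (∀ y ∉ tsupport φ, ψ y = 0) →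
      Integrable (fun y => g y * ψ y) := fun hg hψ h0 =>
    integrable_mul_of_eq_zero hS hg hψ hφ.compact hφ.subset h0
  have hφc := hφ.contDiff.continuous
  have hfd : ∀ x ∈ S, DifferentiableAt ℝ f x := fun x hx =>
    (hf.differentiableOn (by norm_num)).differentiableAt (hS.mem_nhds hx)
  simp only [lap, Finset.sum_mul, Finset.mul_sum]
  rw [integral_finsetSum _ fun i _ => I (hdd i) hφc eq_zero_of_notMem_tsupport,
    integral_finsetSum _ fun i _ => I hf.continuousOn (pdd i) (pzz i)]
  refine Finset.sum_congr rfl fun i _ => ?_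
  have e1 := integral_mul_fderiv_eq_neg_fderiv_mul_of_integrable (μ := volume) (v := 𝐞 i)
    (f := fun y => fderiv ℝ f y (𝐞 i)) (g := φ)
    (I (hdd i) hφc eq_zero_of_notMem_tsupport) (I (hd i).continuousOn (pd i).continuous (pz i))
    (I (hd i).continuousOn hφc eq_zero_of_notMem_tsupport)
    (fun x hx => ((hd i).differentiableOn (by norm_num)).differentiableAt
      (hS.mem_nhds (hφ.subset hx)))
    (fun x _ => hφ.contDiff.differentiable (by norm_num) x)
  have e2 := integral_mul_fderiv_eq_neg_fderiv_mul_of_integrable (μ := volume) (v := 𝐞 i)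
    (f := f) (g := fun y => fderiv ℝ φ y (𝐞 i))
    (I (hd i).continuousOn (pd i).continuous (pz i)) (I hf.continuousOn (pdd i) (pzz i))
    (I hf.continuousOn (pd i).continuous (pz i))
    (fun x hx => hfd x (hφ.subset (tsupport_fderiv_apply_subset ℝ _ hx)))
    (fun x _ => (pd i).differentiable (by norm_num) x)
  linarith

/-- Differentiating an increment of the weight in a pairing `∫ U(t) k(t)`. -/
lemma hasDerivAt_integral_mul_sub {U k : ℝ → 𝔼 → ℝ} {k' : 𝔼 → ℝ} {S K : Set 𝔼} {t₀ : ℝ}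
    (hS : IsOpen S) (hK : IsCompact K) (hKS : K ⊆ S)
    (hUc : ∀ᶠ t in 𝓝 t₀, ContinuousOn (U t) S)
    (hUb : ∃ M, ∀ᶠ t in 𝓝 t₀, ∀ y ∈ K, |U t y| ≤ M)
    (hUt : ∀ y ∈ K, ContinuousAt (fun t => U t y) t₀)
    (hkc : ∀ᶠ t in 𝓝 t₀, Continuous (k t)) (hk0 : ∀ᶠ t in 𝓝 t₀, ∀ y ∉ K, k t y = 0)
    (hkL : ∃ L, ∀ᶠ t in 𝓝 t₀, ∀ y, |k t y - k t₀ y| ≤ L * |t - t₀|)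
    (hk' : ∀ y, HasDerivAt (fun t => k t y) (k' y) t₀) :
    HasDerivAt (fun t => ∫ y, U t y * (k t y - k t₀ y)) (∫ y, U t₀ y * k' y) t₀ := by
  obtain ⟨M, hM⟩ := hUb
  obtain ⟨L, hL⟩ := hkL
  rw [hasDerivAt_iff_tendsto_slope]
  have hs : ∀ t, slope (fun t => ∫ y, U t y * (k t y - k t₀ y)) t₀ t
      = ∫ y, U t y * (slope (fun t => k t y) t₀ t) := by
    intro t
    simp only [slope_def_field, sub_self, mul_zero, integral_zero, sub_zero]
    rw [← integral_div]
    refine integral_congr_ae (Eventually.of_forall fun y => ?_)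
    ring
  refine Tendsto.congr (fun t => (hs t).symm) ?_
  have hz := hk0.self_of_nhds
  have hc := hkc.self_of_nhds
  refine tendsto_integral_filter_of_dominated_convergence (K.indicator fun _ => M * L) ?_ ?_ ?_ ?_
  · filter_upwards [hUc.filter_mono nhdsWithin_le_nhds, hkc.filter_mono nhdsWithin_le_nhds,
      hk0.filter_mono nhdsWithin_le_nhds] with t h1 h2 h3
    refine (continuous_mul_of_eq_zero hS h1 (φ := fun y => slope (fun t => k t y) t₀ t) ?_ hK hKS
      ?_).aestronglyMeasurable
    · simp only [slope_def_field]
      exact (h2.sub hc).div_const _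
    · intro y hy
      simp [slope_def_field, h3 y hy, hz y hy]
  · filter_upwards [hM.filter_mono nhdsWithin_le_nhds, hL.filter_mono nhdsWithin_le_nhds,
      hk0.filter_mono nhdsWithin_le_nhds, self_mem_nhdsWithin] with t h1 h2 h3 h4
    refine Eventually.of_forall fun y => ?_
    by_cases hy : y ∈ K
    · rw [indicator_of_mem hy, norm_mul, Real.norm_eq_abs, Real.norm_eq_abs, slope_def_field,
        abs_div]
      have h5 : 0 < |t - t₀| := abs_pos.2 (sub_ne_zero.2 h4)
      have h6 : |k t y - k t₀ y| / |t - t₀| ≤ L := (div_le_iff₀ h5).2 (h2 y)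
      exact mul_le_mul (h1 y hy) h6 (by positivity) ((abs_nonneg _).trans (h1 y hy))
    · simp [indicator_of_notMem hy, slope_def_field, h3 y hy, hz y hy]
  · exact (integrable_indicator_iff hK.measurableSet).2
      (integrableOn_const hK.measure_lt_top.ne)
  · refine Eventually.of_forall fun y => ?_
    by_cases hy : y ∈ K
    · exact ((hUt y hy).tendsto.mono_left nhdsWithin_le_nhds).mul
        (hasDerivAt_iff_tendsto_slope.1 (hk' y))
    · have : k' y = 0 := by
        have h1 : (fun t => k t y) =ᶠ[𝓝 t₀] fun _ => 0 := hk0.mono fun t h => h y hy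
        exact (hk' y).unique ((hasDerivAt_const t₀ (0 : ℝ)).congr_of_eventuallyEq h1)
      simp only [this, mul_zero]
      refine tendsto_const_nhds.congr' ?_
      filter_upwards [hk0.filter_mono nhdsWithin_le_nhds] with t h3
      simp [slope_def_field, h3 y hy, hz y hy]

/-! ### Weak solutions -/

/-- Local boundedness near time `t`, and the heat equation at time `t` tested against `C²`
functions with compact support in `S`. -/
structure WeakHeatAt (u : ℝ → 𝔼 → ℝ) (S : Set 𝔼) (t : ℝ) : Prop where
  bdd : ∀ K : Set 𝔼, IsCompact K → K ⊆ S → ∃ M, ∀ᶠ s in 𝓝 t, ∀ x ∈ K, |u s x| ≤ M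
  deriv : ∀ φ : 𝔼 → ℝ, IsTest S φ →
    HasDerivAt (fun s => ∫ y, u s y * φ y) (∫ y, u t y * lap φ y) t

lemma WeakHeatAt.mono {u : ℝ → 𝔼 → ℝ} {S S' : Set 𝔼} {t : ℝ} (h : WeakHeatAt u S t)
    (hS : S' ⊆ S) : WeakHeatAt u S' t :=
  ⟨fun K hK hKS => h.bdd K hK (hKS.trans hS), fun φ hφ => h.deriv φ (hφ.mono hS)⟩

/-- Positive, separately continuous weak solutions on `(a, b) × S`. -/
structure WeakHeat (u : ℝ → 𝔼 → ℝ) (a b : ℝ) (S : Set 𝔼) : Prop where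
  isOpen : IsOpen S
  pos : ∀ t ∈ Ioo a b, ∀ x ∈ S, 0 < u t x
  cont_space : ∀ t ∈ Ioo a b, ContinuousOn (u t) S
  cont_time : ∀ x ∈ S, ContinuousOn (fun t => u t x) (Ioo a b)
  weak : ∀ t ∈ Ioo a b, WeakHeatAt u S t

lemma WeakHeat.mono {u : ℝ → 𝔼 → ℝ} {a b a' b' : ℝ} {S S' : Set 𝔼} (h : WeakHeat u a b S)
    (hS' : IsOpen S') (hS : S' ⊆ S) (ha : a ≤ a') (hb : b' ≤ b) : WeakHeat u a' b' S' := by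
  have hI : Ioo a' b' ⊆ Ioo a b := Ioo_subset_Ioo ha hb
  exact ⟨hS', fun t ht x hx => h.pos t (hI ht) x (hS hx), fun t ht =>
    (h.cont_space t (hI ht)).mono hS, fun x hx => (h.cont_time x (hS hx)).mono hI,
    fun t ht => (h.weak t (hI ht)).mono hS⟩

/-- The weak equation against a test function depending on time. -/
lemma WeakHeat.hasDerivAt_integral {u k : ℝ → 𝔼 → ℝ} {k' : 𝔼 → ℝ} {a b t₀ : ℝ} {S K : Set 𝔼}
    (h : WeakHeat u a b S) (ht₀ : t₀ ∈ Ioo a b) (hK : IsCompact K) (hKS : K ⊆ S)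
    (hkc : ∀ᶠ t in 𝓝 t₀, Continuous (k t)) (hk0 : ∀ᶠ t in 𝓝 t₀, ∀ y ∉ K, k t y = 0)
    (hkL : ∃ L, ∀ᶠ t in 𝓝 t₀, ∀ y, |k t y - k t₀ y| ≤ L * |t - t₀|)
    (hk' : ∀ y, HasDerivAt (fun t => k t y) (k' y) t₀) (hkt : ContDiff ℝ 2 (k t₀))
    (hk'c : Continuous k') :
    HasDerivAt (fun t => ∫ y, u t y * k t y) (∫ y, u t₀ y * (lap (k t₀) y + k' y)) t₀ := by
  have hn : Ioo a b ∈ 𝓝 t₀ := isOpen_Ioo.mem_nhds ht₀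
  have hz := hk0.self_of_nhds
  have hc := hkc.self_of_nhds
  have hT : IsTest S (k t₀) := isTest_of_eq_zero hkt hK hKS hz
  have h1 := hasDerivAt_integral_mul_sub (U := u) h.isOpen hK hKS
    (by filter_upwards [hn] with t ht using h.cont_space t ht)
    ((h.weak t₀ ht₀).bdd K hK hKS)
    (fun y hy => (h.cont_time y (hKS hy)).continuousAt hn) hkc hk0 hkL hk'
  have h2 := h1.add ((h.weak t₀ ht₀).deriv _ hT)
  have hk'0 : ∀ y ∉ K, k' y = 0 := fun y hy =>
    (hk' y).unique ((hasDerivAt_const t₀ (0 : ℝ)).congr_of_eventuallyEq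
      (hk0.mono fun t h => h y hy))
  have h3 : ∫ y, u t₀ y * (lap (k t₀) y + k' y)
      = (∫ y, u t₀ y * k' y) + ∫ y, u t₀ y * lap (k t₀) y := by
    rw [← integral_add (integrable_mul_of_eq_zero h.isOpen (h.cont_space t₀ ht₀) hk'c hK hKS hk'0)
      (hT.integrable_mul_lap h.isOpen (h.cont_space t₀ ht₀))]
    exact integral_congr_ae (Eventually.of_forall fun y => by ring)
  rw [h3]
  refine h2.congr_of_eventuallyEq ?_
  filter_upwards [hn, hkc, hk0] with t ht htc ht0
  have i1 := integrable_mul_of_eq_zero h.isOpen (h.cont_space t ht)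
    (φ := fun y => k t y - k t₀ y) (htc.sub hc) hK hKS (fun y hy => by simp [ht0 y hy, hz y hy])
  have i2 := integrable_mul_of_eq_zero h.isOpen (h.cont_space t ht) hc hK hKS hz
  simp only [Pi.add_apply]
  rw [← integral_add i1 i2]
  exact integral_congr_ae (Eventually.of_forall fun y => by ring)

/-! ### Mollification in space -/

/-- Smooth weights supported in the ball of radius `ε`. -/
structure IsMoll (ε : ℝ) (ρ : 𝔼 → ℝ) : Prop where
  contDiff : ContDiff ℝ (⊤ : ℕ∞) ρ
  eq_zero : ∀ z ∉ closedBall (0 : 𝔼) ε, ρ z = 0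

lemma IsMoll.tsupport_subset {ε : ℝ} {ρ : 𝔼 → ℝ} (h : IsMoll ε ρ) :
    tsupport ρ ⊆ closedBall 0 ε :=
  closure_minimal (fun y hy => by by_contra h'; exact hy (h.eq_zero y h')) isClosed_closedBall

lemma IsMoll.hasCompactSupport {ε : ℝ} {ρ : 𝔼 → ℝ} (h : IsMoll ε ρ) : HasCompactSupport ρ :=
  HasCompactSupport.intro (isCompact_closedBall 0 ε) h.eq_zero

lemma IsMoll.contDiff_two {ε : ℝ} {ρ : 𝔼 → ℝ} (h : IsMoll ε ρ) : ContDiff ℝ 2 ρ :=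
  h.contDiff.of_le (WithTop.coe_le_coe.2 le_top)

lemma IsMoll.fderiv_apply {ε : ℝ} {ρ : 𝔼 → ℝ} (h : IsMoll ε ρ) (v : 𝔼) :
    IsMoll ε (fun z => fderiv ℝ ρ z v) := by
  refine ⟨(h.contDiff.fderiv_right (m := (⊤ : ℕ∞)) (by simp)).clm_apply contDiff_const,
    fun z hz => ?_⟩
  exact eq_zero_of_notMem_tsupport (φ := fun z => fderiv ℝ ρ z v) z fun h' =>
    hz (h.tsupport_subset (tsupport_fderiv_apply_subset ℝ _ h'))

lemma IsMoll.lap {ε : ℝ} {ρ : 𝔼 → ℝ} (h : IsMoll ε ρ) : IsMoll ε (lap ρ) := by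
  refine ⟨ContDiff.sum fun i _ => ((h.fderiv_apply (𝐞 i)).fderiv_apply (𝐞 i)).contDiff,
    fun z hz => Finset.sum_eq_zero fun i _ => ?_⟩
  exact ((h.fderiv_apply (𝐞 i)).fderiv_apply (𝐞 i)).eq_zero z hz

lemma IsMoll.exists_lipschitz {ε : ℝ} {ρ : 𝔼 → ℝ} (h : IsMoll ε ρ) :
    ∃ L : ℝ, ∀ x y, |ρ x - ρ y| ≤ L * ‖x - y‖ := by
  obtain ⟨L, hL⟩ := h.contDiff.lipschitzWith_of_hasCompactSupport h.hasCompactSupport (by simp)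
  exact ⟨L, fun x y => by simpa [Real.dist_eq, dist_eq_norm] using hL.dist_le_mul x y⟩

/-- The mollification `(u(t) ∗ ρ)(x)`. -/
def moll (u : ℝ → 𝔼 → ℝ) (ρ : 𝔼 → ℝ) (t : ℝ) (x : 𝔼) : ℝ := ∫ y, u t y * ρ (x - y)

lemma IsMoll.sub_eq_zero {ε r r' : ℝ} {c x y : 𝔼} {ρ : 𝔼 → ℝ} (h : IsMoll ε ρ)
    (hx : x ∈ ball c r) (hr : r + ε ≤ r') (hy : y ∉ closedBall c r') : ρ (x - y) = 0 := by
  refine h.eq_zero _ fun h' => hy ?_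
  rw [mem_closedBall, dist_zero_right, ← dist_eq_norm, dist_comm] at h'
  rw [mem_ball] at hx
  rw [mem_closedBall]
  linarith [dist_triangle y x c]

lemma exists_mem_ball_lt {c x : 𝔼} {r : ℝ} (hx : x ∈ ball c r) : ∃ r' < r, x ∈ ball c r' :=
  let ⟨r', h1, h2⟩ := exists_between (mem_ball.1 hx)
  ⟨r', h2, h1⟩

lemma hasDerivAt_path_weight {ε : ℝ} {ρ : 𝔼 → ℝ} (h : IsMoll ε ρ) (z v y : 𝔼) (t : ℝ) :
    HasDerivAt (fun s : ℝ => ρ (z + s • v - y)) (fderiv ℝ ρ (z + t • v - y) v) t := by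
  have h1 : HasDerivAt (fun s : ℝ => z + s • v - y) v t := by
    simpa using (((hasDerivAt_id t).smul_const v).const_add z).sub_const y
  exact ((h.contDiff.differentiable (by simp)) _).hasFDerivAt.comp_hasDerivAt t h1

section Moll

variable {u : ℝ → EuclideanSpace ℝ (Fin n) → ℝ} {a b r ε : ℝ} {c : EuclideanSpace ℝ (Fin n)}

lemma WeakHeat.hasDerivAt_moll_path (h : WeakHeat u a b (ball c r)) {ρ : 𝔼 → ℝ}
    (hρ : IsMoll ε ρ) {t : ℝ} (ht : t ∈ Ioo a b) (z v : 𝔼) (hx : z + t • v ∈ ball c (r - ε)) :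
    HasDerivAt (fun s => moll u ρ s (z + s • v))
      (moll u (lap ρ) t (z + t • v) + moll u (fun w => fderiv ℝ ρ w v) t (z + t • v)) t := by
  obtain ⟨r', hr', hxr'⟩ := exists_mem_ball_lt hx
  have hpath : Continuous fun s : ℝ => z + s • v := by fun_prop
  have hev : ∀ᶠ s in 𝓝 t, z + s • v ∈ ball c r' :=
    hpath.continuousAt.eventually_mem (isOpen_ball.mem_nhds hxr')
  obtain ⟨L, hL⟩ := hρ.exists_lipschitz
  have hS : closedBall c (r' + ε) ⊆ ball c r := closedBall_subset_ball (by linarith)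
  have key := h.hasDerivAt_integral (k := fun s y => ρ (z + s • v - y))
    (k' := fun y => fderiv ℝ ρ (z + t • v - y) v) ht (isCompact_closedBall c (r' + ε)) hS
    (Eventually.of_forall fun s => hρ.contDiff.continuous.comp (by fun_prop))
    (hev.mono fun s hs y hy => hρ.sub_eq_zero hs le_rfl hy)
    ⟨L * ‖v‖, Eventually.of_forall fun s y => ?_⟩
    (fun y => hasDerivAt_path_weight hρ z v y t)
    (hρ.contDiff_two.comp (contDiff_const.sub contDiff_id))
    ((hρ.fderiv_apply v).contDiff.continuous.comp (by fun_prop))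
  · refine key.congr_deriv ?_
    unfold moll
    have hz : ∀ {ρ' : 𝔼 → ℝ}, IsMoll ε ρ' →
        Integrable fun y => u t y * ρ' (z + t • v - y) := fun h' =>
      integrable_mul_of_eq_zero h.isOpen (h.cont_space t ht)
        (h'.contDiff.continuous.comp (by fun_prop)) (isCompact_closedBall c (r' + ε)) hS
        fun y hy => h'.sub_eq_zero hxr' le_rfl hy
    rw [← integral_add (hz hρ.lap) (hz (hρ.fderiv_apply v))]
    refine integral_congr_ae (Eventually.of_forall fun y => ?_)
    simp only [lap_comp_sub hρ.contDiff_two, mul_add]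
  · refine (hL _ _).trans (le_of_eq ?_)
    rw [show z + s • v - y - (z + t • v - y) = (s - t) • v by module, norm_smul, Real.norm_eq_abs]
    ring

lemma WeakHeat.hasDerivAt_moll_time (h : WeakHeat u a b (ball c r)) {ρ : 𝔼 → ℝ}
    (hρ : IsMoll ε ρ) {t : ℝ} (ht : t ∈ Ioo a b) {x : 𝔼} (hx : x ∈ ball c (r - ε)) :
    HasDerivAt (fun s => moll u ρ s x) (moll u (lap ρ) t x) t := by
  have h1 := h.hasDerivAt_moll_path hρ ht x 0 (by simpa using hx)
  simpa [moll] using h1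

lemma WeakHeat.hasDerivAt_moll_space (h : WeakHeat u a b (ball c r)) {ρ : 𝔼 → ℝ}
    (hρ : IsMoll ε ρ) {t : ℝ} (ht : t ∈ Ioo a b) (z v : 𝔼) {s₀ : ℝ}
    (hx : z + s₀ • v ∈ ball c (r - ε)) :
    HasDerivAt (fun s : ℝ => moll u ρ t (z + s • v))
      (moll u (fun w => fderiv ℝ ρ w v) t (z + s₀ • v)) s₀ := by
  obtain ⟨r', hr', hxr'⟩ := exists_mem_ball_lt hx
  have hpath : Continuous fun s : ℝ => z + s • v := by fun_prop
  have hev : ∀ᶠ s in 𝓝 s₀, z + s • v ∈ ball c r' :=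
    hpath.continuousAt.eventually_mem (isOpen_ball.mem_nhds hxr')
  obtain ⟨L, hL⟩ := hρ.exists_lipschitz
  have hS : closedBall c (r' + ε) ⊆ ball c r := closedBall_subset_ball (by linarith)
  have hK := isCompact_closedBall c (r' + ε)
  obtain ⟨M, hM⟩ := (h.weak t ht).bdd _ hK hS
  have key := hasDerivAt_integral_mul_sub (U := fun _ => u t)
    (k := fun s y => ρ (z + s • v - y)) (t₀ := s₀)
    (k' := fun y => fderiv ℝ ρ (z + s₀ • v - y) v) h.isOpen hK hS
    (Eventually.of_forall fun _ => h.cont_space t ht)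
    ⟨M, Eventually.of_forall fun _ => hM.self_of_nhds⟩ (fun _ _ => continuousAt_const)
    (Eventually.of_forall fun s => hρ.contDiff.continuous.comp (by fun_prop))
    (hev.mono fun s hs y hy => hρ.sub_eq_zero hs le_rfl hy)
    ⟨L * ‖v‖, Eventually.of_forall fun s y => ?_⟩
    (fun y => hasDerivAt_path_weight hρ z v y s₀)
  · have hz : ∀ s : ℝ, z + s • v ∈ ball c r' →
        Integrable fun y => u t y * ρ (z + s • v - y) := fun s hs =>
      integrable_mul_of_eq_zero h.isOpen (h.cont_space t ht)
        (hρ.contDiff.continuous.comp (by fun_prop)) hK hS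
        fun y hy => hρ.sub_eq_zero hs le_rfl hy
    refine (key.add_const (moll u ρ t (z + s₀ • v))).congr_of_eventuallyEq ?_
    filter_upwards [hev] with s hs
    unfold moll
    rw [← integral_add _ (hz s₀ hxr')]
    · exact integral_congr_ae (Eventually.of_forall fun y => by ring)
    · simp only [mul_sub]
      exact (hz s hs).sub (hz s₀ hxr')
  · refine (hL _ _).trans (le_of_eq ?_)
    rw [show z + s • v - y - (z + s₀ • v - y) = (s - s₀) • v by module, norm_smul,
      Real.norm_eq_abs]
    ring

lemma WeakHeat.continuousOn_moll (h : WeakHeat u a b (ball c r)) {ρ : 𝔼 → ℝ}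
    (hρ : IsMoll ε ρ) :
    ContinuousOn (fun p : ℝ × 𝔼 => moll u ρ p.1 p.2) (Ioo a b ×ˢ ball c (r - ε)) := by
  rintro ⟨t, x⟩ ⟨ht, hx⟩
  refine ContinuousAt.continuousWithinAt ?_
  obtain ⟨r', hr', hxr'⟩ := exists_mem_ball_lt hx
  have hS : closedBall c (r' + ε) ⊆ ball c r := closedBall_subset_ball (by linarith)
  have hK := isCompact_closedBall c (r' + ε)
  obtain ⟨M, hM⟩ := (h.weak t ht).bdd _ hK hS
  obtain ⟨B, hB⟩ := hρ.hasCompactSupport.exists_bound_of_continuous hρ.contDiff.continuous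
  have e1 : ∀ᶠ p : ℝ × 𝔼 in 𝓝 (t, x), p.1 ∈ Ioo a b ∧ ∀ y ∈ closedBall c (r' + ε),
      |u p.1 y| ≤ M :=
    (continuous_fst.continuousAt (x := (t, x))).eventually
      ((isOpen_Ioo.eventually_mem ht).and hM)
  have e2 : ∀ᶠ p : ℝ × 𝔼 in 𝓝 (t, x), p.2 ∈ ball c r' :=
    (continuous_snd.continuousAt (x := (t, x))).eventually (isOpen_ball.eventually_mem hxr')
  refine tendsto_integral_filter_of_dominated_convergence
    ((closedBall c (r' + ε)).indicator fun _ => M * B) ?_ ?_ ?_ ?_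
  · filter_upwards [e1, e2] with p hp hp2
    exact (continuous_mul_of_eq_zero h.isOpen (h.cont_space _ hp.1)
      (hρ.contDiff.continuous.comp (by fun_prop)) hK hS
      fun y hy => hρ.sub_eq_zero hp2 le_rfl hy).aestronglyMeasurable
  · filter_upwards [e1, e2] with p hp hp2
    refine Eventually.of_forall fun y => ?_
    by_cases hy : y ∈ closedBall c (r' + ε)
    · rw [indicator_of_mem hy, norm_mul]
      exact mul_le_mul (hp.2 y hy) (hB _) (norm_nonneg _) ((abs_nonneg _).trans (hp.2 y hy))
    · rw [indicator_of_notMem hy, hρ.sub_eq_zero hp2 le_rfl hy]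
      simp
  · exact (integrable_indicator_iff hK.measurableSet).2 (integrableOn_const hK.measure_lt_top.ne)
  · refine Eventually.of_forall fun y => ?_
    by_cases hy : y ∈ closedBall c (r' + ε)
    · have h1 : ContinuousAt (fun s => u s y) t :=
        (h.cont_time y (hS hy)).continuousAt (isOpen_Ioo.mem_nhds ht)
      exact (h1.tendsto.comp (continuous_fst.tendsto (t, x))).mul
        ((hρ.contDiff.continuous.comp (continuous_snd.sub continuous_const)).tendsto (t, x))
    · rw [hρ.sub_eq_zero hxr' le_rfl hy, mul_zero]
      refine tendsto_const_nhds.congr' ?_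
      filter_upwards [e2] with p hp2
      rw [hρ.sub_eq_zero hp2 le_rfl hy, mul_zero]

end Moll

/-! ### The differential Harnack estimate -/

lemma second_deriv_nonpos_of_isLocalMax {g g' : ℝ → ℝ} {g'' s : ℝ} (hmax : IsLocalMax g s)
    (h1 : ∀ᶠ x in 𝓝 s, HasDerivAt g (g' x) x) (h2 : HasDerivAt g' g'' s) : g'' ≤ 0 := by
  by_contra! hpos
  have hd : deriv g =ᶠ[𝓝 s] g' := h1.mono fun x hx => hx.deriv
  have hdd : deriv (deriv g) s = g'' := (h2.congr_of_eventuallyEq hd).deriv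
  have hmin : IsLocalMin g s := isLocalMin_of_deriv_deriv_pos (by rwa [hdd]) hmax.deriv_eq_zero
    h1.self_of_nhds.continuousAt
  have hconst : g =ᶠ[𝓝 s] fun _ => g s := by
    filter_upwards [hmax, hmin] with x hx hx' using le_antisymm hx hx'
  have h0 : deriv g =ᶠ[𝓝 s] fun _ => 0 := by
    filter_upwards [hconst.eventuallyEq_nhds] with x hx
    rw [hx.deriv_eq]; simp
  have : deriv (deriv g) s = 0 := by rw [h0.deriv_eq]; simp
  linarith

lemma deriv_nonneg_of_le_left {g : ℝ → ℝ} {g' s₀ s : ℝ} (hs : s₀ < s) (h : HasDerivAt g g' s)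
    (hle : ∀ x ∈ Ioo s₀ s, g x ≤ g s) : 0 ≤ g' := by
  have h1 : Tendsto (slope g s) (𝓝[<] s) (𝓝 g') :=
    (hasDerivAt_iff_tendsto_slope.1 h).mono_left
      (nhdsWithin_mono _ fun x hx => (ne_of_lt hx : x ≠ s))
  refine ge_of_tendsto h1 ?_
  filter_upwards [Ioo_mem_nhdsLT hs] with x hx
  rw [slope_def_field]
  exact div_nonneg_of_nonpos (by linarith [hle x hx]) (by linarith [hx.2])

/-- Second derivative test for `Σ aᵢ²/b - α w - b B`. -/
lemma second_deriv_harnack_nonpos {a a' a'' : Fin n → ℝ → ℝ} {b b' b'' w w' w'' B B' B'' : ℝ → ℝ}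
    {α : ℝ} (ha : ∀ i, ∀ᶠ h in 𝓝 0, HasDerivAt (a i) (a' i h) h)
    (ha' : ∀ i, HasDerivAt (a' i) (a'' i 0) 0)
    (hb : ∀ᶠ h in 𝓝 0, HasDerivAt b (b' h) h) (hb' : HasDerivAt b' (b'' 0) 0)
    (hw : ∀ᶠ h in 𝓝 0, HasDerivAt w (w' h) h) (hw' : HasDerivAt w' (w'' 0) 0)
    (hB : ∀ᶠ h in 𝓝 0, HasDerivAt B (B' h) h) (hB' : HasDerivAt B' (B'' 0) 0)
    (hpos : 0 < b 0)
    (hmax : IsLocalMax (fun h => ∑ i, a i h ^ 2 / b h - α * w h - b h * B h) 0) :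
    ∑ i, (2 * a' i 0 ^ 2 / b 0 + 2 * a i 0 * a'' i 0 / b 0 - 4 * a i 0 * a' i 0 * b' 0 / b 0 ^ 2
        - a i 0 ^ 2 * b'' 0 / b 0 ^ 2 + 2 * a i 0 ^ 2 * b' 0 ^ 2 / b 0 ^ 3)
      - α * w'' 0 - b'' 0 * B 0 - 2 * b' 0 * B' 0 - b 0 * B'' 0 ≤ 0 := by
  have hbc := hb.self_of_nhds
  have hne : ∀ᶠ h in 𝓝 (0 : ℝ), b h ≠ 0 := hbc.continuousAt.eventually_ne hpos.ne'
  have hall : ∀ᶠ h in 𝓝 (0 : ℝ), ∀ i, HasDerivAt (a i) (a' i h) h := eventually_all.2 ha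
  have d1 : ∀ᶠ h in 𝓝 (0 : ℝ),
      HasDerivAt (fun h => ∑ i, a i h ^ 2 / b h - α * w h - b h * B h)
        (∑ i, (2 * a i h * a' i h / b h - a i h ^ 2 * b' h / b h ^ 2) - α * w' h
          - (b' h * B h + b h * B' h)) h := by
    filter_upwards [hall, hb, hw, hB, hne] with h h1 h2 h3 h4 h5
    refine ((HasDerivAt.fun_sum fun i _ => ?_).sub (h3.const_mul α)).sub (h2.mul h4)
    refine (((h1 i).pow 2).div h2 h5).congr_deriv ?_
    simp
    field_simp
  refine second_deriv_nonpos_of_isLocalMax hmax d1 ?_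
  have hne0 : b 0 ≠ 0 := hpos.ne'
  have e : HasDerivAt (fun h => ∑ i, (2 * a i h * a' i h / b h - a i h ^ 2 * b' h / b h ^ 2)
      - α * w' h - (b' h * B h + b h * B' h))
      (∑ i, (2 * a' i 0 ^ 2 / b 0 + 2 * a i 0 * a'' i 0 / b 0
        - 4 * a i 0 * a' i 0 * b' 0 / b 0 ^ 2
        - a i 0 ^ 2 * b'' 0 / b 0 ^ 2 + 2 * a i 0 ^ 2 * b' 0 ^ 2 / b 0 ^ 3)
      - α * w'' 0 - (b'' 0 * B 0 + b' 0 * B' 0 + (b' 0 * B' 0 + b 0 * B'' 0))) 0 := by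
    refine ((HasDerivAt.fun_sum fun i _ => ?_).sub (hw'.const_mul α)).sub
      ((hb'.mul hB.self_of_nhds).add (hbc.mul hB'))
    have h1 := (ha i).self_of_nhds
    refine ((((h1.const_mul 2).mul (ha' i)).div hbc hne0).sub
      (((h1.pow 2).mul hb').div (hbc.pow 2) (pow_ne_zero 2 hne0))).congr_deriv ?_
    simp
    field_simp
    ring
  refine e.congr_deriv ?_
  ring

/-- The constant in front of the spatial barrier. -/
def barrierConst (n : ℕ) (α : ℝ) : ℝ := n * (2 * n + 13) * α ^ 2 * (1 + α ^ 2 / (α - 1))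

set_option maxHeartbeats 1000000 in
/-- At an interior positive maximum the Li–Yau quantity violates the heat equation. -/
lemma harnack_algebra (hn : 0 < n) {v w r τ α D : ℝ} {p y : Fin n → ℝ} {q : Fin n → Fin n → ℝ}
    (hv : 0 < v) (hr : 0 < r) (hτ : 0 < τ) (hα : 1 < α) (hw : w = ∑ j, q j j)
    (hD : D = r ^ 2 - ∑ j, y j ^ 2) (hD0 : 0 < D)
    (hQ : v * (n * α ^ 2 / (2 * τ) + barrierConst n α * r ^ 2 / D ^ 2)
      < ∑ i, p i ^ 2 / v - α * w)
    (hI : 0 ≤ -∑ i, ∑ j, 2 / v * (q i j - p i * p j / v) ^ 2 + v * (n * α ^ 2 / (2 * τ ^ 2))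
      + 2 * ∑ j, p j * (4 * barrierConst n α * r ^ 2 * y j / D ^ 3)
      + v * ∑ j, (24 * barrierConst n α * r ^ 2 * y j ^ 2 / D ^ 4
        + 4 * barrierConst n α * r ^ 2 / D ^ 3)) : False := by
  have hn' : (1 : ℝ) ≤ n := by exact_mod_cast hn
  have hα1 : 0 < α - 1 := by linarith
  set A := barrierConst n α with hA
  set κ := α ^ 2 / (α - 1) with hκ
  have hκ0 : 0 < κ := by positivity
  have hA0 : 0 < A := by rw [hA, barrierConst]; positivity
  set s := ∑ j, y j ^ 2 with hs
  have hs0 : 0 ≤ s := Finset.sum_nonneg fun j _ => sq_nonneg _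
  set ω := ∑ j, (p j / v) ^ 2 with hω
  have hω0 : 0 ≤ ω := Finset.sum_nonneg fun j _ => sq_nonneg _
  set ψ := A * r ^ 2 / D ^ 2 with hψ
  have hψ0 : 0 < ψ := by positivity
  set X := w / v - ω with hX
  -- the trace part of the Hessian
  have hX' : X = ∑ j, (q j j / v - (p j / v) ^ 2) := by
    rw [hX, hw, hω, Finset.sum_div, Finset.sum_sub_distrib]
  have htr : X ^ 2 ≤ n * ∑ i, ∑ j, (q i j / v - p i / v * (p j / v)) ^ 2 := by
    rw [hX']
    have h1 := sq_sum_le_card_mul_sum_sq (s := (Finset.univ : Finset (Fin n)))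
      (f := fun j => q j j / v - (p j / v) ^ 2)
    simp only [Finset.card_univ, Fintype.card_fin] at h1
    refine h1.trans (mul_le_mul_of_nonneg_left (Finset.sum_le_sum fun i _ => ?_) (by positivity))
    have h2 := Finset.single_le_sum (f := fun j => (q i j / v - p i / v * (p j / v)) ^ 2)
      (fun j _ => sq_nonneg _) (Finset.mem_univ i)
    refine le_trans (le_of_eq ?_) h2
    ring
  have hH : ∑ i, ∑ j, 2 / v * (q i j - p i * p j / v) ^ 2
      = v * (2 * ∑ i, ∑ j, (q i j / v - p i / v * (p j / v)) ^ 2) := by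
    simp only [Finset.mul_sum]
    refine Finset.sum_congr rfl fun i _ => Finset.sum_congr rfl fun j _ => ?_
    field_simp
  have hG : 2 * ∑ j, p j * (4 * A * r ^ 2 * y j / D ^ 3)
      = v * ∑ j, 2 * (p j / v) * (4 * A * r ^ 2 * y j / D ^ 3) := by
    simp only [Finset.mul_sum]
    refine Finset.sum_congr rfl fun j _ => ?_
    field_simp
  set lam := 4 * (α - 1) / (n * α ^ 2) * ψ with hlam
  have hlam0 : 0 < lam := by positivity
  have hG2 : ∑ j, 2 * (p j / v) * (4 * A * r ^ 2 * y j / D ^ 3)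
      ≤ lam * ω + (4 * A * r ^ 2 / D ^ 3) ^ 2 * s / lam := by
    rw [hω, hs, Finset.mul_sum, Finset.mul_sum, Finset.sum_div, ← Finset.sum_add_distrib]
    refine Finset.sum_le_sum fun j _ => ?_
    have h3 : 0 ≤ (lam * (p j / v) - 4 * A * r ^ 2 * y j / D ^ 3) ^ 2 / lam := by positivity
    have h4 : (lam * (p j / v) - 4 * A * r ^ 2 * y j / D ^ 3) ^ 2 / lam
        = lam * (p j / v) ^ 2 + (4 * A * r ^ 2 / D ^ 3) ^ 2 * y j ^ 2 / lam
          - 2 * (p j / v) * (4 * A * r ^ 2 * y j / D ^ 3) := by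
      field_simp
      ring
    linarith
  have hL : ∑ j, (24 * A * r ^ 2 * y j ^ 2 / D ^ 4 + 4 * A * r ^ 2 / D ^ 3)
      = 24 * A * r ^ 2 * s / D ^ 4 + n * (4 * A * r ^ 2 / D ^ 3) := by
    rw [Finset.sum_add_distrib, hs, ← Finset.sum_div, ← Finset.mul_sum]
    simp
  rw [hH, hG, hL] at hI
  have hI2 : 0 ≤ -(2 * ∑ i, ∑ j, (q i j / v - p i / v * (p j / v)) ^ 2) + n * α ^ 2 / (2 * τ ^ 2)
      + ∑ j, 2 * (p j / v) * (4 * A * r ^ 2 * y j / D ^ 3)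
      + (24 * A * r ^ 2 * s / D ^ 4 + n * (4 * A * r ^ 2 / D ^ 3)) := by
    refine (mul_nonneg_iff_of_pos_left hv).1 ?_
    linarith
  -- lower bound for the trace
  set β := n * α ^ 2 / (2 * τ) with hβ
  have hβ0 : 0 < β := by positivity
  have hpv : ∑ i, p i ^ 2 / v = v * ω := by
    rw [hω, Finset.mul_sum]
    refine Finset.sum_congr rfl fun i _ => ?_
    field_simp
  have hXα : β + ψ + (α - 1) * ω < -(α * X) := by
    have h5 : v * (β + ψ) < v * (ω - α * (w / v)) := by
      have : v * (ω - α * (w / v)) = v * ω - α * w := by field_simp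
      rw [this, ← hpv]; exact hQ
    have := lt_of_mul_lt_mul_left h5 hv.le
    rw [hX]; linarith
  have hXsq : (β + ψ + (α - 1) * ω) ^ 2 ≤ α ^ 2 * X ^ 2 := by
    have h0 : 0 ≤ β + ψ + (α - 1) * ω := by positivity
    have h1 := pow_le_pow_left₀ h0 hXα.le 2
    linear_combination h1
  have hexp : β ^ 2 + ψ ^ 2 + 2 * ψ * ((α - 1) * ω) ≤ (β + ψ + (α - 1) * ω) ^ 2 := by
    have h0 : 0 ≤ 2 * β * ψ + 2 * β * ((α - 1) * ω) + ((α - 1) * ω) ^ 2 := by positivity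
    linear_combination h0
  have hchain : 2 / (n * α ^ 2) * (β ^ 2 + ψ ^ 2 + 2 * ψ * ((α - 1) * ω))
      ≤ 2 * ∑ i, ∑ j, (q i j / v - p i / v * (p j / v)) ^ 2 := by
    set H2 := ∑ i, ∑ j, (q i j / v - p i / v * (p j / v)) ^ 2
    have h6 : β ^ 2 + ψ ^ 2 + 2 * ψ * ((α - 1) * ω) ≤ α ^ 2 * (n * H2) :=
      (hexp.trans hXsq).trans (mul_le_mul_of_nonneg_left htr (by positivity))
    calc 2 / (n * α ^ 2) * (β ^ 2 + ψ ^ 2 + 2 * ψ * ((α - 1) * ω))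
        ≤ 2 / (n * α ^ 2) * (α ^ 2 * (n * H2)) := mul_le_mul_of_nonneg_left h6 (by positivity)
      _ = 2 * H2 := by field_simp
  have hb2 : 2 / (n * α ^ 2) * β ^ 2 = n * α ^ 2 / (2 * τ ^ 2) := by
    rw [hβ]; field_simp
  have hl2 : 2 / (n * α ^ 2) * (2 * ψ * ((α - 1) * ω)) = lam * ω := by
    rw [hlam]; ring
  have hfin : 2 / (n * α ^ 2) * ψ ^ 2 ≤ (4 * A * r ^ 2 / D ^ 3) ^ 2 * s / lam
      + (24 * A * r ^ 2 * s / D ^ 4 + n * (4 * A * r ^ 2 / D ^ 3)) := by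
    rw [mul_add, mul_add, hb2, hl2] at hchain
    linarith
  -- contradiction with the choice of the constant
  have hsr : s ≤ r ^ 2 := by linarith
  have hDr : D ≤ r ^ 2 := by linarith
  have g1 : (4 * A * r ^ 2 / D ^ 3) ^ 2 * s / lam = 4 * n * κ * (A * r ^ 2 / D ^ 4) * s := by
    rw [hlam, hψ, hκ]; field_simp
  have g2 : n * (4 * A * r ^ 2 / D ^ 3) = 4 * n * (A * r ^ 2 / D ^ 4) * D := by
    field_simp
  have g3 : 2 / (n * α ^ 2) * ψ ^ 2 = (4 * n + 26) * (1 + κ) * (A * r ^ 2 / D ^ 4) * r ^ 2 := by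
    have : A = n * (2 * n + 13) * α ^ 2 * (1 + κ) := rfl
    rw [hψ]
    have h7 : (A * r ^ 2 / D ^ 2) ^ 2 = A * (A * r ^ 2 / D ^ 4) * r ^ 2 := by
      field_simp
    rw [h7]
    nth_rewrite 1 [this]
    field_simp
    ring
  have g4 : 24 * A * r ^ 2 * s / D ^ 4 = 24 * (A * r ^ 2 / D ^ 4) * s := by ring
  rw [g1, g2, g3, g4] at hfin
  set E := A * r ^ 2 / D ^ 4
  have hE0 : 0 < E := by positivity
  have k1 : 4 * n * κ * E * s ≤ 4 * n * κ * E * r ^ 2 := by gcongr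
  have k2 : 24 * E * s ≤ 24 * E * r ^ 2 := by gcongr
  have k3 : 4 * n * E * D ≤ 4 * n * E * r ^ 2 := by gcongr
  have k4 : 0 < E * r ^ 2 := by positivity
  have k5 : 0 < κ * (E * r ^ 2) := by positivity
  linarith

lemma hasDerivAt_barrier {β A r s y h : ℝ} (hD : r ^ 2 - (s + 2 * h * y + h ^ 2) ≠ 0) :
    HasDerivAt (fun h => β + A * r ^ 2 / (r ^ 2 - (s + 2 * h * y + h ^ 2)) ^ 2)
      (4 * A * r ^ 2 * (y + h) / (r ^ 2 - (s + 2 * h * y + h ^ 2)) ^ 3) h := by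
  have h1 : HasDerivAt (fun h : ℝ => r ^ 2 - (s + 2 * h * y + h ^ 2)) (-(2 * y + 2 * h)) h := by
    refine (((((hasDerivAt_id h).const_mul 2).mul_const y).const_add s).add
      ((hasDerivAt_id h).pow 2)).const_sub (r ^ 2) |>.congr_deriv ?_
    simp
  refine (((hasDerivAt_const h (A * r ^ 2)).div (h1.pow 2) (pow_ne_zero 2 hD)).const_add
    β).congr_deriv ?_
  simp only [Pi.pow_apply]
  field_simp
  push_cast
  ring

lemma hasDerivAt_deriv_barrier {A r s y : ℝ} (hD : r ^ 2 - s ≠ 0) :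
    HasDerivAt (fun h => 4 * A * r ^ 2 * (y + h) / (r ^ 2 - (s + 2 * h * y + h ^ 2)) ^ 3)
      (24 * A * r ^ 2 * y ^ 2 / (r ^ 2 - s) ^ 4 + 4 * A * r ^ 2 / (r ^ 2 - s) ^ 3) 0 := by
  have h1 : HasDerivAt (fun h : ℝ => r ^ 2 - (s + 2 * h * y + h ^ 2)) (-(2 * y)) 0 := by
    refine (((((hasDerivAt_id (0 : ℝ)).const_mul 2).mul_const y).const_add s).add
      ((hasDerivAt_id (0 : ℝ)).pow 2)).const_sub (r ^ 2) |>.congr_deriv ?_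
    simp
  have hD' : r ^ 2 - (s + 2 * 0 * y + 0 ^ 2) ≠ 0 := by simpa using hD
  refine ((((hasDerivAt_id (0 : ℝ)).const_add y).const_mul (4 * A * r ^ 2)).div (h1.pow 3)
    (pow_ne_zero 3 hD')).congr_deriv ?_
  simp
  field_simp
  ring

lemma norm_add_single_sub_sq (x c : 𝔼) (j : Fin n) (h : ℝ) :
    ‖x + h • 𝐞 j - c‖ ^ 2 = ‖x - c‖ ^ 2 + 2 * h * (x j - c j) + h ^ 2 := by
  rw [show x + h • 𝐞 j - c = (x - c) + h • 𝐞 j by module, norm_add_sq_real, norm_smul,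
    inner_smul_right]
  simp [EuclideanSpace.inner_single_right]
  ring

lemma harnack_algebra_identity {v w α B β : ℝ} {p m d e : Fin n → ℝ} {q q₃ : Fin n → Fin n → ℝ}
    (hv : v ≠ 0) (hw : w = ∑ j, q j j) :
    (∑ i, (2 * p i * (∑ j, q₃ i j) / v - p i ^ 2 * w / v ^ 2) - α * (∑ j, m j)
        - (w * B + v * (-β)))
      - ∑ j, (∑ i, (2 * q i j ^ 2 / v + 2 * p i * q₃ i j / v - 4 * p i * q i j * p j / v ^ 2
          - p i ^ 2 * q j j / v ^ 2 + 2 * p i ^ 2 * p j ^ 2 / v ^ 3)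
        - α * m j - q j j * B - 2 * p j * d j - v * e j)
      = -∑ i, ∑ j, 2 / v * (q i j - p i * p j / v) ^ 2 + v * β + 2 * ∑ j, p j * d j
        + v * ∑ j, e j := by
  have h1 : ∑ i, (2 * p i * (∑ j, q₃ i j) / v - p i ^ 2 * w / v ^ 2)
      = ∑ j, ∑ i, (2 * p i * q₃ i j / v - p i ^ 2 * q j j / v ^ 2) := by
    rw [Finset.sum_comm]
    refine Finset.sum_congr rfl fun i _ => ?_
    rw [hw, Finset.mul_sum, Finset.sum_div, Finset.mul_sum, Finset.sum_div,
      Finset.sum_sub_distrib]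
  rw [h1, Finset.sum_comm (f := fun i j => 2 / v * (q i j - p i * p j / v) ^ 2), hw,
    Finset.mul_sum, Finset.sum_mul, Finset.mul_sum, Finset.mul_sum]
  rw [← sub_eq_zero]
  have h2 : ∀ j, ∑ i, (2 * q i j ^ 2 / v + 2 * p i * q₃ i j / v - 4 * p i * q i j * p j / v ^ 2
          - p i ^ 2 * q j j / v ^ 2 + 2 * p i ^ 2 * p j ^ 2 / v ^ 3)
      = ∑ i, (2 * p i * q₃ i j / v - p i ^ 2 * q j j / v ^ 2)
        + ∑ i, 2 / v * (q i j - p i * p j / v) ^ 2 := by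
    intro j
    rw [← Finset.sum_add_distrib]
    refine Finset.sum_congr rfl fun i _ => ?_
    field_simp
    ring
  simp only [h2, Finset.sum_sub_distrib, Finset.sum_add_distrib]
  have h3 : ∑ j, 2 * p j * d j = ∑ j, 2 * (p j * d j) :=
    Finset.sum_congr rfl fun j _ => by ring
  rw [h3]
  ring

set_option maxHeartbeats 1000000 in
/-- Local Li–Yau estimate for mollified positive weak solutions. -/
lemma WeakHeat.gradient_estimate (hn : 0 < n) {u : ℝ → 𝔼 → ℝ} {a b r ε : ℝ} {c : 𝔼}
    (h : WeakHeat u a b (ball c r)) {ρ : 𝔼 → ℝ} (hρ : IsMoll ε ρ)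
    (hpos : ∀ t ∈ Ioo a b, ∀ x ∈ ball c (r - ε), 0 < moll u ρ t x)
    {t₀ t₁ r₀ α : ℝ} (ht₀ : a < t₀) (ht₀₁ : t₀ < t₁) (ht₁ : t₁ < b) (hr₀ : 0 < r₀)
    (hr₀' : r₀ < r - ε) (hα : 1 < α) {x : 𝔼} (hx : x ∈ ball c r₀) :
    ∑ i, moll u (fun z => fderiv ℝ ρ z (𝐞 i)) t₁ x ^ 2 / moll u ρ t₁ x
        - α * moll u (lap ρ) t₁ x
      ≤ moll u ρ t₁ x * (n * α ^ 2 / (2 * (t₁ - t₀))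
          + barrierConst n α * r₀ ^ 2 / (r₀ ^ 2 - ‖x - c‖ ^ 2) ^ 2) := by
  by_contra! hcon
  have hn' : (1 : ℝ) ≤ n := by exact_mod_cast hn
  have hα1 : 0 < α - 1 := by linarith
  set A := barrierConst n α with hA
  have hA0 : 0 < A := by rw [hA, barrierConst]; positivity
  set V : ℝ → 𝔼 → ℝ := moll u ρ with hV
  set p : Fin n → ℝ → 𝔼 → ℝ := fun i => moll u (fun z => fderiv ℝ ρ z (𝐞 i)) with hp
  set w : ℝ → 𝔼 → ℝ := moll u (lap ρ) with hw
  set P : ℝ → 𝔼 → ℝ := fun t x => ∑ i, p i t x ^ 2 / V t x - α * w t x with hP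
  set B : ℝ → 𝔼 → ℝ := fun t x => n * α ^ 2 / (2 * (t - t₀))
    + A * r₀ ^ 2 / (r₀ ^ 2 - ‖x - c‖ ^ 2) ^ 2 with hB
  set Ω : Set (ℝ × 𝔼) := Icc t₀ t₁ ×ˢ closedBall c r₀ with hΩ
  have hΩc : IsCompact Ω := isCompact_Icc.prod (isCompact_closedBall c r₀)
  have hsub : Ω ⊆ Ioo a b ×ˢ ball c (r - ε) :=
    prod_mono (Icc_subset_Ioo ht₀ ht₁) (closedBall_subset_ball hr₀')
  have hVc : ContinuousOn (fun z : ℝ × 𝔼 => V z.1 z.2) Ω := (h.continuousOn_moll hρ).mono hsub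
  have hVp : ∀ z ∈ Ω, 0 < V z.1 z.2 := fun z hz => hpos _ (hsub hz).1 _ (hsub hz).2
  have hPc : ContinuousOn (fun z : ℝ × 𝔼 => P z.1 z.2) Ω := by
    refine ContinuousOn.sub (continuousOn_finsetSum _ fun i _ => ContinuousOn.div
      (ContinuousOn.pow ((h.continuousOn_moll (hρ.fderiv_apply (𝐞 i))).mono hsub) 2) hVc
      fun z hz => (hVp z hz).ne')
      (ContinuousOn.mul continuousOn_const ((h.continuousOn_moll hρ.lap).mono hsub))
  obtain ⟨N₀, hN₀⟩ := hΩc.bddAbove_image (hPc.div hVc fun z hz => (hVp z hz).ne')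
  set N := max N₀ 1 with hN
  have hN1 : 1 ≤ N := le_max_right _ _
  have hPN : ∀ z ∈ Ω, P z.1 z.2 ≤ V z.1 z.2 * N := by
    intro z hz
    have h1 : P z.1 z.2 / V z.1 z.2 ≤ N := (hN₀ ⟨z, hz, rfl⟩).trans (le_max_left _ _)
    rw [div_le_iff₀ (hVp z hz)] at h1
    linarith
  -- the region where the barrier does not exceed `N`
  set E : Set (ℝ × 𝔼) := Ω ∩ {z | n * α ^ 2 ≤ N * (2 * (z.1 - t₀))
    ∧ A * r₀ ^ 2 ≤ N * (r₀ ^ 2 - ‖z.2 - c‖ ^ 2) ^ 2} with hE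
  have hEc : IsCompact E := by
    refine hΩc.inter_right ?_
    rw [ofPred_and]
    refine (isClosed_le ?_ ?_).inter (isClosed_le ?_ ?_) <;> fun_prop
  have hEt : ∀ z ∈ E, t₀ < z.1 ∧ ‖z.2 - c‖ ^ 2 < r₀ ^ 2 := by
    rintro z ⟨hz, hz1, hz2⟩
    constructor
    · have : 0 < N * (2 * (z.1 - t₀)) := lt_of_lt_of_le (by positivity) hz1
      have := pos_of_mul_pos_right this (by positivity)
      linarith
    · have h0 : 0 < N * (r₀ ^ 2 - ‖z.2 - c‖ ^ 2) ^ 2 := lt_of_lt_of_le (by positivity) hz2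
      have h1 := pos_of_mul_pos_right h0 (by positivity)
      have h2 : ‖z.2 - c‖ ≤ r₀ := by simpa [dist_eq_norm] using hz.2
      have h3 : ‖z.2 - c‖ ^ 2 ≤ r₀ ^ 2 := pow_le_pow_left₀ (norm_nonneg _) h2 2
      rcases h3.lt_or_eq with h4 | h4
      · exact h4
      · rw [h4] at h1; simp at h1
  set Φ : ℝ × 𝔼 → ℝ := fun z => P z.1 z.2 - V z.1 z.2 * B z.1 z.2 with hΦ
  have hΦc : ContinuousOn Φ E := by
    have hEΩ : E ⊆ Ω := inter_subset_left
    refine (hPc.mono hEΩ).sub ((hVc.mono hEΩ).mul ?_)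
    refine ContinuousOn.add ?_ ?_
    · refine ContinuousOn.div (by fun_prop) (by fun_prop) fun z hz => ?_
      have := (hEt z hz).1
      exact mul_ne_zero two_ne_zero (by linarith)
    · refine ContinuousOn.div (by fun_prop) (by fun_prop) fun z hz => ?_
      have := (hEt z hz).2
      exact pow_ne_zero 2 (by linarith)
  have hball : ∀ z ∈ ball c r₀, ‖z - c‖ ^ 2 < r₀ ^ 2 := fun z hz =>
    pow_lt_pow_left₀ (by simpa [dist_eq_norm] using hz) (norm_nonneg _) two_ne_zero
  have hout : ∀ z : ℝ × 𝔼, z.1 ∈ Ioc t₀ t₁ → z.2 ∈ ball c r₀ → z ∉ E → Φ z ≤ 0 := by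
    intro z hz1 hz2 hzE
    have hzΩ : z ∈ Ω := ⟨⟨hz1.1.le, hz1.2⟩, ball_subset_closedBall hz2⟩
    have hτ : 0 < 2 * (z.1 - t₀) := by linarith [hz1.1]
    have hD : 0 < (r₀ ^ 2 - ‖z.2 - c‖ ^ 2) ^ 2 := by
      have := hball _ hz2
      exact pow_pos (by linarith) 2
    have h1 : 0 < n * α ^ 2 / (2 * (z.1 - t₀)) := by positivity
    have h2 : 0 < A * r₀ ^ 2 / (r₀ ^ 2 - ‖z.2 - c‖ ^ 2) ^ 2 := by positivity
    have hBN : N ≤ B z.1 z.2 := by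
      by_contra! hlt
      refine hzE ⟨hzΩ, ?_, ?_⟩
      · have : n * α ^ 2 / (2 * (z.1 - t₀)) ≤ N := by
          simp only [hB] at hlt; linarith
        rwa [div_le_iff₀ hτ] at this
      · have : A * r₀ ^ 2 / (r₀ ^ 2 - ‖z.2 - c‖ ^ 2) ^ 2 ≤ N := by
          simp only [hB] at hlt; linarith
        rwa [div_le_iff₀ hD] at this
    have h3 := hPN z hzΩ
    have h4 := mul_le_mul_of_nonneg_left hBN (hVp z hzΩ).le
    simp only [hΦ]
    linarith
  have hpos0 : 0 < Φ (t₁, x) := by simpa only [hΦ, hP, hB, sub_pos] using hcon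
  have hmemE : (t₁, x) ∈ E := by
    by_contra hne
    exact absurd (hout (t₁, x) ⟨ht₀₁, le_rfl⟩ hx hne) (not_le.2 hpos0)
  obtain ⟨⟨t, z⟩, hzE, hzmax⟩ := hEc.exists_isMaxOn ⟨_, hmemE⟩ hΦc
  have hΦz : 0 < Φ (t, z) := hpos0.trans_le (hzmax hmemE)
  have hmax : ∀ t' ∈ Ioc t₀ t₁, ∀ z' ∈ ball c r₀, Φ (t', z') ≤ Φ (t, z) := by
    intro t' ht' z' hz'
    by_cases hm : (t', z') ∈ E
    · exact hzmax hm
    · exact (hout (t', z') ht' hz' hm).trans hΦz.le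
  have htt : t₀ < t := (hEt _ hzE).1
  have ht : t ∈ Ioo a b := (hsub hzE.1).1
  have htle : t ≤ t₁ := hzE.1.1.2
  have hzD : ‖z - c‖ ^ 2 < r₀ ^ 2 := (hEt _ hzE).2
  have hzr : z ∈ ball c r₀ := by
    rw [mem_ball, dist_eq_norm]
    exact lt_of_pow_lt_pow_left₀ 2 hr₀.le hzD
  have hzr' : z ∈ ball c (r - ε) := ball_subset_ball hr₀'.le hzr
  have hVz : 0 < V t z := hpos t ht z hzr'
  -- spatial second derivatives
  set q : Fin n → Fin n → ℝ := fun i j =>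
    moll u (fun z => fderiv ℝ (fun z => fderiv ℝ ρ z (𝐞 i)) z (𝐞 j)) t z with hq
  set q₃ : Fin n → Fin n → ℝ := fun i j =>
    moll u (fun z => fderiv ℝ (fun z => fderiv ℝ (fun z => fderiv ℝ ρ z (𝐞 i)) z (𝐞 j)) z (𝐞 j))
      t z with hq₃
  set m : Fin n → ℝ := fun j =>
    moll u (fun z => fderiv ℝ (fun z => fderiv ℝ (lap ρ) z (𝐞 j)) z (𝐞 j)) t z with hm
  set D := r₀ ^ 2 - ‖z - c‖ ^ 2 with hD
  have hD0 : 0 < D := by linarith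
  have hspace : ∀ j : Fin n,
      ∑ i, (2 * q i j ^ 2 / V t z + 2 * p i t z * q₃ i j / V t z
        - 4 * p i t z * q i j * p j t z / V t z ^ 2
        - p i t z ^ 2 * q j j / V t z ^ 2 + 2 * p i t z ^ 2 * p j t z ^ 2 / V t z ^ 3)
      - α * m j - q j j * B t z - 2 * p j t z * (4 * A * r₀ ^ 2 * (z j - c j) / D ^ 3)
      - V t z * (24 * A * r₀ ^ 2 * (z j - c j) ^ 2 / D ^ 4 + 4 * A * r₀ ^ 2 / D ^ 3) ≤ 0 := by
    intro j
    have hpath : Continuous fun s : ℝ => z + s • 𝐞 j := by fun_prop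
    have hev : ∀ᶠ s in 𝓝 (0 : ℝ), z + s • 𝐞 j ∈ ball c r₀ :=
      hpath.continuousAt.eventually_mem (isOpen_ball.mem_nhds (by simpa using hzr))
    have hev' : ∀ᶠ s in 𝓝 (0 : ℝ), z + s • 𝐞 j ∈ ball c (r - ε) :=
      hev.mono fun s hs => ball_subset_ball hr₀'.le hs
    have hz0 : z + (0 : ℝ) • 𝐞 j ∈ ball c (r - ε) := by simpa using hzr'
    have key := second_deriv_harnack_nonpos (α := α)
      (a := fun i s => p i t (z + s • 𝐞 j))
      (a' := fun i s => moll u (fun z => fderiv ℝ (fun z => fderiv ℝ ρ z (𝐞 i)) z (𝐞 j)) t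
        (z + s • 𝐞 j))
      (a'' := fun i _ => q₃ i j)
      (b := fun s => V t (z + s • 𝐞 j)) (b' := fun s => p j t (z + s • 𝐞 j))
      (b'' := fun _ => q j j)
      (w := fun s => w t (z + s • 𝐞 j))
      (w' := fun s => moll u (fun z => fderiv ℝ (lap ρ) z (𝐞 j)) t (z + s • 𝐞 j))
      (w'' := fun _ => m j)
      (B := fun s => n * α ^ 2 / (2 * (t - t₀)) + A * r₀ ^ 2 /
        (r₀ ^ 2 - (‖z - c‖ ^ 2 + 2 * s * (z j - c j) + s ^ 2)) ^ 2)
      (B' := fun s => 4 * A * r₀ ^ 2 * ((z j - c j) + s) /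
        (r₀ ^ 2 - (‖z - c‖ ^ 2 + 2 * s * (z j - c j) + s ^ 2)) ^ 3)
      (B'' := fun _ => 24 * A * r₀ ^ 2 * (z j - c j) ^ 2 / D ^ 4 + 4 * A * r₀ ^ 2 / D ^ 3)
      (fun i => hev'.mono fun s hs => h.hasDerivAt_moll_space (hρ.fderiv_apply (𝐞 i)) ht z _ hs)
      (fun i => by
        simpa [hq₃] using h.hasDerivAt_moll_space
          ((hρ.fderiv_apply (𝐞 i)).fderiv_apply (𝐞 j)) ht z _ hz0)
      (hev'.mono fun s hs => h.hasDerivAt_moll_space hρ ht z _ hs)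
      (by simpa [hq] using h.hasDerivAt_moll_space (hρ.fderiv_apply (𝐞 j)) ht z _ hz0)
      (hev'.mono fun s hs => h.hasDerivAt_moll_space hρ.lap ht z _ hs)
      (by simpa [hm] using h.hasDerivAt_moll_space (hρ.lap.fderiv_apply (𝐞 j)) ht z _ hz0)
      (hev.mono fun s hs => hasDerivAt_barrier (by
        rw [← norm_add_single_sub_sq]
        have := hball _ hs
        linarith))
      (hasDerivAt_deriv_barrier hD0.ne')
      (by simpa using hVz) ?_
    · simpa [hq, hB, hD] using key
    · filter_upwards [hev] with s hs
      have := hmax t ⟨htt, htle⟩ _ hs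
      simp only [hΦ, hP, hB, norm_add_single_sub_sq] at this
      simpa using this
  -- time derivative
  have htime : 0 ≤ ∑ i, (2 * p i t z * (∑ j, q₃ i j) / V t z - p i t z ^ 2 * w t z / V t z ^ 2)
      - α * (∑ j, m j) - (w t z * B t z + V t z * (-(n * α ^ 2 / (2 * (t - t₀) ^ 2)))) := by
    have hsum : ∀ f : Fin n → 𝔼 → ℝ, (∀ j, IsMoll ε (f j)) →
        moll u (fun z => ∑ j, f j z) t z = ∑ j, moll u (f j) t z := by
      intro f hf
      unfold moll
      simp only [Finset.mul_sum]
      obtain ⟨r', hr', hzr''⟩ := exists_mem_ball_lt hzr'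
      refine integral_finsetSum _ fun j _ => ?_
      exact integrable_mul_of_eq_zero h.isOpen (h.cont_space t ht)
        ((hf j).contDiff.continuous.comp (by fun_prop)) (isCompact_closedBall c (r' + ε))
        (closedBall_subset_ball (by linarith)) fun y hy => (hf j).sub_eq_zero hzr'' le_rfl hy
    have dp : ∀ i, HasDerivAt (fun s => p i s z) (∑ j, q₃ i j) t := fun i => by
      rw [← hsum _ fun j => ((hρ.fderiv_apply (𝐞 i)).fderiv_apply (𝐞 j)).fderiv_apply (𝐞 j)]
      exact h.hasDerivAt_moll_time (hρ.fderiv_apply (𝐞 i)) ht hzr'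
    have dw : HasDerivAt (fun s => w s z) (∑ j, m j) t := by
      rw [← hsum _ fun j => (hρ.lap.fderiv_apply (𝐞 j)).fderiv_apply (𝐞 j)]
      exact h.hasDerivAt_moll_time hρ.lap ht hzr'
    have dV : HasDerivAt (fun s => V s z) (w t z) t := h.hasDerivAt_moll_time hρ ht hzr'
    have hne : 2 * (t - t₀) ≠ 0 := mul_ne_zero two_ne_zero (by linarith)
    have dB : HasDerivAt (fun s => B s z) (-(n * α ^ 2 / (2 * (t - t₀) ^ 2))) t := by
      refine (((hasDerivAt_const t ((n : ℝ) * α ^ 2)).div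
        (((hasDerivAt_id t).sub_const t₀).const_mul 2) hne).add_const _).congr_deriv ?_
      have : t - t₀ ≠ 0 := by linarith
      simp
      field_simp
    refine deriv_nonneg_of_le_left htt (g := fun s => Φ (s, z)) ?_ fun s hs =>
      hmax s ⟨hs.1, hs.2.le.trans htle⟩ z hzr
    refine ((HasDerivAt.fun_sum fun i _ => ?_).sub (dw.const_mul α)).sub (dV.mul dB)
    refine (((dp i).pow 2).div dV hVz.ne').congr_deriv ?_
    simp
    field_simp
  have hwq : w t z = ∑ j, q j j := by
    obtain ⟨r', hr', hzr''⟩ := exists_mem_ball_lt hzr'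
    simp only [hw, hq, moll, lap, Finset.mul_sum]
    refine integral_finsetSum _ fun j _ => ?_
    have hj := (hρ.fderiv_apply (𝐞 j)).fderiv_apply (𝐞 j)
    exact integrable_mul_of_eq_zero h.isOpen (h.cont_space t ht)
      (hj.contDiff.continuous.comp (by fun_prop)) (isCompact_closedBall c (r' + ε))
      (closedBall_subset_ball (by linarith)) fun y hy => hj.sub_eq_zero hzr'' le_rfl hy
  have hnorm : ‖z - c‖ ^ 2 = ∑ j, (z j - c j) ^ 2 := by
    simp [EuclideanSpace.norm_sq_eq]
  refine harnack_algebra hn (v := V t z) (w := w t z) (r := r₀) (τ := t - t₀) (α := α) (D := D)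
    (p := fun i => p i t z) (y := fun j => z j - c j) (q := q) hVz hr₀ (by linarith) hα hwq
    (by rw [hD, hnorm]) hD0 ?_ ?_
  · simp only [hΦ, hP, hB, sub_pos] at hΦz
    exact hΦz
  · have hs := Finset.sum_nonpos fun j (_ : j ∈ Finset.univ) => hspace j
    refine (sub_nonneg.2 (hs.trans htime)).trans (le_of_eq ?_)
    exact harnack_algebra_identity hVz.ne' hwq

/-! ### The Harnack inequality for weak solutions -/

lemma WeakHeat.moll_fderiv_apply {u : ℝ → 𝔼 → ℝ} {ρ : 𝔼 → ℝ} {a b t r ε : ℝ} {c x : 𝔼}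
    (h : WeakHeat u a b (ball c r)) (hρ : IsMoll ε ρ) (ht : t ∈ Ioo a b)
    (hx : x ∈ ball c (r - ε)) (v : 𝔼) :
    moll u (fun z => fderiv ℝ ρ z v) t x
      = ∑ i, v i * moll u (fun z => fderiv ℝ ρ z (𝐞 i)) t x := by
  obtain ⟨r', hr', hx'⟩ := exists_mem_ball_lt hx
  have hi (i : Fin n) : Integrable fun y => u t y * fderiv ℝ ρ (x - y) (𝐞 i) :=
    integrable_mul_of_eq_zero h.isOpen (h.cont_space t ht)
      (φ := fun y => fderiv ℝ ρ (x - y) (𝐞 i))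
      ((hρ.fderiv_apply (𝐞 i)).contDiff.continuous.comp (continuous_const.sub continuous_id))
      (isCompact_closedBall c (r' + ε)) (closedBall_subset_ball (by linarith))
      (fun y hy => (hρ.fderiv_apply (𝐞 i)).sub_eq_zero hx' le_rfl hy)
  unfold moll
  simp_rw [← integral_const_mul]
  rw [← integral_finsetSum _ fun i _ => (hi i).const_mul _]
  refine integral_congr_ae (Eventually.of_forall fun y => ?_)
  have hv : v = ∑ i, v i • 𝐞 i := by
    ext j
    simp [Finset.sum_apply, Pi.single_apply]
  simp only
  conv_lhs => rw [hv]
  rw [map_sum, Finset.mul_sum]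
  refine Finset.sum_congr rfl fun i _ => ?_
  rw [map_smul, smul_eq_mul]
  ring

/-- Completing the square along a path. -/
lemma path_deriv_nonneg {V W D α s : ℝ} {B : ℝ} (v p : Fin n → ℝ) (hV : 0 < V) (hα : 0 < α)
    (hs : 0 < s) (h : ∑ i, p i ^ 2 / V - α * W ≤ V * (n * α ^ 2 / (2 * s) + B)) (hB : B ≤ D) :
    0 ≤ (W + ∑ i, v i * p i) / V + n * α / 2 * (1 / s) + (α * ∑ i, v i ^ 2) / 4 + D / α := by
  have h1 : 0 ≤ ∑ i, (p i + α * V * v i / 2) ^ 2 / (V * α) :=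
    Finset.sum_nonneg fun i _ => by positivity
  have h2 : ∑ i, (p i + α * V * v i / 2) ^ 2 / (V * α)
      = (∑ i, p i ^ 2 / V) / α + ∑ i, v i * p i + V * ((α * ∑ i, v i ^ 2) / 4) := by
    rw [Finset.sum_div, Finset.mul_sum, Finset.sum_div, Finset.mul_sum, ← Finset.sum_add_distrib,
      ← Finset.sum_add_distrib]
    refine Finset.sum_congr rfl fun i _ => ?_
    field_simp
    ring
  rw [h2] at h1
  have h3 : (∑ i, p i ^ 2 / V) / α ≤ W + V * (n * α / 2 * (1 / s) + D / α) := by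
    rw [div_le_iff₀ hα]
    have : V * (n * α ^ 2 / (2 * s) + B) ≤ V * (n * α ^ 2 / (2 * s) + D) := by gcongr
    have e : (W + V * (n * α / 2 * (1 / s) + D / α)) * α
        = α * W + V * (n * α ^ 2 / (2 * s) + D) := by
      field_simp
    rw [e]
    linarith
  have h4 : (W + ∑ i, v i * p i) / V + n * α / 2 * (1 / s) + (α * ∑ i, v i ^ 2) / 4 + D / α
      = (W + ∑ i, v i * p i + V * (n * α / 2 * (1 / s) + D / α)
        + V * ((α * ∑ i, v i ^ 2) / 4)) / V := by
    field_simp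
    ring
  rw [h4]
  apply div_nonneg _ hV.le
  linarith

/-- The Harnack inequality for mollified solutions. -/
lemma WeakHeat.harnack_moll {u : ℝ → 𝔼 → ℝ} {ρ : 𝔼 → ℝ} {a b t₀ t₁ t₂ r r₀ s ε α D : ℝ}
    {c x₁ x₂ : 𝔼} (hn : 0 < n) (h : WeakHeat u a b (ball c r)) (hρ : IsMoll ε ρ)
    (hpos : ∀ t ∈ Ioo a b, ∀ x ∈ ball c (r - ε), 0 < moll u ρ t x)
    (ht₀ : a < t₀) (ht₁ : t₀ < t₁) (ht₁₂ : t₁ < t₂) (ht₂ : t₂ < b) (hr₀ : 0 < r₀)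
    (hr₀' : r₀ < r - ε) (hs : s < r₀) (hα : 1 < α)
    (hx₁ : x₁ ∈ closedBall c s) (hx₂ : x₂ ∈ closedBall c s)
    (hD : barrierConst n α * r₀ ^ 2 / (r₀ ^ 2 - s ^ 2) ^ 2 ≤ D) :
    moll u ρ t₁ x₁ ≤ moll u ρ t₂ x₂ * ((t₂ - t₀) / (t₁ - t₀)) ^ ((n : ℝ) * α / 2) *
      Real.exp (α * ‖x₁ - x₂‖ ^ 2 / (4 * (t₂ - t₁)) + D / α * (t₂ - t₁)) := by
  have hΔ : 0 < t₂ - t₁ := sub_pos.2 ht₁₂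
  have hs0 : 0 ≤ s := (norm_nonneg _).trans (mem_closedBall_iff_norm.1 hx₁)
  set v : 𝔼 := (t₂ - t₁)⁻¹ • (x₂ - x₁) with hv
  set z : 𝔼 := x₁ - t₁ • v with hz
  have hz1 : z + t₁ • v = x₁ := by simp [hz]
  have hz2 : z + t₂ • v = x₂ := by
    have : z + t₂ • v = x₁ + (t₂ - t₁) • v := by rw [hz, sub_smul]; abel
    rw [this, hv, smul_smul, mul_inv_cancel₀ hΔ.ne', one_smul]; abel
  have hpath : ∀ t ∈ Icc t₁ t₂, z + t • v ∈ closedBall c s := by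
    intro t ht
    refine (convex_closedBall c s).segment_subset hx₁ hx₂ ?_
    rw [segment_eq_image_lineMap]
    refine ⟨(t - t₁) / (t₂ - t₁), ⟨div_nonneg (by linarith [ht.1]) hΔ.le,
      (div_le_one hΔ).2 (by linarith [ht.2])⟩, ?_⟩
    rw [AffineMap.lineMap_apply_module', hz, hv, smul_smul, smul_smul, ← sub_eq_zero]
    rw [div_eq_mul_inv, sub_mul, sub_smul]
    abel
  have hvn : α * ‖v‖ ^ 2 / 4 * (t₂ - t₁) = α * ‖x₁ - x₂‖ ^ 2 / (4 * (t₂ - t₁)) := by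
    rw [hv, norm_smul, norm_inv, Real.norm_of_nonneg hΔ.le, norm_sub_rev x₁]
    field_simp
  have hsum : ∑ i, v i ^ 2 = ‖v‖ ^ 2 := by
    rw [EuclideanSpace.norm_sq_eq]; simp
  set G : ℝ → ℝ := fun t => Real.log (moll u ρ t (z + t • v)) + n * α / 2 * Real.log (t - t₀)
    + (α * ‖v‖ ^ 2 / 4 + D / α) * t with hG
  have hball : closedBall c s ⊆ ball c (r - ε) := closedBall_subset_ball (by linarith)
  have hder : ∀ t ∈ Icc t₁ t₂, HasDerivAt G
      ((moll u (lap ρ) t (z + t • v) + moll u (fun w => fderiv ℝ ρ w v) t (z + t • v))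
        / moll u ρ t (z + t • v) + n * α / 2 * (1 / (t - t₀)) + (α * ‖v‖ ^ 2 / 4 + D / α)) t := by
    intro t ht
    have hI : t ∈ Ioo a b := ⟨by linarith [ht.1], by linarith [ht.2]⟩
    have h1 := (h.hasDerivAt_moll_path hρ hI z v (hball (hpath t ht))).log
      (hpos t hI _ (hball (hpath t ht))).ne'
    have h2 : HasDerivAt (fun t => Real.log (t - t₀)) (1 / (t - t₀)) t :=
      ((hasDerivAt_id t).sub_const t₀).log (by simp only [id]; linarith [ht.1])
    have h3 : HasDerivAt (fun t : ℝ => (α * ‖v‖ ^ 2 / 4 + D / α) * t)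
      (α * ‖v‖ ^ 2 / 4 + D / α) t := by simpa using (hasDerivAt_id t).const_mul _
    exact (h1.add (h2.const_mul _)).add h3
  have hmono : MonotoneOn G (Icc t₁ t₂) := by
    refine monotoneOn_of_deriv_nonneg (convex_Icc _ _)
      (fun t ht => (hder t ht).continuousAt.continuousWithinAt) ?_ ?_
    · rw [interior_Icc]
      exact fun t ht => (hder t (Ioo_subset_Icc_self ht)).differentiableAt.differentiableWithinAt
    · rw [interior_Icc]
      intro t ht'
      have ht := Ioo_subset_Icc_self ht'
      have hI : t ∈ Ioo a b := ⟨by linarith [ht.1], by linarith [ht.2]⟩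
      have hxs := hpath t ht
      rw [(hder t ht).deriv, h.moll_fderiv_apply hρ hI (hball hxs), ← hsum]
      have hns : ‖z + t • v - c‖ ≤ s := mem_closedBall_iff_norm.1 hxs
      have hB : barrierConst n α * r₀ ^ 2 / (r₀ ^ 2 - ‖z + t • v - c‖ ^ 2) ^ 2 ≤ D := by
        refine le_trans ?_ hD
        have hb : 0 ≤ barrierConst n α := by
          unfold barrierConst
          have : 0 < α - 1 := by linarith
          positivity
        have h1 : ‖z + t • v - c‖ ^ 2 ≤ s ^ 2 := by gcongr
        have h2 : 0 < r₀ ^ 2 - s ^ 2 := by nlinarith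
        gcongr
      have hg := h.gradient_estimate hn hρ hpos ht₀ (by linarith [ht.1] : t₀ < t)
        (by linarith [ht.2] : t < b) hr₀ hr₀' hα (closedBall_subset_ball hs hxs)
      have := path_deriv_nonneg (fun i => v i)
        (fun i => moll u (fun z => fderiv ℝ ρ z (𝐞 i)) t (z + t • v))
        (hpos t hI _ (hball hxs)) (by linarith) (by linarith [ht.1] : 0 < t - t₀) hg hB
      linarith
  have hfin := hmono (left_mem_Icc.2 ht₁₂.le) (right_mem_Icc.2 ht₁₂.le) ht₁₂.le
  simp only [hG, hz1, hz2] at hfin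
  have hV1 := hpos t₁ ⟨by linarith, by linarith⟩ x₁ (hball hx₁)
  have hV2 := hpos t₂ ⟨by linarith, by linarith⟩ x₂ (hball hx₂)
  have q1 : 0 < t₁ - t₀ := by linarith
  have q2 : 0 < t₂ - t₀ := by linarith
  have hq := div_pos q2 q1
  rw [← Real.log_le_log_iff hV1 (by positivity), Real.log_mul (by positivity) (by positivity),
    Real.log_mul hV2.ne' (by positivity), Real.log_exp, Real.log_rpow hq,
    Real.log_div q2.ne' q1.ne', ← hvn]
  linarith

/-- Nonnegative smooth weights of mass one concentrated near the origin. -/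
lemma exists_moll (ε : ℝ) (hε : 0 < ε) :
    ∃ ρ : 𝔼 → ℝ, IsMoll ε ρ ∧ (∀ z, 0 ≤ ρ z) ∧ ∫ z, ρ z = 1 := by
  let f : ContDiffBump (0 : 𝔼) := ⟨ε / 2, ε, by positivity, by linarith⟩
  refine ⟨f.normed volume, ⟨f.contDiff_normed, fun z hz => ?_⟩, f.nonneg_normed,
    f.integral_normed⟩
  have h := f.support_normed_eq (μ := (volume : Measure 𝔼))
  by_contra h'
  have : z ∈ Function.support (f.normed volume) := h'
  rw [h] at this
  exact hz (ball_subset_closedBall this)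

lemma WeakHeat.moll_pos {u : ℝ → 𝔼 → ℝ} {ρ : 𝔼 → ℝ} {a b t r ε : ℝ} {c x : 𝔼}
    (h : WeakHeat u a b (ball c r)) (hρ : IsMoll ε ρ) (h0 : ∀ z, 0 ≤ ρ z) (h1 : ∫ z, ρ z = 1)
    (ht : t ∈ Ioo a b) (hx : x ∈ ball c (r - ε)) : 0 < moll u ρ t x := by
  obtain ⟨r', hr', hx'⟩ := exists_mem_ball_lt hx
  have hc : Continuous fun y => ρ (x - y) :=
    hρ.contDiff.continuous.comp (continuous_const.sub continuous_id)
  have hz : ∀ y ∉ closedBall c (r' + ε), ρ (x - y) = 0 :=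
    fun y hy => hρ.sub_eq_zero hx' le_rfl hy
  have hS : closedBall c (r' + ε) ⊆ ball c r := closedBall_subset_ball (by linarith)
  have hcont := continuous_mul_of_eq_zero h.isOpen (h.cont_space t ht) hc
    (isCompact_closedBall c (r' + ε)) hS hz
  have hnn : ∀ y, 0 ≤ u t y * ρ (x - y) := fun y => by
    by_cases hy : y ∈ closedBall c (r' + ε)
    · exact mul_nonneg (h.pos t ht y (hS hy)).le (h0 _)
    · simp [hz y hy]
  have hex : ∃ z, ρ z ≠ 0 := by
    by_contra! h'
    simp [h'] at h1
  obtain ⟨z, hz0⟩ := hex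
  refine (integral_pos_iff_support_of_nonneg hnn (integrable_mul_of_eq_zero h.isOpen
    (h.cont_space t ht) hc (isCompact_closedBall c (r' + ε)) hS hz)).2 ?_
  refine (hcont.isOpen_support).measure_pos _ ⟨x - z, ?_⟩
  have hz' : ρ (x - (x - z)) ≠ 0 := by simpa using hz0
  have hm : x - z ∈ closedBall c (r' + ε) := by
    by_contra h'
    exact hz' (hz _ h')
  exact mul_ne_zero (h.pos t ht _ (hS hm)).ne' hz'

/-- Mollifications converge pointwise. -/
lemma abs_moll_sub_le {u : ℝ → 𝔼 → ℝ} {ρ : 𝔼 → ℝ} {t ε η : ℝ} {x : 𝔼} {S : Set 𝔼}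
    (hS : IsOpen S) (hu : ContinuousOn (u t) S) (hρ : IsMoll ε ρ) (h0 : ∀ z, 0 ≤ ρ z)
    (h1 : ∫ z, ρ z = 1) (hx : closedBall x ε ⊆ S)
    (hη : ∀ y ∈ closedBall x ε, |u t y - u t x| ≤ η) : |moll u ρ t x - u t x| ≤ η := by
  have hz : ∀ y ∉ closedBall x ε, ρ (x - y) = 0 := fun y hy => hρ.eq_zero _ fun h' => hy (by
    rwa [mem_closedBall, dist_zero_right, ← dist_eq_norm, dist_comm] at h')
  have hc : Continuous fun y => ρ (x - y) :=
    hρ.contDiff.continuous.comp (continuous_const.sub continuous_id)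
  have hi := integrable_mul_of_eq_zero hS hu hc (isCompact_closedBall x ε) hx hz
  have h1' : ∫ y, ρ (x - y) = 1 := by rw [integral_sub_left_eq_self ρ volume x, h1]
  have hi1 : Integrable fun y => ρ (x - y) :=
    Integrable.of_integral_ne_zero (by rw [h1']; norm_num)
  have e : moll u ρ t x - u t x = ∫ y, (u t y - u t x) * ρ (x - y) := by
    simp_rw [sub_mul]
    rw [integral_sub hi (hi1.const_mul _), integral_const_mul, h1', mul_one]
    rfl
  rw [e]
  calc |∫ y, (u t y - u t x) * ρ (x - y)| ≤ ∫ y, η * ρ (x - y) := by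
        refine norm_integral_le_of_norm_le (f := fun y => (u t y - u t x) * ρ (x - y)) (hi1.const_mul η) (Eventually.of_forall fun y => ?_)
        by_cases hy : y ∈ closedBall x ε
        · rw [norm_mul, Real.norm_eq_abs, Real.norm_of_nonneg (h0 _)]
          exact mul_le_mul_of_nonneg_right (hη y hy) (h0 _)
        · simp [hz y hy]
    _ = η := by rw [integral_const_mul, h1', mul_one]

lemma exists_moll_close {u : ℝ → 𝔼 → ℝ} {t η : ℝ} {x : 𝔼} {S : Set 𝔼}
    (hS : IsOpen S) (hu : ContinuousOn (u t) S) (hx : x ∈ S) (hη : 0 < η) :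
    ∃ ε₀ > 0, ∀ ε ≤ ε₀, ∀ ρ : 𝔼 → ℝ, IsMoll ε ρ → (∀ z, 0 ≤ ρ z) → ∫ z, ρ z = 1 →
      |moll u ρ t x - u t x| ≤ η := by
  have h1 : ∀ᶠ y in 𝓝 x, y ∈ S ∧ |u t y - u t x| ≤ η := by
    have := (hu.continuousAt (hS.mem_nhds hx)).tendsto.eventually (closedBall_mem_nhds _ hη)
    filter_upwards [hS.mem_nhds hx, this] with y hy hy'
    exact ⟨hy, by simpa [Real.dist_eq] using hy'⟩
  obtain ⟨ε₀, hε₀, hb⟩ := nhds_basis_closedBall.eventually_iff.1 h1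
  exact ⟨ε₀, hε₀, fun ε hε ρ hρ h0 h1 => abs_moll_sub_le hS hu hρ h0 h1
    (fun y hy => (hb (closedBall_subset_closedBall hε hy)).1)
    (fun y hy => (hb (closedBall_subset_closedBall hε hy)).2)⟩

/-- The Harnack inequality for weak solutions. -/
theorem WeakHeat.harnack {u : ℝ → 𝔼 → ℝ} {a b t₁ t₂ r α : ℝ}
    {c x₁ x₂ : 𝔼} (hn : 0 < n) (hr : 0 < r) (h : WeakHeat u a b (ball c r))
    (ht₁ : a < t₁) (ht₁₂ : t₁ < t₂) (ht₂ : t₂ < b) (hα : 1 < α)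
    (hx₁ : x₁ ∈ closedBall c (2 * r / 3)) (hx₂ : x₂ ∈ closedBall c (2 * r / 3)) :
    u t₁ x₁ ≤ u t₂ x₂ * ((t₂ - a) / (t₁ - a)) ^ ((n : ℝ) * α / 2) *
      Real.exp (α * ‖x₁ - x₂‖ ^ 2 / (4 * (t₂ - t₁))
        + 7 * barrierConst n α / r ^ 2 / α * (t₂ - t₁)) := by
  set D := 7 * barrierConst n α / r ^ 2 with hD
  have hb : 0 ≤ barrierConst n α := by
    unfold barrierConst
    have : 0 < α - 1 := by linarith
    positivity
  set E := Real.exp (α * ‖x₁ - x₂‖ ^ 2 / (4 * (t₂ - t₁)) + D / α * (t₂ - t₁)) with hE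
  have hS : closedBall c (2 * r / 3) ⊆ ball c r := closedBall_subset_ball (by linarith)
  have hI1 : t₁ ∈ Ioo a b := ⟨ht₁, by linarith⟩
  have hI2 : t₂ ∈ Ioo a b := ⟨by linarith, ht₂⟩
  have key : ∀ t₀ ∈ Ioo a t₁,
      u t₁ x₁ ≤ u t₂ x₂ * ((t₂ - t₀) / (t₁ - t₀)) ^ ((n : ℝ) * α / 2) * E := by
    intro t₀ ht₀
    set Q := ((t₂ - t₀) / (t₁ - t₀)) ^ ((n : ℝ) * α / 2) with hQ
    have hQ0 : 0 ≤ Q := Real.rpow_nonneg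
      (div_nonneg (by linarith [ht₀.2]) (by linarith [ht₀.2])) _
    have hE0 : 0 < E := Real.exp_pos _
    have hmain : ∀ η > 0, u t₁ x₁ ≤ (u t₂ x₂ + η) * Q * E + η := by
      intro η hη
      obtain ⟨ε₁, hε₁, k1⟩ := exists_moll_close h.isOpen (h.cont_space t₁ hI1) (hS hx₁) hη
      obtain ⟨ε₂, hε₂, k2⟩ := exists_moll_close h.isOpen (h.cont_space t₂ hI2) (hS hx₂) hη
      set ε := min (min ε₁ ε₂) (r / 20)
      have hε : 0 < ε := by positivity
      have hε' : ε ≤ r / 20 := min_le_right _ _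
      obtain ⟨ρ, hρ, h0, h1⟩ := exists_moll (n := n) ε hε
      have e1 := abs_le.1 (k1 ε ((min_le_left _ _).trans (min_le_left _ _)) ρ hρ h0 h1)
      have e2 := abs_le.1 (k2 ε ((min_le_left _ _).trans (min_le_right _ _)) ρ hρ h0 h1)
      have := h.harnack_moll hn hρ (fun t ht x hx => h.moll_pos hρ h0 h1 ht hx) ht₀.1 ht₀.2 ht₁₂
        ht₂ (r₀ := 9 / 10 * r) (by positivity) (by linarith) (s := 2 * r / 3) (by linarith) hα
        hx₁ hx₂ (D := D) (by
          rw [hD]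
          have e : barrierConst n α * (9 / 10 * r) ^ 2 / ((9 / 10 * r) ^ 2 - (2 * r / 3) ^ 2) ^ 2
            = (656100 / 108241) * (barrierConst n α / r ^ 2) := by
            field_simp
            ring
          rw [e, mul_div_assoc]
          gcongr
          norm_num)
      calc u t₁ x₁ ≤ moll u ρ t₁ x₁ + η := by linarith
        _ ≤ moll u ρ t₂ x₂ * Q * E + η := by linarith
        _ ≤ _ := by gcongr; linarith
    have hlim : Tendsto (fun η : ℝ => (u t₂ x₂ + η) * Q * E + η) (𝓝[>] 0)
        (𝓝 ((u t₂ x₂ + 0) * Q * E + 0)) :=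
      tendsto_nhdsWithin_of_tendsto_nhds (Continuous.tendsto (by fun_prop) 0)
    have := ge_of_tendsto hlim (by filter_upwards [self_mem_nhdsWithin] with η hη using hmain η hη)
    simpa using this
  have hlim : Tendsto (fun t₀ : ℝ => u t₂ x₂ * ((t₂ - t₀) / (t₁ - t₀)) ^ ((n : ℝ) * α / 2) * E)
      (𝓝[>] a) (𝓝 (u t₂ x₂ * ((t₂ - a) / (t₁ - a)) ^ ((n : ℝ) * α / 2) * E)) := by
    refine tendsto_nhdsWithin_of_tendsto_nhds (ContinuousAt.tendsto ?_)
    have hd : ContinuousAt (fun t₀ : ℝ => (t₂ - t₀) / (t₁ - t₀)) a :=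
      ContinuousAt.div (by fun_prop) (by fun_prop) (by linarith)
    exact ((continuousAt_const.mul (hd.rpow_const (Or.inr (by positivity)))).mul
      continuousAt_const)
  exact ge_of_tendsto hlim (by
    filter_upwards [Ioo_mem_nhdsGT ht₁] with t₀ ht₀ using key t₀ ht₀)

/-! ### A truncated heat kernel -/

/-- A smooth cutoff in the squared radius: `1` for `q ≤ ρ² / 4`, `0` for `q ≥ ρ² / 2`. -/
def cutoff (ρ q : ℝ) : ℝ := Real.smoothTransition (2 - 4 * q / ρ ^ 2)

lemma cutoff_nonneg (ρ q : ℝ) : 0 ≤ cutoff ρ q := Real.smoothTransition.nonneg _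

lemma cutoff_le_one (ρ q : ℝ) : cutoff ρ q ≤ 1 := Real.smoothTransition.le_one _

lemma cutoff_eq_one {ρ q : ℝ} (hρ : 0 < ρ) (hq : q ≤ ρ ^ 2 / 4) : cutoff ρ q = 1 := by
  refine Real.smoothTransition.one_of_one_le ?_
  have : 4 * q / ρ ^ 2 ≤ 1 := (div_le_one (by positivity)).2 (by linarith)
  linarith

lemma cutoff_eq_zero {ρ q : ℝ} (hρ : 0 < ρ) (hq : ρ ^ 2 / 2 ≤ q) : cutoff ρ q = 0 := by
  refine Real.smoothTransition.zero_of_nonpos ?_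
  have : 2 ≤ 4 * q / ρ ^ 2 := (le_div_iff₀ (by positivity)).2 (by linarith)
  linarith

lemma contDiff_cutoff (ρ : ℝ) {m : ℕ∞} : ContDiff ℝ m (cutoff ρ) :=
  Real.smoothTransition.contDiff.comp (by fun_prop)

lemma deriv_eq_zero_off_Icc {f : ℝ → ℝ} {a b c d : ℝ} (ha : ∀ q < a, f q = c)
    (hb : ∀ q > b, f q = d) : ∀ q ∉ Icc a b, deriv f q = 0 := by
  intro q hq
  rw [mem_Icc, not_and_or, not_le, not_le] at hq
  rcases hq with hq | hq
  · have : f =ᶠ[𝓝 q] fun _ => c := by filter_upwards [Iio_mem_nhds hq] with p hp using ha p hp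
    rw [this.deriv_eq, deriv_const]
  · have : f =ᶠ[𝓝 q] fun _ => d := by filter_upwards [Ioi_mem_nhds hq] with p hp using hb p hp
    rw [this.deriv_eq, deriv_const]

lemma exists_bound_of_eq_zero_off_Icc {f : ℝ → ℝ} {a b : ℝ} (hf : Continuous f)
    (h : ∀ q ∉ Icc a b, f q = 0) : ∃ D, 0 ≤ D ∧ ∀ q, |f q| ≤ D := by
  obtain ⟨D, hD⟩ := isCompact_Icc.exists_bound_of_continuousOn (hf.continuousOn (s := Icc a b))
  refine ⟨|D|, abs_nonneg D, fun q => ?_⟩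
  by_cases hq : q ∈ Icc a b
  · exact (hD q hq).trans (le_abs_self D)
  · simp [h q hq]

lemma exists_cutoff_derivs {ρ : ℝ} (hρ : 0 < ρ) : ∃ θ' θ'' : ℝ → ℝ, ∃ D, 0 ≤ D ∧
    (∀ q, HasDerivAt (cutoff ρ) (θ' q) q) ∧ (∀ q, HasDerivAt θ' (θ'' q) q) ∧
    (∀ q, |θ' q| ≤ D) ∧ (∀ q, |θ'' q| ≤ D) ∧
    ∀ q ∉ Icc (ρ ^ 2 / 4) (ρ ^ 2 / 2), θ' q = 0 ∧ θ'' q = 0 := by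
  have h2 : ContDiff ℝ 2 (cutoff ρ) := contDiff_cutoff ρ (m := 2)
  have h1 : ContDiff ℝ 1 (deriv (cutoff ρ)) := h2.deriv' (n := 1)
  have h0 : Continuous (deriv (deriv (cutoff ρ))) := h1.continuous_deriv le_rfl
  have z1 := deriv_eq_zero_off_Icc (f := cutoff ρ) (a := ρ ^ 2 / 4) (b := ρ ^ 2 / 2)
    (fun q hq => cutoff_eq_one hρ hq.le) (fun q hq => cutoff_eq_zero hρ (le_of_lt hq))
  have z2 := deriv_eq_zero_off_Icc (f := deriv (cutoff ρ)) (a := ρ ^ 2 / 4) (b := ρ ^ 2 / 2)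
    (fun q hq => z1 q (fun h => by linarith [h.1])) (fun q hq => z1 q (fun h => by linarith [h.2]))
  obtain ⟨D1, p1, hD1⟩ := exists_bound_of_eq_zero_off_Icc h1.continuous z1
  obtain ⟨D2, p2, hD2⟩ := exists_bound_of_eq_zero_off_Icc h0 z2
  refine ⟨deriv (cutoff ρ), deriv (deriv (cutoff ρ)), D1 + D2, by positivity,
    fun q => (h2.differentiable (by norm_num) q).hasDerivAt,
    fun q => (h1.differentiable (by norm_num) q).hasDerivAt,
    fun q => (hD1 q).trans (by linarith), fun q => (hD2 q).trans (by linarith),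
    fun q hq => ⟨z1 q hq, z2 q hq⟩⟩

/-- The amplitude `(4πτ)^{-n/2}` of the heat kernel. -/
def gaussAmp (n : ℕ) (τ : ℝ) : ℝ := (4 * π * τ) ^ (-((n : ℝ) / 2))

lemma gaussAmp_pos (n : ℕ) {τ : ℝ} (hτ : 0 < τ) : 0 < gaussAmp n τ :=
  Real.rpow_pos_of_pos (by positivity) _

lemma gaussAmp_anti (n : ℕ) {τ τ' : ℝ} (hτ : 0 < τ) (h : τ ≤ τ') :
    gaussAmp n τ' ≤ gaussAmp n τ :=
  Real.rpow_le_rpow_of_nonpos (by positivity) (by gcongr)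
    (neg_nonpos.2 (by positivity))

lemma hasDerivAt_gaussAmp (n : ℕ) {τ : ℝ} (hτ : 0 < τ) :
    HasDerivAt (gaussAmp n) (gaussAmp n τ * (-(n / (2 * τ)))) τ := by
  have h1 : HasDerivAt (fun τ : ℝ => 4 * π * τ) (4 * π) τ := by
    simpa using (hasDerivAt_id τ).const_mul (4 * π)
  have h0 : 4 * π * τ ≠ 0 := by positivity
  refine (h1.rpow_const (p := -((n : ℝ) / 2)) (Or.inl h0)).congr_deriv ?_
  rw [gaussAmp, Real.rpow_sub_one h0]
  field_simp

/-- The Gaussian is bounded away from the origin, uniformly in small time. -/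
lemma gaussAmp_mul_exp_le (n : ℕ) {ρ τ q : ℝ} (hρ : 0 < ρ) (hτ : 0 < τ) (hτ1 : τ ≤ 1)
    (hq : ρ ^ 2 / 4 ≤ q) :
    gaussAmp n τ * Real.exp (-q / (4 * τ)) / τ ≤ (n + 1).factorial * (16 / ρ ^ 2) ^ (n + 1) := by
  have h1 : gaussAmp n τ ≤ (τ ^ n)⁻¹ := by
    calc gaussAmp n τ ≤ τ ^ (-((n : ℝ) / 2)) := by
          refine Real.rpow_le_rpow_of_nonpos hτ ?_ (neg_nonpos.2 (by positivity))
          nlinarith [Real.pi_gt_three]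
      _ ≤ τ ^ (-(n : ℝ)) := Real.rpow_le_rpow_of_exponent_ge hτ hτ1 (by
          have : (0 : ℝ) ≤ n := by positivity
          linarith)
      _ = (τ ^ n)⁻¹ := by rw [Real.rpow_neg hτ.le, Real.rpow_natCast]
  have h2 : Real.exp (-q / (4 * τ)) ≤ (n + 1).factorial * (16 * τ / ρ ^ 2) ^ (n + 1) := by
    have h3 : Real.exp (-q / (4 * τ)) ≤ Real.exp (-(ρ ^ 2 / (16 * τ))) := by
      refine Real.exp_le_exp.2 ?_
      rw [neg_div, neg_le_neg_iff, div_le_div_iff₀ (by positivity) (by positivity)]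
      nlinarith
    have h4 := Real.pow_div_factorial_le_exp (ρ ^ 2 / (16 * τ)) (by positivity) (n + 1)
    rw [Real.exp_neg] at h3
    refine h3.trans ?_
    calc (Real.exp (ρ ^ 2 / (16 * τ)))⁻¹
        ≤ ((ρ ^ 2 / (16 * τ)) ^ (n + 1) / (n + 1).factorial)⁻¹ := by gcongr
      _ = _ := by
        rw [inv_div, div_eq_mul_inv, ← inv_pow, inv_div]
  calc gaussAmp n τ * Real.exp (-q / (4 * τ)) / τ
      ≤ (τ ^ n)⁻¹ * ((n + 1).factorial * (16 * τ / ρ ^ 2) ^ (n + 1)) / τ := by gcongr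
    _ = _ := by
      have : 16 * τ / ρ ^ 2 = τ * (16 / ρ ^ 2) := by ring
      rw [this, mul_pow, pow_succ τ n]
      field_simp

/-- The heat kernel with pole `x` at time `τ`, cut off to `ball x ρ`. -/
def heatKernel (ρ τ : ℝ) (x y : 𝔼) : ℝ :=
  cutoff ρ (‖y - x‖ ^ 2) * (gaussAmp n τ * Real.exp (-‖y - x‖ ^ 2 / (4 * τ)))

/-- The time derivative of the truncated heat kernel. -/
def heatKernelDeriv (ρ τ : ℝ) (x y : 𝔼) : ℝ :=
  heatKernel ρ τ x y * (‖y - x‖ ^ 2 / (4 * τ ^ 2) - n / (2 * τ))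

lemma heatKernel_nonneg {ρ τ : ℝ} (hτ : 0 < τ) (x y : 𝔼) : 0 ≤ heatKernel ρ τ x y :=
  mul_nonneg (cutoff_nonneg _ _) (mul_nonneg (gaussAmp_pos n hτ).le (Real.exp_pos _).le)

lemma heatKernel_eq_zero {ρ τ : ℝ} (hρ : 0 < ρ) {x y : 𝔼} (hy : y ∉ closedBall x ρ) :
    heatKernel ρ τ x y = 0 := by
  rw [mem_closedBall, dist_eq_norm, not_le] at hy
  rw [heatKernel, cutoff_eq_zero hρ (by nlinarith), zero_mul]

lemma contDiff_heatKernel (ρ τ : ℝ) (x : 𝔼) : ContDiff ℝ 2 (heatKernel ρ τ x) :=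
  contDiff_radial (G := fun q => cutoff ρ q * (gaussAmp n τ * Real.exp (-q / (4 * τ))))
    ((contDiff_cutoff ρ (m := 2)).mul (by fun_prop)) x

lemma isTest_heatKernel {ρ τ : ℝ} (hρ : 0 < ρ) {x : 𝔼} {S : Set 𝔼} (hS : closedBall x ρ ⊆ S) :
    IsTest S (heatKernel ρ τ x) :=
  isTest_of_eq_zero (contDiff_heatKernel ρ τ x) (isCompact_closedBall x ρ) hS
    fun _ hy => heatKernel_eq_zero hρ hy

lemma continuous_heatKernelDeriv (ρ τ : ℝ) (x : 𝔼) : Continuous (heatKernelDeriv ρ τ x) :=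
  (contDiff_heatKernel ρ τ x).continuous.mul (by fun_prop)

lemma hasDerivAt_heatKernel (ρ : ℝ) {τ : ℝ} (hτ : 0 < τ) (x y : 𝔼) :
    HasDerivAt (fun τ => heatKernel ρ τ x y) (heatKernelDeriv ρ τ x y) τ := by
  have h1 : HasDerivAt (fun τ : ℝ => -‖y - x‖ ^ 2 / (4 * τ)) (‖y - x‖ ^ 2 / (4 * τ ^ 2)) τ := by
    have h2 : HasDerivAt (fun τ : ℝ => 4 * τ) 4 τ := by
      simpa using (hasDerivAt_id τ).const_mul (4 : ℝ)
    refine ((hasDerivAt_const τ (-‖y - x‖ ^ 2)).div h2 (by positivity)).congr_deriv ?_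
    field_simp
    ring
  refine (((hasDerivAt_gaussAmp n hτ).mul h1.exp).const_mul
    (cutoff ρ (‖y - x‖ ^ 2))).congr_deriv ?_
  simp only [heatKernelDeriv, heatKernel]
  ring

lemma heatKernel_lipschitz {ρ τ₀ : ℝ} (hρ : 0 < ρ) (hτ₀ : 0 < τ₀) (x : 𝔼) :
    ∃ L, ∀ᶠ τ in 𝓝 τ₀, ∀ y, |heatKernel ρ τ x y - heatKernel ρ τ₀ x y| ≤ L * |τ - τ₀| := by
  refine ⟨gaussAmp n (τ₀ / 2) * (ρ ^ 2 / τ₀ ^ 2 + n / τ₀), ?_⟩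
  filter_upwards [Ioi_mem_nhds (by linarith : τ₀ / 2 < τ₀)] with τ hτ y
  have hA := gaussAmp_pos n (half_pos hτ₀)
  by_cases hy : y ∈ closedBall x ρ
  · refine Convex.norm_image_sub_le_of_norm_hasDerivWithin_le (s := Ioi (τ₀ / 2))
      (fun σ hσ => (hasDerivAt_heatKernel ρ ((half_pos hτ₀).trans hσ) x y).hasDerivWithinAt)
      (fun σ hσ => ?_) (convex_Ioi _) (mem_Ioi.2 (by linarith)) hτ
    rw [mem_Ioi] at hσ
    have hσ0 : 0 < σ := (half_pos hτ₀).trans hσ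
    rw [mem_closedBall, dist_eq_norm] at hy
    have k1 : heatKernel ρ σ x y ≤ gaussAmp n (τ₀ / 2) := by
      calc heatKernel ρ σ x y ≤ 1 * (gaussAmp n (τ₀ / 2) * 1) := by
            unfold heatKernel
            have := gaussAmp_pos n hσ0
            refine mul_le_mul (cutoff_le_one _ _) ?_ (by positivity) zero_le_one
            refine mul_le_mul (gaussAmp_anti n (half_pos hτ₀) hσ.le) ?_ (by positivity) hA.le
            refine Real.exp_le_one_iff.2 ?_
            rw [neg_div]
            exact neg_nonpos.2 (by positivity)
        _ = _ := by ring
    rw [heatKernelDeriv, norm_mul, Real.norm_of_nonneg (heatKernel_nonneg hσ0 x y)]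
    refine mul_le_mul k1 ?_ (norm_nonneg _) hA.le
    refine (norm_sub_le _ _).trans ?_
    rw [Real.norm_of_nonneg (by positivity), Real.norm_of_nonneg (by positivity)]
    have h1 : τ₀ ^ 2 ≤ 4 * σ ^ 2 := by nlinarith
    have h2 : τ₀ ≤ 2 * σ := by linarith
    gcongr
  · simp only [heatKernel_eq_zero hρ hy, sub_self, abs_zero]
    positivity

/-- The truncated heat kernel solves the heat equation up to a bounded error. -/
lemma exists_heatKernel_error {ρ : ℝ} (hρ : 0 < ρ) : ∃ C, 0 ≤ C ∧ ∀ τ ∈ Ioc (0 : ℝ) 1,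
    ∀ x y : 𝔼, |lap (heatKernel ρ τ x) y - heatKernelDeriv ρ τ x y| ≤ C := by
  obtain ⟨θ', θ'', D, hD0, h1, h2, b1, b2, hz⟩ := exists_cutoff_derivs hρ
  set M : ℝ := (n + 1).factorial * (16 / ρ ^ 2) ^ (n + 1)
  refine ⟨M * (4 * ρ ^ 2 * (D + D) + 2 * n * D), by positivity, fun τ hτ x y => ?_⟩
  have hτ0 : 0 < τ := hτ.1
  set A := gaussAmp n τ with hA
  have hA0 : 0 < A := gaussAmp_pos n hτ0
  set E : ℝ → ℝ := fun q => A * Real.exp (-q / (4 * τ)) with hE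
  have hE' : ∀ q, HasDerivAt E (E q * (-1 / (4 * τ))) q := by
    intro q
    have : HasDerivAt (fun q : ℝ => -q / (4 * τ)) (-1 / (4 * τ)) q :=
      ((hasDerivAt_id q).fun_neg).div_const _
    refine (this.exp.const_mul A).congr_deriv ?_
    simp only [hE]
    ring
  have g1 : ∀ q, HasDerivAt (fun q => cutoff ρ q * E q)
      (θ' q * E q + cutoff ρ q * (E q * (-1 / (4 * τ)))) q := fun q => (h1 q).mul (hE' q)
  have g2 : ∀ q, HasDerivAt (fun q => θ' q * E q + cutoff ρ q * (E q * (-1 / (4 * τ))))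
      (θ'' q * E q + θ' q * (E q * (-1 / (4 * τ)))
        + (θ' q * (E q * (-1 / (4 * τ)))
          + cutoff ρ q * (E q * (-1 / (4 * τ)) * (-1 / (4 * τ))))) q := fun q =>
    ((h2 q).mul (hE' q)).add ((h1 q).mul ((hE' q).mul_const _))
  have hl : lap (heatKernel ρ τ x) y = _ := lap_radial g1 g2 x y
  set q := ‖y - x‖ ^ 2 with hq
  have e : lap (heatKernel ρ τ x) y - heatKernelDeriv ρ τ x y
      = E q * (4 * q * (θ'' q - θ' q / (2 * τ)) + 2 * n * θ' q) := by
    rw [hl, heatKernelDeriv, heatKernel, ← hq, ← hA]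
    simp only [hE]
    field_simp
    ring
  rw [e]
  by_cases hm : q ∈ Icc (ρ ^ 2 / 4) (ρ ^ 2 / 2)
  · have hEq : 0 < E q := by positivity
    have hEM : E q / τ ≤ M := gaussAmp_mul_exp_le n hρ hτ0 hτ.2 hm.1
    have hq0 : 0 ≤ q := by positivity
    have hqρ : q ≤ ρ ^ 2 := by nlinarith [hm.2]
    have hE1 : E q = E q / τ * τ := by field_simp
    rw [abs_mul, abs_of_pos hEq, hE1, mul_assoc]
    refine mul_le_mul hEM ?_ (by positivity) (by positivity)
    have t1 : |4 * q * (θ'' q - θ' q / (2 * τ)) + 2 * n * θ' q|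
        ≤ 4 * q * (|θ'' q| + |θ' q| / (2 * τ)) + 2 * n * |θ' q| := by
      refine (abs_add_le _ _).trans (add_le_add ?_ ?_)
      · rw [abs_mul, abs_of_nonneg (by positivity : 0 ≤ 4 * q)]
        refine mul_le_mul_of_nonneg_left ((abs_sub _ _).trans ?_) (by positivity)
        rw [abs_div, abs_of_pos (by positivity : 0 < 2 * τ)]
      · rw [abs_mul, abs_of_nonneg (by positivity : (0 : ℝ) ≤ 2 * n)]
    calc τ * |4 * q * (θ'' q - θ' q / (2 * τ)) + 2 * n * θ' q|
        ≤ τ * (4 * ρ ^ 2 * (D + D / (2 * τ)) + 2 * n * D) := by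
          refine mul_le_mul_of_nonneg_left (t1.trans ?_) hτ0.le
          have := b1 q
          have := b2 q
          gcongr
      _ = 4 * ρ ^ 2 * (τ * D + D / 2) + 2 * n * (τ * D) := by field_simp
      _ ≤ 4 * ρ ^ 2 * (D + D) + 2 * n * D := by
          have : τ * D ≤ D := mul_le_of_le_one_left hD0 hτ.2
          gcongr
          linarith
  · rw [(hz q hm).1, (hz q hm).2]
    simp only [zero_div, sub_self, mul_zero, add_zero, abs_zero]
    positivity

lemma integral_gauss_one : ∫ z : 𝔼, gaussAmp n 1 * Real.exp (-(1 / 4) * ‖z‖ ^ 2) = 1 := by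
  rw [integral_const_mul, GaussianFourier.integral_rexp_neg_mul_sq_norm (by norm_num), gaussAmp,
    finrank_euclideanSpace_fin, Real.rpow_neg (by positivity)]
  have : π / (1 / 4) = 4 * π * 1 := by ring
  rw [this]
  exact inv_mul_cancel₀ (Real.rpow_pos_of_pos (by positivity) _).ne'

lemma heatKernel_eq_scaled {ρ τ : ℝ} (hτ : 0 < τ) (x y : 𝔼) :
    heatKernel ρ τ x y = (τ ^ (-(1 / 2) : ℝ)) ^ n * (gaussAmp n 1 *
      Real.exp (-(1 / 4) * ‖(τ ^ (-(1 / 2) : ℝ)) • (x - y)‖ ^ 2)) * cutoff ρ (‖y - x‖ ^ 2) := by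
  have h1 : (τ ^ (-(1 / 2) : ℝ)) ^ 2 = τ⁻¹ := by
    rw [← Real.rpow_natCast, ← Real.rpow_mul hτ.le]
    norm_num
    rw [Real.rpow_neg_one]
  have h2 : (τ ^ (-(1 / 2) : ℝ)) ^ n * gaussAmp n 1 = gaussAmp n τ := by
    rw [← Real.rpow_natCast, ← Real.rpow_mul hτ.le, gaussAmp, gaussAmp, mul_one,
      Real.mul_rpow (by positivity) hτ.le, mul_comm]
    congr 2
    ring
  rw [heatKernel, ← h2, norm_smul, mul_pow, Real.norm_eq_abs, sq_abs, h1, norm_sub_rev x y]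
  have h3 : -‖y - x‖ ^ 2 / (4 * τ) = -(1 / 4) * (τ⁻¹ * ‖y - x‖ ^ 2) := by
    field_simp
  rw [h3]
  ring

lemma integral_heatKernel_le {ρ τ : ℝ} (hρ : 0 < ρ) (hτ : 0 < τ) (x : 𝔼) :
    ∫ y, heatKernel ρ τ x y ≤ 1 := by
  set c : ℝ := τ ^ (-(1 / 2) : ℝ) with hc
  have hc0 : 0 < c := Real.rpow_pos_of_pos hτ _
  set g : 𝔼 → ℝ := fun z => gaussAmp n 1 * Real.exp (-(1 / 4) * ‖z‖ ^ 2) with hg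
  have hgi : Integrable g := integrable_of_integral_eq_one integral_gauss_one
  have e : ∫ y, c ^ n * g (c • (x - y)) = 1 := by
    rw [integral_const_mul, integral_sub_left_eq_self (fun y => g (c • y)) volume x,
      Measure.integral_comp_smul_of_nonneg _ _ _ (hR := hc0.le), finrank_euclideanSpace_fin, hg,
      integral_gauss_one]
    simp [hc0.ne']
  have hi : Integrable fun y => c ^ n * g (c • (x - y)) := integrable_of_integral_eq_one e
  rw [← e]
  refine integral_mono ?_ hi fun y => ?_
  · exact (contDiff_heatKernel ρ τ x).continuous.integrable_of_hasCompactSupport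
      (isTest_heatKernel hρ (subset_univ _)).compact
  · simp only
    rw [heatKernel_eq_scaled hτ]
    have hgn : 0 ≤ c ^ n * g (c • (x - y)) := by
      have := gaussAmp_pos n one_pos
      positivity
    exact mul_le_of_le_one_right hgn (cutoff_le_one _ _)

lemma tendsto_norm_pow_mul_gauss :
    Tendsto (fun z : 𝔼 => ‖z‖ ^ n * (gaussAmp n 1 * Real.exp (-(1 / 4) * ‖z‖ ^ 2)))
      (Bornology.cobounded 𝔼) (𝓝 0) := by
  have h0 := (tendsto_rpow_abs_mul_exp_neg_mul_sq_cocompact (a := 1 / 4) (by norm_num)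
    (n : ℝ)).mono_left (atTop_le_cocompact (α := ℝ))
  have h1 := (h0.comp (tendsto_norm_cobounded_atTop (E := 𝔼))).const_mul (gaussAmp n 1)
  rw [mul_zero] at h1
  refine h1.congr fun z => ?_
  simp only [Function.comp, abs_norm, Real.rpow_natCast]
  ring

/-- The truncated heat kernel is an approximate identity. -/
lemma tendsto_integral_heatKernel {ρ : ℝ} (hρ : 0 < ρ) {f : 𝔼 → ℝ} {S : Set 𝔼} {x : 𝔼}
    (hS : IsOpen S) (hf : ContinuousOn f S) (hx : closedBall x ρ ⊆ S) :
    Tendsto (fun τ => ∫ y, f y * heatKernel ρ τ x y) (𝓝[>] 0) (𝓝 (f x)) := by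
  have hcut : ∀ y ∉ closedBall x ρ, cutoff ρ (‖y - x‖ ^ 2) = 0 := fun y hy => by
    rw [mem_closedBall, dist_eq_norm, not_le] at hy
    exact cutoff_eq_zero hρ (by nlinarith)
  have hcc : Continuous fun y : 𝔼 => cutoff ρ (‖y - x‖ ^ 2) :=
    (contDiff_cutoff ρ (m := 0)).continuous.comp (by fun_prop)
  have hgi := integrable_mul_of_eq_zero hS hf hcc (isCompact_closedBall x ρ) hx hcut
  have hgc := continuous_mul_of_eq_zero hS hf hcc (isCompact_closedBall x ρ) hx hcut
  have h1 := tendsto_integral_comp_smul_smul_of_integrable' (μ := (volume : Measure 𝔼))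
    (φ := fun z : 𝔼 => gaussAmp n 1 * Real.exp (-(1 / 4) * ‖z‖ ^ 2))
    (fun z => by have := gaussAmp_pos n one_pos; positivity) integral_gauss_one
    (by simpa only [finrank_euclideanSpace_fin] using tendsto_norm_pow_mul_gauss)
    hgi hgc.continuousAt (x₀ := x)
  have h2 : Tendsto (fun τ : ℝ => τ ^ (-(1 / 2) : ℝ)) (𝓝[>] 0) atTop :=
    tendsto_rpow_neg_nhdsGT_zero (by norm_num)
  have h3 := h1.comp h2
  have e : cutoff ρ (‖x - x‖ ^ 2) = 1 := cutoff_eq_one hρ (by simp; positivity)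
  simp only [e, mul_one, finrank_euclideanSpace_fin] at h3
  refine h3.congr' ?_
  filter_upwards [self_mem_nhdsWithin] with τ hτ
  refine integral_congr_ae (Eventually.of_forall fun y => ?_)
  simp only [smul_eq_mul]
  rw [heatKernel_eq_scaled hτ]
  ring

lemma heatKernel_ge {ρ τ : ℝ} (hρ : 0 < ρ) (hτ : 0 < τ) (hτρ : τ ≤ ρ ^ 2 / 4) {x y : 𝔼}
    (hy : ‖y - x‖ ^ 2 ≤ τ) : gaussAmp n τ * Real.exp (-(1 / 4)) ≤ heatKernel ρ τ x y := by
  rw [heatKernel, cutoff_eq_one hρ (hy.trans hτρ), one_mul]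
  have := gaussAmp_pos n hτ
  refine mul_le_mul_of_nonneg_left (Real.exp_le_exp.2 ?_) this.le
  rw [neg_div, neg_le_neg_iff, div_le_div_iff₀ (by positivity) (by positivity)]
  linarith

/-- Pairing a weak solution with the backward truncated heat kernel. -/
lemma WeakHeat.hasDerivAt_heatKernel {u : ℝ → 𝔼 → ℝ} {a b s t ρ : ℝ} {S : Set 𝔼} {x : 𝔼}
    (h : WeakHeat u a b S) (hs : s ∈ Ioo a b) (hst : s < t) (hρ : 0 < ρ)
    (hx : closedBall x ρ ⊆ S) :
    HasDerivAt (fun s => ∫ y, u s y * heatKernel ρ (t - s) x y)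
      (∫ y, u s y * (lap (heatKernel ρ (t - s) x) y - heatKernelDeriv ρ (t - s) x y)) s := by
  have hτ : 0 < t - s := sub_pos.2 hst
  have hc : Tendsto (fun s => t - s) (𝓝 s) (𝓝 (t - s)) :=
    (continuous_const.sub continuous_id).tendsto s
  have hd : ∀ y, HasDerivAt (fun s => heatKernel ρ (t - s) x y)
      (-heatKernelDeriv ρ (t - s) x y) s := fun y => by
    refine ((_root_.hasDerivAt_heatKernel ρ hτ x y).comp s
      ((hasDerivAt_id s).const_sub t)).congr_deriv ?_
    simp
  have := h.hasDerivAt_integral (k := fun s => heatKernel ρ (t - s) x)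
    (k' := fun y => -heatKernelDeriv ρ (t - s) x y) hs (isCompact_closedBall x ρ) hx
    (Eventually.of_forall fun s => (contDiff_heatKernel ρ (t - s) x).continuous)
    (Eventually.of_forall fun s y hy => heatKernel_eq_zero hρ hy)
    (by
      obtain ⟨L, hL⟩ := heatKernel_lipschitz hρ hτ x
      refine ⟨L, ?_⟩
      filter_upwards [hc.eventually hL] with s' hs' y
      refine (hs' y).trans (le_of_eq ?_)
      rw [abs_sub_comm s']
      ring_nf)
    hd (contDiff_heatKernel ρ (t - s) x) (continuous_heatKernelDeriv ρ (t - s) x).neg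
  simpa only [sub_eq_add_neg] using this

lemma hasDerivAt_integral_heatKernel {f : 𝔼 → ℝ} {τ ρ : ℝ} {S : Set 𝔼} {x : 𝔼}
    (hS : IsOpen S) (hf : ContinuousOn f S) (hτ : 0 < τ) (hρ : 0 < ρ)
    (hx : closedBall x ρ ⊆ S) :
    HasDerivAt (fun τ => ∫ y, f y * heatKernel ρ τ x y)
      (∫ y, f y * heatKernelDeriv ρ τ x y) τ := by
  obtain ⟨M, hM⟩ := (isCompact_closedBall x ρ).exists_bound_of_continuousOn (hf.mono hx)
  have h1 := hasDerivAt_integral_mul_sub (U := fun _ => f) hS (isCompact_closedBall x ρ) hx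
    (t₀ := τ) (Eventually.of_forall fun _ => hf) ⟨M, Eventually.of_forall fun _ => hM⟩
    (fun y _ => continuousAt_const)
    (Eventually.of_forall fun s => (contDiff_heatKernel ρ s x).continuous)
    (Eventually.of_forall fun s y hy => heatKernel_eq_zero hρ hy)
    (heatKernel_lipschitz hρ hτ x) (hasDerivAt_heatKernel ρ hτ x)
  have hi (σ : ℝ) : Integrable fun y => f y * heatKernel ρ σ x y :=
    integrable_mul_of_eq_zero hS hf (contDiff_heatKernel ρ σ x).continuous
      (isCompact_closedBall x ρ) hx fun y hy => heatKernel_eq_zero hρ hy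
  refine (h1.add_const (∫ y, f y * heatKernel ρ τ x y)).congr_of_eventuallyEq
    (Eventually.of_forall fun σ => ?_)
  simp only [mul_sub]
  rw [integral_sub (hi σ) (hi τ)]
  ring

/-! ### Weak solutions between two controlled times -/

/-- A weak solution on `(a, b) × S` that is continuous in time up to `a` and `b`, with bounds on
`u(a)`, `u(b)` and `Δu(a)`. -/
structure Gap (u : ℝ → 𝔼 → ℝ) (a b : ℝ) (S : Set 𝔼) (K : ℝ) : Prop where
  lt : a < b
  weak : WeakHeat u a b S
  cont_time : ∀ x ∈ S, ContinuousOn (fun t => u t x) (Icc a b)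
  left_contDiff : ContDiffOn ℝ 2 (u a) S
  left_nonneg : ∀ x ∈ S, 0 ≤ u a x
  left_le : ∀ x ∈ S, u a x ≤ K
  right_le : ∀ x ∈ S, u b x ≤ K
  lap_le : ∀ x ∈ S, |lap (u a) x| ≤ K

/-- The constant in the Harnack inequality at a fixed point over the second half of a gap. -/
def midConst (n : ℕ) (ρ : ℝ) : ℝ := 2 ^ n * Real.exp (7 * barrierConst n 2 / ρ ^ 2 / 2)

lemma Gap.le_of_mid {u : ℝ → 𝔼 → ℝ} {a b K ρ s : ℝ} {S : Set 𝔼} {y : 𝔼} (hn : 0 < n)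
    (h : Gap u a b S K) (hab : b - a ≤ 1) (hρ : 0 < ρ) (hy : ball y ρ ⊆ S)
    (hs : (a + b) / 2 ≤ s) (hsb : s < b) : u s y ≤ K * midConst n ρ := by
  have hlt := h.lt
  have hyS : y ∈ S := hy (mem_ball_self hρ)
  have has : a < s := by linarith
  have key : ∀ t ∈ Ioo s b, u s y ≤ u t y * midConst n ρ := by
    intro t ht
    have h0 := (h.weak.mono isOpen_ball hy le_rfl le_rfl).harnack hn hρ has ht.1 ht.2
      (α := 2) (by norm_num) (x₁ := y) (x₂ := y) (mem_closedBall_self (by positivity))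
      (mem_closedBall_self (by positivity))
    refine h0.trans ?_
    have hu : 0 < u t y := h.weak.pos t ⟨has.trans ht.1, ht.2⟩ y hyS
    have hb : 0 ≤ barrierConst n 2 := by unfold barrierConst; norm_num; positivity
    rw [mul_assoc]
    refine mul_le_mul_of_nonneg_left ?_ hu.le
    unfold midConst
    have e : (n : ℝ) * 2 / 2 = n := by ring
    rw [e, Real.rpow_natCast, sub_self, norm_zero]
    have hq : 0 < s - a := by linarith
    refine mul_le_mul (pow_le_pow_left₀ (div_nonneg (by linarith [ht.1]) hq.le) ?_ n)
      (Real.exp_le_exp.2 ?_) (Real.exp_pos _).le (by positivity)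
    · rw [div_le_iff₀ hq]
      linarith [ht.2]
    · have : 7 * barrierConst n 2 / ρ ^ 2 / 2 * (t - s) ≤ 7 * barrierConst n 2 / ρ ^ 2 / 2 * 1 := by
        refine mul_le_mul_of_nonneg_left ?_ (by positivity)
        linarith [ht.1, ht.2]
      simpa using this
  have hm : 0 ≤ midConst n ρ := by unfold midConst; positivity
  have hlim : Tendsto (fun t => u t y * midConst n ρ) (𝓝[<] b) (𝓝 (u b y * midConst n ρ)) := by
    refine Tendsto.mul_const _ ?_
    exact ((h.cont_time y hyS) b (right_mem_Icc.2 hlt.le)).mono_left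
      (nhdsWithin_le_of_mem (by
        filter_upwards [Ioo_mem_nhdsLT hlt] with t ht using Ioo_subset_Icc_self ht))
  refine (ge_of_tendsto hlim ?_).trans (mul_le_mul_of_nonneg_right (h.right_le y hyS) hm)
  filter_upwards [Ioo_mem_nhdsLT hsb] with t ht using key t ht

lemma hasDerivAt_max_zero_pow (m : ℕ) (v : ℝ) :
    HasDerivAt (fun v : ℝ => max v 0 ^ (m + 2)) ((m + 2) * max v 0 ^ (m + 1)) v := by
  rcases lt_trichotomy v 0 with hv | hv | hv
  · have : (fun v : ℝ => max v 0 ^ (m + 2)) =ᶠ[𝓝 v] fun _ => 0 := by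
      filter_upwards [Iio_mem_nhds hv] with w hw
      rw [max_eq_right (le_of_lt hw)]
      simp
    refine ((hasDerivAt_const v (0 : ℝ)).congr_of_eventuallyEq this).congr_deriv ?_
    rw [max_eq_right hv.le]
    simp
  · subst hv
    simp only [max_self, ne_eq, Nat.add_eq_zero_iff, one_ne_zero, and_false, not_false_eq_true,
      zero_pow, mul_zero]
    rw [hasDerivAt_iff_isLittleO]
    simp only [max_self, sub_zero, smul_zero, ne_eq, Nat.add_eq_zero_iff, OfNat.ofNat_ne_zero,
      and_false, not_false_eq_true, zero_pow]
    have h1 : (fun v : ℝ => max v 0 ^ (m + 2)) =O[𝓝 0] fun v => v ^ (m + 2) := by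
      refine Asymptotics.IsBigO.of_bound 1 (Eventually.of_forall fun v => ?_)
      rw [one_mul, norm_pow, norm_pow]
      refine pow_le_pow_left₀ (norm_nonneg _) ?_ _
      rw [Real.norm_of_nonneg (le_max_right _ _)]
      exact max_le (le_abs_self v) (abs_nonneg v)
    refine h1.trans_isLittleO ?_
    have := Asymptotics.isLittleO_pow_pow (𝕜 := ℝ) (m := 1) (n := m + 2) (by omega)
    simpa using this
  · have : (fun v : ℝ => max v 0 ^ (m + 2)) =ᶠ[𝓝 v] fun v => v ^ (m + 2) := by
      filter_upwards [Ioi_mem_nhds hv] with w hw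
      rw [max_eq_left (le_of_lt hw)]
    refine ((hasDerivAt_pow (m + 2) v).congr_of_eventuallyEq this).congr_deriv ?_
    rw [max_eq_left hv.le]
    simp

lemma contDiff_max_zero_cube : ContDiff ℝ 2 (fun v : ℝ => max v 0 ^ 3) := by
  have d1 : deriv (fun v : ℝ => max v 0 ^ 3) = fun v => (1 + 2) * max v 0 ^ 2 := by
    funext v
    simpa using (hasDerivAt_max_zero_pow 1 v).deriv
  have d2 : deriv (fun v : ℝ => max v 0 ^ 2) = fun v => 2 * max v 0 := by
    funext v
    simpa using (hasDerivAt_max_zero_pow 0 v).deriv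
  have c1 : ContDiff ℝ 1 (fun v : ℝ => max v 0 ^ 2) := by
    refine contDiff_one_iff_deriv.2 ⟨fun v => (hasDerivAt_max_zero_pow 0 v).differentiableAt, ?_⟩
    rw [d2]
    fun_prop
  have e : (2 : WithTop ℕ∞) = 1 + 1 := by norm_num
  rw [e, contDiff_succ_iff_deriv]
  refine ⟨fun v => (hasDerivAt_max_zero_pow 1 v).differentiableAt, by simp, ?_⟩
  rw [d1]
  exact contDiff_const.mul c1

/-- A localized mass of the solution, increasing in time. -/
lemma WeakHeat.monotoneOn_mass {u : ℝ → 𝔼 → ℝ} {a b A ρ : ℝ} {S : Set 𝔼} {x : 𝔼}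
    (h : WeakHeat u a b S) (hρ : 0 ≤ ρ) (hS : closedBall x ρ ⊆ S) (hA : A ≤ ρ ^ 2) :
    MonotoneOn (fun s => ∫ y, u s y * max (A - 2 * n * (b - s) - ‖y - x‖ ^ 2) 0 ^ 3)
      (Ioo a b) := by
  have hz : ∀ s ∈ Ioo a b, ∀ y ∉ closedBall x ρ,
      max (A - 2 * n * (b - s) - ‖y - x‖ ^ 2) 0 = 0 := by
    intro s hs y hy
    rw [mem_closedBall, dist_eq_norm, not_le] at hy
    refine max_eq_right ?_
    have : 0 ≤ 2 * (n : ℝ) * (b - s) := mul_nonneg (by positivity) (by linarith [hs.2])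
    nlinarith
  have hd : ∀ s ∈ Ioo a b, HasDerivAt
      (fun s => ∫ y, u s y * max (A - 2 * n * (b - s) - ‖y - x‖ ^ 2) 0 ^ 3)
      (∫ y, u s y * (24 * ‖y - x‖ ^ 2 * max (A - 2 * n * (b - s) - ‖y - x‖ ^ 2) 0)) s := by
    intro s hs
    have hI : Ioo a b ∈ 𝓝 s := isOpen_Ioo.mem_nhds hs
    have h3 : ∀ v : ℝ, HasDerivAt (fun v : ℝ => max v 0 ^ 3) (3 * max v 0 ^ 2) v := fun v =>
      (hasDerivAt_max_zero_pow 1 v).congr_deriv (by norm_num)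
    have h2 : ∀ v : ℝ, HasDerivAt (fun v : ℝ => max v 0 ^ 2) (2 * max v 0) v := fun v =>
      (hasDerivAt_max_zero_pow 0 v).congr_deriv (by norm_num)
    have hkd : ∀ y : 𝔼, HasDerivAt (fun s : ℝ => max (A - 2 * n * (b - s) - ‖y - x‖ ^ 2) 0 ^ 3)
        (6 * (n : ℝ) * max (A - 2 * n * (b - s) - ‖y - x‖ ^ 2) 0 ^ 2) s := by
      intro y
      have e : HasDerivAt (fun s : ℝ => A - 2 * n * (b - s) - ‖y - x‖ ^ 2) (2 * (n : ℝ)) s := by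
        have := ((((hasDerivAt_id s).const_sub b).const_mul (2 * (n : ℝ))).const_sub
          A).sub_const (‖y - x‖ ^ 2)
        simpa using this
      refine ((h3 _).comp s e).congr_deriv ?_
      ring
    have hr (B : ℝ) (y : 𝔼) : lap (fun z => max (B - ‖z - x‖ ^ 2) 0 ^ 3) y
        = 4 * ‖y - x‖ ^ 2 * (6 * max (B - ‖y - x‖ ^ 2) 0)
          + 2 * n * (-3 * max (B - ‖y - x‖ ^ 2) 0 ^ 2) := by
      have e (q : ℝ) : HasDerivAt (fun q => B - q) (-1) q := by
        simpa using (hasDerivAt_id q).const_sub B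
      refine lap_radial (G := fun q => max (B - q) 0 ^ 3)
        (G' := fun q => -3 * max (B - q) 0 ^ 2) (G'' := fun q => 6 * max (B - q) 0)
        (fun q => ((h3 _).comp q (e q)).congr_deriv (by ring))
        (fun q => (((h2 _).comp q (e q)).const_mul (-3)).congr_deriv (by ring)) x y
    have := h.hasDerivAt_integral
      (k := fun s y => max (A - 2 * n * (b - s) - ‖y - x‖ ^ 2) 0 ^ 3)
      (k' := fun y => 6 * n * max (A - 2 * n * (b - s) - ‖y - x‖ ^ 2) 0 ^ 2) hs
      (isCompact_closedBall x ρ) hS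
      (Eventually.of_forall fun s => by fun_prop)
      (by filter_upwards [hI] with s hs y hy; simp [hz s hs y hy])
      (by
        refine ⟨3 * (|A|) ^ 2 * (2 * n), ?_⟩
        filter_upwards [hI] with s' hs' y
        have hle (σ : ℝ) (hσ : σ ∈ Ioo a b) : A - 2 * n * (b - σ) - ‖y - x‖ ^ 2 ∈ Iic |A| := by
          have : 0 ≤ 2 * (n : ℝ) * (b - σ) := mul_nonneg (by positivity) (by linarith [hσ.2])
          have h4 := le_abs_self A
          have h5 : 0 ≤ ‖y - x‖ ^ 2 := by positivity
          exact mem_Iic.2 (by linarith)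
        have := Convex.norm_image_sub_le_of_norm_hasDerivWithin_le (s := Iic |A|)
          (C := 3 * (|A|) ^ 2) (fun v _ => (h3 v).hasDerivWithinAt) (fun v hv => by
            rw [Real.norm_of_nonneg (by positivity)]
            have : max v 0 ≤ |A| := max_le hv (abs_nonneg A)
            have : 0 ≤ max v 0 := le_max_right _ _
            gcongr) (convex_Iic _) (hle s hs) (hle s' hs')
        refine this.trans (le_of_eq ?_)
        have e : A - 2 * n * (b - s') - ‖y - x‖ ^ 2 - (A - 2 * n * (b - s) - ‖y - x‖ ^ 2)
          = 2 * n * (s' - s) := by ring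
        rw [e, norm_mul, Real.norm_of_nonneg (by positivity), Real.norm_eq_abs]
        ring)
      hkd
      (contDiff_radial (G := fun q => max (A - 2 * n * (b - s) - q) 0 ^ 3)
        (contDiff_max_zero_cube.comp (by fun_prop)) x)
      (by fun_prop)
    refine this.congr_deriv (integral_congr_ae (Eventually.of_forall fun y => ?_))
    simp only
    rw [hr]
    ring
  refine monotoneOn_of_deriv_nonneg (convex_Ioo a b)
    (fun s hs => (hd s hs).continuousAt.continuousWithinAt) ?_ ?_
  · rw [interior_Ioo]
    exact fun s hs => (hd s hs).differentiableAt.differentiableWithinAt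
  · rw [interior_Ioo]
    intro s hs
    rw [(hd s hs).deriv]
    refine integral_nonneg fun y => ?_
    by_cases hy : y ∈ closedBall x ρ
    · exact mul_nonneg (h.pos s hs y (hS hy)).le (by positivity)
    · simp [hz s hs y hy]

lemma volume_real_closedBall_center (x : 𝔼) (r : ℝ) :
    volume.real (closedBall x r) = volume.real (closedBall (0 : 𝔼) r) := by
  rw [Measure.real, Measure.real, Measure.addHaar_closedBall_center]

/-- The mass of a gap solution is controlled. -/
lemma Gap.mass_le {u : ℝ → 𝔼 → ℝ} {a b K ρ s : ℝ} {S : Set 𝔼} {x : 𝔼} (hn : 0 < n)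
    (h : Gap u a b S K) (hab : b - a ≤ 1) (hab' : 2 * n * (b - a) ≤ ρ ^ 2) (hρ : 0 < ρ)
    (hS : ball x (4 * ρ) ⊆ S) (hs : s ∈ Ioo a b) (hK : 0 ≤ K) :
    ∫ y in closedBall x (2 * ρ), u s y
      ≤ 216 * (K * midConst n ρ) * volume.real (closedBall (0 : 𝔼) (3 * ρ)) := by
  have hS3 : closedBall x (3 * ρ) ⊆ S := (closedBall_subset_ball (by linarith)).trans hS
  have hmono := h.weak.monotoneOn_mass (x := x) (A := 6 * ρ ^ 2) (ρ := 3 * ρ) (by positivity) hS3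
    (by nlinarith)
  have hlt := h.lt
  set s' := max s ((a + b) / 2) with hs'
  have hsI : s' ∈ Ioo a b := ⟨hs.1.trans_le (le_max_left _ _), max_lt hs.2 (by linarith)⟩
  have h1 := hmono hs hsI (le_max_left _ _)
  simp only at h1
  have hz (σ : ℝ) (hσ : σ ∈ Ioo a b) (y : 𝔼) (hy : y ∉ closedBall x (3 * ρ)) :
      max (6 * ρ ^ 2 - 2 * n * (b - σ) - ‖y - x‖ ^ 2) 0 ^ 3 = 0 := by
    rw [mem_closedBall, dist_eq_norm, not_le] at hy
    have : 0 ≤ 2 * (n : ℝ) * (b - σ) := mul_nonneg (by positivity) (by linarith [hσ.2])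
    rw [max_eq_right (by nlinarith)]
    norm_num
  have hi (σ : ℝ) (hσ : σ ∈ Ioo a b) : Integrable fun y =>
      u σ y * max (6 * ρ ^ 2 - 2 * n * (b - σ) - ‖y - x‖ ^ 2) 0 ^ 3 :=
    integrable_mul_of_eq_zero h.weak.isOpen (h.weak.cont_space σ hσ) (by fun_prop)
      (isCompact_closedBall x (3 * ρ)) hS3 (hz σ hσ)
  have hm : 0 ≤ midConst n ρ := by unfold midConst; positivity
  have up : ∫ y, u s' y * max (6 * ρ ^ 2 - 2 * n * (b - s') - ‖y - x‖ ^ 2) 0 ^ 3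
      ≤ K * midConst n ρ * (6 * ρ ^ 2) ^ 3 * volume.real (closedBall (0 : 𝔼) (3 * ρ)) := by
    have e : K * midConst n ρ * (6 * ρ ^ 2) ^ 3 * volume.real (closedBall (0 : 𝔼) (3 * ρ))
        = ∫ y, (closedBall x (3 * ρ)).indicator (fun _ => K * midConst n ρ * (6 * ρ ^ 2) ^ 3) y := by
      rw [integral_indicator_const _ measurableSet_closedBall, smul_eq_mul, mul_comm,
        volume_real_closedBall_center x]
    rw [e]
    refine integral_mono (hi s' hsI) ((integrableOn_const
      (isCompact_closedBall x (3 * ρ)).measure_lt_top.ne).integrable_indicator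
        measurableSet_closedBall) fun y => ?_
    by_cases hy : y ∈ closedBall x (3 * ρ)
    · simp only [indicator_of_mem hy]
      have h4 : u s' y ≤ K * midConst n ρ := by
        refine h.le_of_mid hn hab hρ ((ball_subset_ball' ?_).trans hS) (le_max_right _ _) hsI.2
        linarith [mem_closedBall.1 hy]
      have h5 : max (6 * ρ ^ 2 - 2 * n * (b - s') - ‖y - x‖ ^ 2) 0 ≤ 6 * ρ ^ 2 := by
        refine max_le ?_ (by positivity)
        have : 0 ≤ 2 * (n : ℝ) * (b - s') := mul_nonneg (by positivity) (by linarith [hsI.2])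
        nlinarith [sq_nonneg ‖y - x‖]
      exact mul_le_mul h4 (pow_le_pow_left₀ (le_max_right _ _) h5 3) (by positivity)
        (by positivity)
    · simp [hz s' hsI y hy, indicator_of_notMem hy]
  have low : ρ ^ 6 * ∫ y in closedBall x (2 * ρ), u s y
      ≤ ∫ y, u s y * max (6 * ρ ^ 2 - 2 * n * (b - s) - ‖y - x‖ ^ 2) 0 ^ 3 := by
    rw [← integral_const_mul, ← integral_indicator measurableSet_closedBall]
    have hS2 : closedBall x (2 * ρ) ⊆ S := (closedBall_subset_ball (by linarith)).trans hS
    refine integral_mono ?_ (hi s hs) fun y => ?_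
    · have hc : IntegrableOn (fun y => ρ ^ 6 * u s y) (closedBall x (2 * ρ)) :=
        (((h.weak.cont_space s hs).mono hS2).integrableOn_compact
          (isCompact_closedBall _ _)).const_mul _
      exact hc.integrable_indicator measurableSet_closedBall
    · by_cases hy : y ∈ closedBall x (2 * ρ)
      · simp only [indicator_of_mem hy]
        rw [mul_comm]
        refine mul_le_mul_of_nonneg_left ?_ (h.weak.pos s hs y (hS2 hy)).le
        rw [mem_closedBall, dist_eq_norm] at hy
        have h4 : 2 * (n : ℝ) * (b - s) ≤ ρ ^ 2 :=
          le_trans (mul_le_mul_of_nonneg_left (by linarith [hs.1]) (by positivity)) hab'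
        have h5 : ρ ^ 2 ≤ 6 * ρ ^ 2 - 2 * n * (b - s) - ‖y - x‖ ^ 2 := by
          nlinarith [norm_nonneg (y - x)]
        have e : ρ ^ 6 = (ρ ^ 2) ^ 3 := by ring
        rw [e]
        exact pow_le_pow_left₀ (by positivity) (h5.trans (le_max_left _ _)) 3
      · simp only [indicator_of_notMem hy]
        by_cases hy3 : y ∈ closedBall x (3 * ρ)
        · exact mul_nonneg (h.weak.pos s hs y (hS3 hy3)).le (by positivity)
        · simp [hz s hs y hy3]
  have hρ6 : 0 < ρ ^ 6 := by positivity
  refine le_of_mul_le_mul_left ?_ hρ6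
  calc _ ≤ _ := low.trans (h1.trans up)
    _ = _ := by ring

/-! ### Comparison with the truncated heat kernel -/

lemma heatKernel_error_eq_zero {ρ τ : ℝ} (hρ : 0 < ρ) (hτ : 0 < τ) {x y : 𝔼}
    (hy : y ∉ closedBall x ρ) :
    lap (heatKernel ρ τ x) y - heatKernelDeriv ρ τ x y = 0 := by
  have h1 : lap (heatKernel ρ τ x) y = 0 :=
    eq_zero_of_notMem_tsupport y fun h =>
      hy ((isTest_heatKernel hρ subset_rfl).subset (tsupport_lap_subset _ h))
  have h2 : heatKernelDeriv ρ τ x y = 0 :=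
    (hasDerivAt_heatKernel ρ hτ x y).unique ((hasDerivAt_const τ (0 : ℝ)).congr_of_eventuallyEq
      (Eventually.of_forall fun σ => heatKernel_eq_zero hρ hy))
  rw [h1, h2, sub_zero]

lemma abs_integral_mul_le {f e : 𝔼 → ℝ} {B : Set 𝔼} {C : ℝ} (hB : IsCompact B)
    (hf : ContinuousOn f B) (he : ∀ y, |e y| ≤ C) (he0 : ∀ y ∉ B, e y = 0) :
    |∫ y, f y * e y| ≤ C * ∫ y in B, |f y| := by
  have hi : IntegrableOn (fun y => C * |f y|) B :=
    (continuousOn_const.mul hf.abs).integrableOn_compact hB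
  have h := norm_integral_le_of_norm_le (f := fun y => f y * e y)
    (hi.integrable_indicator hB.measurableSet) (Eventually.of_forall fun y => by
      by_cases hy : y ∈ B
      · rw [indicator_of_mem hy, Real.norm_eq_abs, abs_mul, mul_comm]
        exact mul_le_mul_of_nonneg_right (he y) (abs_nonneg _)
      · rw [indicator_of_notMem hy, he0 y hy]
        simp)
  rwa [integral_indicator hB.measurableSet, integral_const_mul] at h

lemma abs_sub_le_of_hasDerivAt_Icc {f f' : ℝ → ℝ} {s t C : ℝ} (hst : s ≤ t)
    (hf : ∀ σ ∈ Icc s t, HasDerivAt f (f' σ) σ) (hC : ∀ σ ∈ Icc s t, |f' σ| ≤ C) :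
    |f t - f s| ≤ C * (t - s) := by
  have := norm_image_sub_le_of_norm_deriv_le_segment' (f := f) (f' := f') (C := C)
    (fun σ hσ => (hf σ hσ).hasDerivWithinAt) (fun σ hσ => hC σ (Ico_subset_Icc_self hσ)) t
    (right_mem_Icc.2 hst)
  simpa [Real.norm_eq_abs] using this

/-- A weak solution is given, up to an error linear in the elapsed time, by its integral against
the truncated heat kernel. -/
lemma WeakHeat.abs_sub_integral_heatKernel_le {u : ℝ → 𝔼 → ℝ} {a b s τ ρ C M : ℝ} {S : Set 𝔼}
    {x : 𝔼} (h : WeakHeat u a b S) (hρ : 0 < ρ) (hx : closedBall x ρ ⊆ S) (hab : b - a ≤ 1 / 2)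
    (hC : 0 ≤ C) (hCe : ∀ τ ∈ Ioc (0 : ℝ) 1, ∀ x y : 𝔼,
      |lap (heatKernel ρ τ x) y - heatKernelDeriv ρ τ x y| ≤ C)
    (hM : ∀ σ ∈ Ioo a b, ∫ y in closedBall x ρ, u σ y ≤ M) (hs : a < s) (hτ : 0 < τ)
    (hsb : s + τ < b) :
    |u (s + τ) x - ∫ y, u s y * heatKernel ρ τ x y| ≤ C * M * τ := by
  have hB := isCompact_closedBall x ρ
  have key : ∀ η ∈ Ioo (0 : ℝ) (1 / 2), |(∫ y, u (s + τ) y * heatKernel ρ η x y)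
      - ∫ y, u s y * heatKernel ρ (τ + η) x y| ≤ C * M * τ := by
    intro η hη
    have h0 := abs_sub_le_of_hasDerivAt_Icc (s := s) (t := s + τ) (C := C * M)
      (f := fun σ => ∫ y, u σ y * heatKernel ρ (s + τ + η - σ) x y) (by linarith)
      (fun σ hσ => h.hasDerivAt_heatKernel ⟨by linarith [hσ.1], by linarith [hσ.2]⟩
        (by linarith [hσ.2, hη.1]) hρ hx) (fun σ hσ => by
          have hσ' : σ ∈ Ioo a b := ⟨by linarith [hσ.1], by linarith [hσ.2]⟩
          have hpos : 0 < s + τ + η - σ := by linarith [hσ.2, hη.1]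
          refine (abs_integral_mul_le hB ((h.cont_space σ hσ').mono hx)
            (hCe _ ⟨hpos, by linarith [hσ.1, hη.2]⟩ x)
            fun y hy => heatKernel_error_eq_zero hρ hpos hy).trans ?_
          refine mul_le_mul_of_nonneg_left (le_of_eq_of_le ?_ (hM σ hσ')) hC
          exact setIntegral_congr_fun hB.measurableSet fun y hy =>
            abs_of_pos (h.pos σ hσ' y (hx hy)))
    have e1 : s + τ + η - (s + τ) = η := by ring
    have e2 : s + τ + η - s = τ + η := by ring
    have e3 : s + τ - s = τ := by ring
    simpa only [e1, e2, e3] using h0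
  have l1 := tendsto_integral_heatKernel hρ h.isOpen
    (h.cont_space (s + τ) ⟨by linarith, hsb⟩) hx
  have l2 : Tendsto (fun η => ∫ y, u s y * heatKernel ρ (τ + η) x y) (𝓝[>] 0)
      (𝓝 (∫ y, u s y * heatKernel ρ τ x y)) := by
    have := (hasDerivAt_integral_heatKernel h.isOpen
      (h.cont_space s ⟨hs, by linarith⟩) hτ hρ hx).continuousAt
    have l3 : Tendsto (fun η : ℝ => τ + η) (𝓝[>] 0) (𝓝 τ) := by
      have : Tendsto (fun η : ℝ => τ + η) (𝓝 0) (𝓝 (τ + 0)) :=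
        (continuous_const.add continuous_id).tendsto 0
      rw [add_zero] at this
      exact this.mono_left nhdsWithin_le_nhds
    exact this.tendsto.comp l3
  refine le_of_tendsto (l1.sub l2).abs ?_
  filter_upwards [Ioo_mem_nhdsGT (show (0 : ℝ) < 1 / 2 by norm_num)] with η hη using key η hη

lemma abs_integral_heatKernel_sub_le {f : 𝔼 → ℝ} {τ ρ C K : ℝ} {S : Set 𝔼} {x : 𝔼}
    (hS : IsOpen S) (hf : ContDiffOn ℝ 2 f S) (hρ : 0 < ρ) (hx : closedBall x ρ ⊆ S)
    (hC : 0 ≤ C) (hCe : ∀ τ ∈ Ioc (0 : ℝ) 1, ∀ x y : 𝔼,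
      |lap (heatKernel ρ τ x) y - heatKernelDeriv ρ τ x y| ≤ C)
    (hfK : ∀ y ∈ S, |f y| ≤ K) (hlK : ∀ y ∈ S, |lap f y| ≤ K) (hτ : 0 < τ) (hτ1 : τ ≤ 1) :
    |(∫ y, f y * heatKernel ρ τ x y) - f x|
      ≤ (K + C * (K * volume.real (closedBall (0 : 𝔼) ρ))) * τ := by
  have hB := isCompact_closedBall x ρ
  have hK : 0 ≤ K := (abs_nonneg _).trans (hfK x (hx (mem_closedBall_self hρ.le)))
  have hd : ∀ σ ∈ Ioc (0 : ℝ) 1, |∫ y, f y * heatKernelDeriv ρ σ x y|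
      ≤ K + C * (K * volume.real (closedBall (0 : 𝔼) ρ)) := by
    intro σ hσ
    have hT := isTest_heatKernel (τ := σ) hρ hx
    have hk := (contDiff_heatKernel ρ σ x).continuous
    have i1 : Integrable fun y => f y * lap (heatKernel ρ σ x) y :=
      hT.integrable_mul_lap hS hf.continuousOn
    have i2 : Integrable fun y => f y * (lap (heatKernel ρ σ x) y - heatKernelDeriv ρ σ x y) :=
      integrable_mul_of_eq_zero hS hf.continuousOn
        ((continuous_lap (contDiff_heatKernel ρ σ x)).sub (continuous_heatKernelDeriv ρ σ x))
        hB hx fun y hy => heatKernel_error_eq_zero hρ hσ.1 hy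
    have e : ∫ y, f y * heatKernelDeriv ρ σ x y = (∫ y, lap f y * heatKernel ρ σ x y)
        - ∫ y, f y * (lap (heatKernel ρ σ x) y - heatKernelDeriv ρ σ x y) := by
      rw [integral_lap_mul hS hf hT, ← integral_sub i1 i2]
      exact integral_congr_ae (Eventually.of_forall fun y => by ring)
    rw [e]
    refine (abs_sub _ _).trans (add_le_add ?_ ?_)
    · have i3 : Integrable (heatKernel ρ σ x) :=
        hk.integrable_of_hasCompactSupport hT.compact
      have := norm_integral_le_of_norm_le (f := fun y => lap f y * heatKernel ρ σ x y)
        (i3.const_mul K) (Eventually.of_forall fun y => by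
          by_cases hy : y ∈ closedBall x ρ
          · rw [norm_mul, Real.norm_eq_abs, Real.norm_eq_abs,
              abs_of_nonneg (heatKernel_nonneg hσ.1 x y)]
            exact mul_le_mul_of_nonneg_right (hlK y (hx hy)) (heatKernel_nonneg hσ.1 x y)
          · simp [heatKernel_eq_zero hρ hy])
      rw [integral_const_mul] at this
      refine this.trans ?_
      simpa using mul_le_mul_of_nonneg_left (integral_heatKernel_le hρ hσ.1 x) hK
    · refine (abs_integral_mul_le hB (hf.continuousOn.mono hx) (hCe σ hσ x)
        fun y hy => heatKernel_error_eq_zero hρ hσ.1 hy).trans ?_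
      refine mul_le_mul_of_nonneg_left ?_ hC
      have := setIntegral_mono_on (s := closedBall x ρ) (μ := (volume : Measure 𝔼))
        ((hf.continuousOn.mono hx).abs.integrableOn_compact hB)
        (integrableOn_const (hB.measure_lt_top.ne)) hB.measurableSet fun y hy => hfK y (hx hy)
      refine this.trans (le_of_eq ?_)
      rw [setIntegral_const, volume_real_closedBall_center, smul_eq_mul, mul_comm]
  have l1 := tendsto_integral_heatKernel hρ hS hf.continuousOn hx
  have hCK : 0 ≤ K + C * (K * volume.real (closedBall (0 : 𝔼) ρ)) := by positivity
  refine le_of_tendsto (l1.const_sub _).abs ?_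
  filter_upwards [Ioo_mem_nhdsGT hτ] with σ hσ
  refine (abs_sub_le_of_hasDerivAt_Icc hσ.2.le (fun σ' hσ' => hasDerivAt_integral_heatKernel hS
    hf.continuousOn (hσ.1.trans_le hσ'.1) hρ hx) fun σ' hσ' =>
    hd σ' ⟨hσ.1.trans_le hσ'.1, hσ'.2.trans hτ1⟩).trans ?_
  exact mul_le_mul_of_nonneg_left (by linarith [hσ.1]) hCK

lemma gaussAmp_sq (n : ℕ) {r : ℝ} (hr : 0 < r) : gaussAmp n (r ^ 2) = gaussAmp n 1 / r ^ n := by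
  unfold gaussAmp
  rw [mul_one, Real.mul_rpow (by positivity) (by positivity), ← Real.rpow_natCast r 2,
    ← Real.rpow_mul hr.le, ← Real.rpow_natCast r n, div_eq_mul_inv _ (r ^ (n : ℝ)),
    ← Real.rpow_neg hr.le]
  congr 2
  push_cast
  ring

lemma Gap.exists_ball_bound {u : ℝ → 𝔼 → ℝ} {a b K ρ C M : ℝ} {S : Set 𝔼} {x : 𝔼}
    (h : Gap u a b S K) (hρ : 0 < ρ) (hx : closedBall x ρ ⊆ S) (hab : b - a ≤ 1 / 2)
    (hC : 0 ≤ C) (hCe : ∀ τ ∈ Ioc (0 : ℝ) 1, ∀ x y : 𝔼,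
      |lap (heatKernel ρ τ x) y - heatKernelDeriv ρ τ x y| ≤ C)
    (hM0 : 0 ≤ M) (hM : ∀ σ ∈ Ioo a b, ∫ y in closedBall x ρ, u σ y ≤ M) :
    ∃ r₀ > 0, ∀ r ∈ Ioc (0 : ℝ) r₀, ∀ᶠ s in 𝓝[>] a,
      ∫ y in closedBall x r, u s y ≤ (K + 1 + C * M) * Real.exp (1 / 4) / gaussAmp n 1 * r ^ n := by
  have hlt := h.lt
  have hxS : x ∈ S := hx (mem_closedBall_self hρ.le)
  have hev : ∀ᶠ t in 𝓝[>] a, u t x < K + 1 := by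
    have : Tendsto (fun t => u t x) (𝓝[>] a) (𝓝 (u a x)) :=
      ((h.cont_time x hxS) a (left_mem_Icc.2 hlt.le)).mono_left
        (nhdsWithin_le_of_mem (by
          filter_upwards [Ioo_mem_nhdsGT hlt] with t ht using Ioo_subset_Icc_self ht))
    exact this.eventually (gt_mem_nhds (by linarith [h.left_le x hxS]))
  obtain ⟨c, hc, hcs⟩ := mem_nhdsGT_iff_exists_Ioo_subset.1 hev
  rw [mem_Ioi] at hc
  have hd : 0 < (min c b - a) / 2 := by
    have := lt_min hc hlt
    linarith
  refine ⟨min 1 (min (ρ / 2) ((min c b - a) / 2)), by positivity, fun r hr => ?_⟩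
  have hr0 := hr.1
  have hr1 : r ≤ 1 := hr.2.trans (min_le_left _ _)
  have hr2 : r ≤ ρ / 2 := hr.2.trans ((min_le_right _ _).trans (min_le_left _ _))
  have hr3 : r ≤ (min c b - a) / 2 := hr.2.trans ((min_le_right _ _).trans (min_le_right _ _))
  have hrr : r ^ 2 ≤ r := by nlinarith
  filter_upwards [Ioo_mem_nhdsGT (show a < a + (min c b - a) / 2 by linarith)] with s hs
  have hsc : s + r ^ 2 < c := by linarith [hs.2, min_le_left c b]
  have hsb : s + r ^ 2 < b := by linarith [hs.2, min_le_right c b]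
  have hr2' : 0 < r ^ 2 := by positivity
  have hsab : s ∈ Ioo a b := ⟨hs.1, by linarith⟩
  have h1 := (abs_le.1 (h.weak.abs_sub_integral_heatKernel_le hρ hx hab hC hCe hM hs.1 hr2' hsb)).1
  have h2 : u (s + r ^ 2) x < K + 1 := hcs ⟨by linarith [hs.1], hsc⟩
  have hg := gaussAmp_pos n hr2'
  have hcont : ContinuousOn (u s) (closedBall x ρ) := (h.weak.cont_space s hsab).mono hx
  have hsub : closedBall x r ⊆ closedBall x ρ := closedBall_subset_closedBall (by linarith)
  have hk : Integrable fun y => u s y * heatKernel ρ (r ^ 2) x y :=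
    integrable_mul_of_eq_zero h.weak.isOpen (h.weak.cont_space s hsab)
      (contDiff_heatKernel ρ _ x).continuous (isCompact_closedBall x ρ) hx
      fun y hy => heatKernel_eq_zero hρ hy
  have h3 : ∫ y in closedBall x r, u s y * (gaussAmp n (r ^ 2) * Real.exp (-(1 / 4)))
      ≤ ∫ y, u s y * heatKernel ρ (r ^ 2) x y := by
    refine (setIntegral_mono_on (g := fun y => u s y * heatKernel ρ (r ^ 2) x y) ?_ hk.integrableOn
      measurableSet_closedBall fun y hy => ?_).trans
      (setIntegral_le_integral hk (Eventually.of_forall fun y => ?_))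
    · exact ((hcont.mono hsub).mul continuousOn_const).integrableOn_compact
        (isCompact_closedBall x r)
    · refine mul_le_mul_of_nonneg_left (heatKernel_ge hρ hr2' (by nlinarith) ?_)
        (h.weak.pos s hsab y (hx (hsub hy))).le
      rw [mem_closedBall, dist_eq_norm] at hy
      exact pow_le_pow_left₀ (norm_nonneg _) hy 2
    · by_cases hy : y ∈ closedBall x ρ
      · exact mul_nonneg (h.weak.pos s hsab y (hx hy)).le (heatKernel_nonneg hr2' x y)
      · simp [heatKernel_eq_zero hρ hy]
  rw [integral_mul_const, gaussAmp_sq n hr0, Real.exp_neg] at h3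
  have hCM : C * M * r ^ 2 ≤ C * M := mul_le_of_le_one_right (by positivity) (by linarith)
  have h4 := h3.trans (show _ ≤ K + 1 + C * M by linarith)
  have hg1 := gaussAmp_pos n one_pos
  have he := Real.exp_pos (1 / 4)
  have e : gaussAmp n 1 / r ^ n * (Real.exp (1 / 4))⁻¹
      = gaussAmp n 1 / (r ^ n * Real.exp (1 / 4)) := by field_simp
  rw [e, mul_div_assoc', div_le_iff₀ (by positivity)] at h4
  rw [div_mul_eq_mul_div, le_div_iff₀ hg1]
  linarith

/-- Bounds for the masses of small balls, uniform in the centre but not in the admissible radii,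
give bounds for integrals against continuous functions. -/
lemma eventually_integral_mul_le {u : ℝ → 𝔼 → ℝ} {φ : 𝔼 → ℝ} {a ρ C : ℝ} {x₀ : 𝔼} (hρ : 0 < ρ)
    (hC : 0 ≤ C) (hφ : Continuous φ) (hφ0 : ∀ y, 0 ≤ φ y) (hφz : ∀ y ∉ closedBall x₀ ρ, φ y = 0)
    (hu : ∀ᶠ s in 𝓝[>] a, ContinuousOn (u s) (closedBall x₀ (2 * ρ)) ∧
      ∀ y ∈ closedBall x₀ (2 * ρ), 0 ≤ u s y)
    (hb : ∀ x ∈ closedBall x₀ ρ, ∃ r₀ > 0, ∀ r ∈ Ioc (0 : ℝ) r₀, ∀ᶠ s in 𝓝[>] a,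
      ∫ y in closedBall x r, u s y ≤ C * r ^ n) :
    ∀ᶠ s in 𝓝[>] a, ∫ y, u s y * φ y ≤ C * 5 ^ n / volume.real (ball (0 : 𝔼) 1) *
      ((∫ y, φ y) + 2 * volume.real (closedBall (0 : 𝔼) (2 * ρ))) := by
  have hsupp : HasCompactSupport φ := HasCompactSupport.intro (isCompact_closedBall x₀ ρ) hφz
  have hφi : Integrable φ := hφ.integrable_of_hasCompactSupport hsupp
  obtain ⟨δ, hδ, hosc⟩ := Metric.uniformContinuous_iff.1
    (hsupp.uniformContinuous_of_continuous hφ) 1 one_pos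
  choose! r₀ hr₀ hbd using hb
  set r : 𝔼 → ℝ := fun x => min (r₀ x / 5) (min (δ / 7) (ρ / 5)) with hr
  have hrpos : ∀ x ∈ closedBall x₀ ρ, 0 < r x := fun x hx => by
    have := hr₀ x hx
    simp only [hr]
    positivity
  have hr1 : ∀ x, 5 * r x ≤ r₀ x := fun x => by
    have : r x ≤ r₀ x / 5 := min_le_left _ _
    linarith
  have hr2 : ∀ x, 5 * r x < δ := fun x => by
    have : r x ≤ δ / 7 := (min_le_right _ _).trans (min_le_left _ _)
    linarith
  have hr3 : ∀ x, 5 * r x ≤ ρ := fun x => by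
    have : r x ≤ ρ / 5 := (min_le_right _ _).trans (min_le_right _ _)
    linarith
  obtain ⟨t, htS, htc⟩ := (isCompact_closedBall x₀ ρ).elim_nhds_subcover
    (fun x => closedBall x (r x)) fun x hx => closedBall_mem_nhds x (hrpos x hx)
  obtain ⟨v, hvt, hvd, hvc⟩ := Vitali.exists_disjoint_subfamily_covering_enlargement_closedBall
    (t : Set 𝔼) id r ρ (fun x hx => by linarith [hr3 x, hrpos x (htS x hx)]) 5 (by norm_num)
  obtain ⟨w, rfl⟩ : ∃ w : Finset 𝔼, (w : Set 𝔼) = v :=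
    (t.finite_toSet.subset hvt).exists_finset_coe
  simp only [id] at hvd hvc
  have hwS : ∀ x ∈ w, x ∈ closedBall x₀ ρ := fun x hx => htS x (hvt hx)
  have hcov : ∀ y ∈ closedBall x₀ ρ, ∃ x ∈ w, y ∈ closedBall x (5 * r x) := fun y hy => by
    obtain ⟨x, hx, hyx⟩ := mem_iUnion₂.1 (htc hy)
    obtain ⟨z, hz, hxz⟩ := hvc x hx
    exact ⟨z, hz, hxz hyx⟩
  have hsub : ∀ x ∈ w, closedBall x (5 * r x) ⊆ closedBall x₀ (2 * ρ) := fun x hx =>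
    closedBall_subset_closedBall' (by linarith [mem_closedBall.1 (hwS x hx), hr3 x])
  have hall : ∀ᶠ s in 𝓝[>] a, ∀ x ∈ w, ∫ y in closedBall x (5 * r x), u s y
      ≤ C * (5 * r x) ^ n := by
    rw [Filter.eventually_all_finset]
    intro x hx
    exact hbd x (hwS x hx) _ ⟨by linarith [hrpos x (hwS x hx)], hr1 x⟩
  have hφ2 : IntegrableOn (fun y => φ y + 2) (closedBall x₀ (2 * ρ)) :=
    (hφ.add continuous_const).continuousOn.integrableOn_compact (isCompact_closedBall _ _)
  have hω : 0 < volume.real (ball (0 : 𝔼) 1) := 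
    ENNReal.toReal_pos (measure_ball_pos _ _ one_pos).ne' measure_ball_lt_top.ne
  filter_upwards [hall, hu] with s hs hus
  have hint : ∀ x ∈ w, IntegrableOn (u s) (closedBall x (5 * r x)) := fun x hx =>
    (hus.1.mono (hsub x hx)).integrableOn_compact (isCompact_closedBall _ _)
  have hind : ∀ x ∈ w, Integrable
      ((closedBall x (5 * r x)).indicator fun y => u s y * (φ x + 1)) := fun x hx => by
    have : IntegrableOn (fun y => u s y * (φ x + 1)) (closedBall x (5 * r x)) :=
      (hint x hx).mul_const _
    exact this.integrable_indicator measurableSet_closedBall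
  calc ∫ y, u s y * φ y
      ≤ ∫ y, ∑ x ∈ w, (closedBall x (5 * r x)).indicator (fun y => u s y * (φ x + 1)) y := by
        refine integral_mono_of_nonneg (Eventually.of_forall fun y => ?_)
          (integrable_finsetSum _ hind) (Eventually.of_forall fun y => ?_)
        · by_cases hy : y ∈ closedBall x₀ ρ
          · exact mul_nonneg (hus.2 y (closedBall_subset_closedBall (by linarith) hy)) (hφ0 y)
          · simp [hφz y hy]
        · have hnn : ∀ x ∈ w, 0 ≤ (closedBall x (5 * r x)).indicator
              (fun y => u s y * (φ x + 1)) y := fun x hx =>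
            indicator_nonneg (fun z hz => mul_nonneg (hus.2 z (hsub x hx hz))
              (by linarith [hφ0 x])) y
          by_cases hy : y ∈ closedBall x₀ ρ
          · obtain ⟨x, hx, hyx⟩ := hcov y hy
            refine le_trans ?_ (Finset.single_le_sum hnn hx)
            rw [indicator_of_mem hyx]
            refine mul_le_mul_of_nonneg_left ?_ (hus.2 y (hsub x hx hyx))
            have := hosc (lt_of_le_of_lt (mem_closedBall.1 hyx) (hr2 x))
            rw [Real.dist_eq] at this
            linarith [(abs_lt.1 this).2]
          · simpa [hφz y hy] using Finset.sum_nonneg hnn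
    _ = ∑ x ∈ w, (∫ y in closedBall x (5 * r x), u s y) * (φ x + 1) := by
        rw [integral_finsetSum _ hind]
        refine Finset.sum_congr rfl fun x _ => ?_
        rw [integral_indicator measurableSet_closedBall, integral_mul_const]
    _ ≤ ∑ x ∈ w, C * 5 ^ n / volume.real (ball (0 : 𝔼) 1) *
          ∫ y in closedBall x (r x), (φ y + 2) := by
        refine Finset.sum_le_sum fun x hx => ?_
        have hrx := hrpos x (hwS x hx)
        have hsx : closedBall x (r x) ⊆ closedBall x₀ (2 * ρ) :=
          (closedBall_subset_closedBall (by linarith)).trans (hsub x hx)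
        have h1 : r x ^ n * volume.real (ball (0 : 𝔼) 1) * (φ x + 1)
            ≤ ∫ y in closedBall x (r x), (φ y + 2) := by
          have := setIntegral_mono_on (s := closedBall x (r x)) (μ := (volume : Measure 𝔼))
            (f := fun _ => φ x + 1) (g := fun y => φ y + 2)
            (integrableOn_const ((isCompact_closedBall _ _).measure_lt_top.ne))
            (hφ2.mono_set hsx) measurableSet_closedBall fun y hy => by
              have := hosc (lt_of_le_of_lt (mem_closedBall.1 hy) (by linarith [hr2 x]))
              rw [Real.dist_eq] at this
              linarith [(abs_lt.1 this).1]
          rwa [setIntegral_const, smul_eq_mul, Measure.addHaar_real_closedBall _ _ hrx.le,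
            finrank_euclideanSpace_fin] at this
        calc (∫ y in closedBall x (5 * r x), u s y) * (φ x + 1)
            ≤ C * (5 * r x) ^ n * (φ x + 1) :=
              mul_le_mul_of_nonneg_right (hs x hx) (by linarith [hφ0 x])
          _ = C * 5 ^ n / volume.real (ball (0 : 𝔼) 1) *
                (r x ^ n * volume.real (ball (0 : 𝔼) 1) * (φ x + 1)) := by
              rw [mul_pow]
              field_simp
          _ ≤ _ := mul_le_mul_of_nonneg_left h1 (by positivity)
    _ = C * 5 ^ n / volume.real (ball (0 : 𝔼) 1) *
          ∫ y in ⋃ x ∈ w, closedBall x (r x), (φ y + 2) := by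
        rw [← Finset.mul_sum, integral_biUnion_finset _ (fun _ _ => measurableSet_closedBall) hvd]
        intro x hx
        refine hφ2.mono_set ((closedBall_subset_closedBall ?_).trans (hsub x hx))
        linarith [hrpos x (hwS x hx)]
    _ ≤ _ := by
        refine mul_le_mul_of_nonneg_left ?_ (by positivity)
        have h1 : ∫ y in ⋃ x ∈ w, closedBall x (r x), (φ y + 2)
            ≤ ∫ y in closedBall x₀ (2 * ρ), (φ y + 2) := by
          refine setIntegral_mono_set hφ2 (Eventually.of_forall fun y => ?_)
            (LE.le.eventuallyLE ?_)
          · simp only [Pi.zero_apply]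
            linarith [hφ0 y]
          · refine iUnion₂_subset fun x hx => (closedBall_subset_closedBall ?_).trans (hsub x hx)
            linarith [hrpos x (hwS x hx)]
        refine h1.trans ?_
        rw [integral_add hφi.integrableOn (integrableOn_const
          ((isCompact_closedBall _ _).measure_lt_top.ne)), setIntegral_const,
          volume_real_closedBall_center, smul_eq_mul, mul_comm _ (2 : ℝ)]
        linarith [setIntegral_le_integral (s := closedBall x₀ (2 * ρ)) hφi
          (Eventually.of_forall hφ0)]

lemma Gap.tendsto_left {u : ℝ → 𝔼 → ℝ} {a b K : ℝ} {S : Set 𝔼} {x : 𝔼} (h : Gap u a b S K)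
    (hx : x ∈ S) {t : ℝ} (ht : t ∈ Ico a b) :
    Tendsto (fun s => u s x) (𝓝[>] t) (𝓝 (u t x)) :=
  ((h.cont_time x hx) t (Ico_subset_Icc_self ht)).mono_left (nhdsWithin_le_of_mem (by
    filter_upwards [Ioo_mem_nhdsGT ht.2] with s hs using ⟨ht.1.trans hs.1.le, hs.2.le⟩))

lemma tendsto_add_const_nhdsGT (a τ : ℝ) :
    Tendsto (fun s : ℝ => s + τ) (𝓝[>] a) (𝓝[>] (a + τ)) := by
  refine tendsto_nhdsWithin_iff.2 ⟨?_, ?_⟩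
  · exact ((continuous_id.add continuous_const).tendsto a).mono_left nhdsWithin_le_nhds
  · filter_upwards [self_mem_nhdsWithin] with s hs
    exact add_lt_add_left (mem_Ioi.1 hs) τ

/-- The mass bound on a gap. -/
def gapMass (n : ℕ) (ρ K : ℝ) : ℝ :=
  216 * (K * midConst n ρ) * volume.real (closedBall (0 : EuclideanSpace ℝ (Fin n)) (3 * ρ))

lemma gapMass_nonneg (n : ℕ) (ρ : ℝ) {K : ℝ} (hK : 0 ≤ K) : 0 ≤ gapMass n ρ K := by
  unfold gapMass midConst
  positivity

lemma Gap.mass_closedBall_le {u : ℝ → 𝔼 → ℝ} {a b K ρ s : ℝ} {S : Set 𝔼} {x x' : 𝔼} (hn : 0 < n)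
    (h : Gap u a b S K) (hab : b - a ≤ 1) (hab' : 2 * n * (b - a) ≤ ρ ^ 2) (hρ : 0 < ρ)
    (hS : ball x (4 * ρ) ⊆ S) (hK : 0 ≤ K) (hx' : x' ∈ closedBall x ρ) (hs : s ∈ Ioo a b) :
    ∫ y in closedBall x' ρ, u s y ≤ gapMass n ρ K := by
  have h2 : closedBall x (2 * ρ) ⊆ S := (closedBall_subset_ball (by linarith)).trans hS
  refine le_trans (setIntegral_mono_set ?_ ?_ (LE.le.eventuallyLE ?_))
    (h.mass_le hn hab hab' hρ hS hs hK)
  · exact ((h.weak.cont_space s hs).mono h2).integrableOn_compact (isCompact_closedBall _ _)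
  · refine (ae_restrict_iff' measurableSet_closedBall).2 (Eventually.of_forall fun y hy => ?_)
    exact (h.weak.pos s hs y (h2 hy)).le
  · exact closedBall_subset_closedBall' (by linarith [mem_closedBall.1 hx'])

lemma Gap.exists_bound (hn : 0 < n) {ρ K : ℝ} (hρ : 0 < ρ) (hK : 0 ≤ K) :
    ∃ C, K ≤ C ∧ ∀ (u : ℝ → 𝔼 → ℝ) (a b : ℝ) (S : Set 𝔼) (x : 𝔼), Gap u a b S K →
      b - a ≤ 1 / 2 → 2 * n * (b - a) ≤ ρ ^ 2 → ball x (4 * ρ) ⊆ S →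
      ∀ t ∈ Icc a b, u t x ≤ C := by
  obtain ⟨Ce, hCe0, hCe⟩ := exists_heatKernel_error (n := n) hρ
  set M := gapMass n ρ K with hM
  have hM0 : 0 ≤ M := gapMass_nonneg n ρ hK
  set C₁ := (K + 1 + Ce * M) * Real.exp (1 / 4) / gaussAmp n 1 with hC₁
  have hC₁0 : 0 ≤ C₁ := by
    have := gaussAmp_pos n one_pos
    positivity
  set A := C₁ * 5 ^ n / volume.real (ball (0 : 𝔼) 1) *
      (1 + 2 * volume.real (closedBall (0 : 𝔼) (2 * ρ))) with hA
  have hA0 : 0 ≤ A := by positivity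
  refine ⟨K + (A + Ce * M), le_add_of_nonneg_right (by positivity), ?_⟩
  intro u a b S x h hab hab' hS t ht
  have hP : 0 ≤ A + Ce * M := by positivity
  have hxS : x ∈ S := hS (mem_ball_self (by positivity))
  rcases ht.1.eq_or_lt with rfl | hat
  · linarith [h.left_le x hxS]
  rcases ht.2.eq_or_lt with rfl | htb
  · linarith [h.right_le x hxS]
  have hτ : 0 < t - a := sub_pos.2 hat
  have hsubS : ∀ x' ∈ closedBall x ρ, closedBall x' ρ ⊆ S := fun x' hx' =>
    (closedBall_subset_ball' (by linarith [mem_closedBall.1 hx'])).trans hS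
  have h2S : closedBall x (2 * ρ) ⊆ S := (closedBall_subset_ball (by linarith)).trans hS
  have hmass : ∀ x' ∈ closedBall x ρ, ∀ s ∈ Ioo a b, ∫ y in closedBall x' ρ, u s y ≤ M :=
    fun x' hx' s hs => h.mass_closedBall_le hn (by linarith) hab' hρ hS hK hx' hs
  have hxx : x ∈ closedBall x ρ := mem_closedBall_self hρ.le
  have h1 := eventually_integral_mul_le (u := u) (φ := heatKernel ρ (t - a) x) (a := a) hρ hC₁0
    (contDiff_heatKernel _ _ x).continuous (heatKernel_nonneg hτ x)
    (fun y hy => heatKernel_eq_zero hρ hy)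
    (by
      filter_upwards [Ioo_mem_nhdsGT h.lt] with s hs
      exact ⟨(h.weak.cont_space s hs).mono h2S, fun y hy => (h.weak.pos s hs y (h2S hy)).le⟩)
    fun x' hx' => h.exists_ball_bound hρ (hsubS x' hx') hab hCe0 hCe hM0 (hmass x' hx')
  have hlim := (h.tendsto_left hxS (t := a + (t - a)) ⟨by linarith, by linarith⟩).comp
    (tendsto_add_const_nhdsGT a (t - a))
  have e : a + (t - a) = t := by ring
  rw [e] at hlim
  have : u t x ≤ A + Ce * M := by
    refine le_of_tendsto hlim ?_
    filter_upwards [h1, Ioo_mem_nhdsGT (show a < b - (t - a) by linarith)] with s hs hsI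
    have h3 := (abs_le.1 (h.weak.abs_sub_integral_heatKernel_le hρ (hsubS x hxx) hab hCe0 hCe
      (hmass x hxx) hsI.1 hτ (by linarith [hsI.2]))).2
    have h4 : Ce * M * (t - a) ≤ Ce * M := mul_le_of_le_one_right (by positivity) (by linarith)
    have h5 : C₁ * 5 ^ n / volume.real (ball (0 : 𝔼) 1) *
      ((∫ y, heatKernel ρ (t - a) x y) + 2 * volume.real (closedBall (0 : 𝔼) (2 * ρ))) ≤ A := by
      refine mul_le_mul_of_nonneg_left ?_ (by positivity)
      linarith [integral_heatKernel_le hρ hτ x]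
    simp only [Function.comp_apply]
    linarith
  linarith

/-- On a gap, the solution is bounded, and Lipschitz in time at the left end, with constants
depending only on the bounds for the end data. -/
lemma Gap.exists_lipschitz (hn : 0 < n) {ρ K : ℝ} (hρ : 0 < ρ) (hK : 0 ≤ K) :
    ∃ C, K ≤ C ∧ ∀ (u : ℝ → 𝔼 → ℝ) (a b : ℝ) (S : Set 𝔼) (x : 𝔼), Gap u a b S K →
      b - a ≤ 1 / 2 → 2 * n * (b - a) ≤ ρ ^ 2 → ball x (5 * ρ) ⊆ S →
      ∀ t ∈ Icc a b, u t x ≤ C ∧ |u t x - u a x| ≤ C * (t - a) := by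
  obtain ⟨Ce, hCe0, hCe⟩ := exists_heatKernel_error (n := n) hρ
  obtain ⟨C₀, hKC, hC₀⟩ := Gap.exists_bound (n := n) hn hρ hK
  set M := gapMass n ρ K with hM
  have hM0 : 0 ≤ M := gapMass_nonneg n ρ hK
  set D := Ce * M + (K + Ce * (K * volume.real (closedBall (0 : 𝔼) ρ))) with hD
  have hD0 : 0 ≤ D := by positivity
  refine ⟨C₀ + D, by linarith, ?_⟩
  intro u a b S x h hab hab' hS t ht
  have hS4 : ∀ y ∈ closedBall x ρ, ball y (4 * ρ) ⊆ S := fun y hy =>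
    (ball_subset_ball' (by linarith [mem_closedBall.1 hy])).trans hS
  have hxx : x ∈ closedBall x ρ := mem_closedBall_self hρ.le
  have hxS : x ∈ S := hS (mem_ball_self (by positivity))
  have hBS : closedBall x ρ ⊆ S := (closedBall_subset_ball (by linarith)).trans hS
  have hbd : ∀ y ∈ closedBall x ρ, ∀ s ∈ Icc a b, u s y ≤ C₀ := fun y hy =>
    hC₀ u a b S y h hab hab' (hS4 y hy)
  refine ⟨(hbd x hxx t ht).trans (by linarith), ?_⟩
  have key : ∀ t ∈ Ioo a b, |u t x - u a x| ≤ D * (t - a) := by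
    intro t ht
    have hτ : 0 < t - a := sub_pos.2 ht.1
    have hk := (contDiff_heatKernel ρ (t - a) x).continuous
    have hki : Integrable (heatKernel ρ (t - a) x) :=
      hk.integrable_of_hasCompactSupport (isTest_heatKernel hρ hBS).compact
    have hlim := (h.tendsto_left hxS (t := a + (t - a)) ⟨by linarith, by linarith [ht.2]⟩).comp
      (tendsto_add_const_nhdsGT a (t - a))
    have e : a + (t - a) = t := by ring
    rw [e] at hlim
    have hlim2 : Tendsto (fun s => ∫ y, u s y * heatKernel ρ (t - a) x y) (𝓝[>] a)
        (𝓝 (∫ y, u a y * heatKernel ρ (t - a) x y)) := by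
      refine tendsto_integral_filter_of_dominated_convergence
        (fun y => C₀ * heatKernel ρ (t - a) x y) ?_ ?_ (hki.const_mul _) ?_
      · filter_upwards [Ioo_mem_nhdsGT h.lt] with s hs
        exact (integrable_mul_of_eq_zero h.weak.isOpen (h.weak.cont_space s hs) hk
          (isCompact_closedBall x ρ) hBS fun y hy => heatKernel_eq_zero hρ hy).aestronglyMeasurable
      · filter_upwards [Ioo_mem_nhdsGT h.lt] with s hs
        refine Eventually.of_forall fun y => ?_
        by_cases hy : y ∈ closedBall x ρ
        · rw [norm_mul, Real.norm_eq_abs, Real.norm_eq_abs,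
            abs_of_nonneg (heatKernel_nonneg hτ x y), abs_of_pos (h.weak.pos s hs y (hBS hy))]
          exact mul_le_mul_of_nonneg_right (hbd y hy s (Ioo_subset_Icc_self hs))
            (heatKernel_nonneg hτ x y)
        · simp [heatKernel_eq_zero hρ hy]
      · refine Eventually.of_forall fun y => ?_
        by_cases hy : y ∈ closedBall x ρ
        · exact (h.tendsto_left (hBS hy) ⟨le_rfl, h.lt⟩).mul_const _
        · simp [heatKernel_eq_zero hρ hy]
    have h1 : |u t x - ∫ y, u a y * heatKernel ρ (t - a) x y| ≤ Ce * M * (t - a) := by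
      refine le_of_tendsto (hlim.sub hlim2).abs ?_
      filter_upwards [Ioo_mem_nhdsGT (show a < b - (t - a) by linarith [ht.2])] with s hsI
      exact h.weak.abs_sub_integral_heatKernel_le hρ hBS hab hCe0 hCe
        (fun σ hσ => h.mass_closedBall_le hn (by linarith) hab' hρ (hS4 x hxx) hK hxx hσ)
        hsI.1 hτ (by linarith [hsI.2])
    have h2 := abs_integral_heatKernel_sub_le h.weak.isOpen h.left_contDiff hρ hBS hCe0 hCe
      (fun y hy => (abs_of_nonneg (h.left_nonneg y hy)).le.trans (h.left_le y hy)) h.lap_le hτ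
      (by linarith [ht.2])
    refine (abs_sub_le _ (∫ y, u a y * heatKernel ρ (t - a) x y) _).trans ?_
    rw [hD, add_mul]
    exact add_le_add h1 h2
  have key' : |u t x - u a x| ≤ D * (t - a) := by
    rcases ht.1.eq_or_lt with rfl | hat
    · simp
    rcases ht.2.eq_or_lt with rfl | htb
    · have hl : Tendsto (fun s => u s x) (𝓝[<] t) (𝓝 (u t x)) :=
        ((h.cont_time x hxS) t ht).mono_left (nhdsWithin_le_of_mem (by
          filter_upwards [Ioo_mem_nhdsLT hat] with s hs using Ioo_subset_Icc_self hs))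
      have hr : Tendsto (fun s => D * (s - a)) (𝓝[<] t) (𝓝 (D * (t - a))) :=
        (Continuous.tendsto (by fun_prop) t).mono_left nhdsWithin_le_nhds
      refine le_of_tendsto_of_tendsto (hl.sub_const _).abs hr ?_
      filter_upwards [Ioo_mem_nhdsLT hat] with s hs using key s hs
    · exact key t ⟨hat, htb⟩
  refine key'.trans (mul_le_mul_of_nonneg_right (by linarith) (sub_nonneg.2 ht.1))

/-! ### Separately regular classical solutions -/

/-- Positive solutions of the heat equation on `(a, b) × S` which are `C²` in space at each time and
`C¹` in time at each point. -/
structure SepHeat (u : ℝ → 𝔼 → ℝ) (a b : ℝ) (S : Set 𝔼) : Prop where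
  isOpen : IsOpen S
  pos : ∀ t ∈ Ioo a b, ∀ x ∈ S, 0 < u t x
  contDiff_space : ∀ t ∈ Ioo a b, ContDiffOn ℝ 2 (u t) S
  contDiff_time : ∀ x ∈ S, ContDiffOn ℝ 1 (fun t => u t x) (Ioo a b)
  eq : ∀ t ∈ Ioo a b, ∀ x ∈ S, deriv (fun τ => u τ x) t = lap (u t) x

section

variable {u : ℝ → EuclideanSpace ℝ (Fin n) → ℝ} {a b K : ℝ} {S : Set (EuclideanSpace ℝ (Fin n))}

lemma SepHeat.mono {S' : Set 𝔼} (h : SepHeat u a b S) (hS' : IsOpen S') (hS : S' ⊆ S) :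
    SepHeat u a b S' :=
  ⟨hS', fun t ht x hx => h.pos t ht x (hS hx), fun t ht => (h.contDiff_space t ht).mono hS,
    fun x hx => h.contDiff_time x (hS hx), fun t ht x hx => h.eq t ht x (hS hx)⟩

lemma SepHeat.hasDerivAt (h : SepHeat u a b S) {t : ℝ} (ht : t ∈ Ioo a b) {x : 𝔼} (hx : x ∈ S) :
    HasDerivAt (fun τ => u τ x) (lap (u t) x) t := by
  rw [← h.eq t ht x hx]
  exact (((h.contDiff_time x hx).differentiableOn one_ne_zero).differentiableAt
    (isOpen_Ioo.mem_nhds ht)).hasDerivAt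

lemma SepHeat.continuousOn_time (h : SepHeat u a b S) {x : 𝔼} (hx : x ∈ S) :
    ContinuousOn (fun t => u t x) (Ioo a b) :=
  (h.contDiff_time x hx).continuousOn

lemma SepHeat.continuousOn_lap_time (h : SepHeat u a b S) {x : 𝔼} (hx : x ∈ S) :
    ContinuousOn (fun t => lap (u t) x) (Ioo a b) :=
  ((h.contDiff_time x hx).continuousOn_deriv_of_isOpen isOpen_Ioo le_rfl).congr
    fun t ht => (h.eq t ht x hx).symm

/-- A closed set `F` of times, containing the end points of `[c, d]`, at which `u` and `Δu` are
bounded by `K`, such that the weak heat equation holds at the other times of `[c, d]`. -/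
structure ControlledTimes (u : ℝ → 𝔼 → ℝ) (S : Set 𝔼) (K c d : ℝ) (F : Set ℝ) : Prop where
  lt : c < d
  isClosed : IsClosed F
  subset : F ⊆ Icc c d
  left_mem : c ∈ F
  right_mem : d ∈ F
  le : ∀ t ∈ F, ∀ x ∈ S, u t x ≤ K
  lap_le : ∀ t ∈ F, ∀ x ∈ S, |lap (u t) x| ≤ K
  weak : ∀ t ∈ Ioo c d, t ∉ F → WeakHeatAt u S t

lemma SepHeat.gap {c d : ℝ} {F : Set ℝ} (h : SepHeat u a b S) (hcd : Icc c d ⊆ Ioo a b)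
    (hF : ControlledTimes u S K c d F) {p q : ℝ} (hp : p ∈ F) (hq : q ∈ F) (hpq : p < q)
    (hFpq : ∀ t ∈ Ioo p q, t ∉ F) : Gap u p q S K := by
  have hI : Icc p q ⊆ Ioo a b :=
    (Icc_subset_Icc (hF.subset hp).1 (hF.subset hq).2).trans hcd
  have hI' : Ioo p q ⊆ Ioo a b := Ioo_subset_Icc_self.trans hI
  have hpI := hI (left_mem_Icc.2 hpq.le)
  refine ⟨hpq, ⟨h.isOpen, fun t ht => h.pos t (hI' ht), fun t ht =>
    (h.contDiff_space t (hI' ht)).continuousOn, fun x hx => (h.continuousOn_time hx).mono hI',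
    fun t ht => hF.weak t ?_ (hFpq t ht)⟩, fun x hx => (h.continuousOn_time hx).mono hI,
    h.contDiff_space p hpI, fun x hx => (h.pos p hpI x hx).le, hF.le p hp, hF.le q hq,
    hF.lap_le p hp⟩
  exact ⟨(hF.subset hp).1.trans_lt ht.1, ht.2.trans_le (hF.subset hq).2⟩

lemma SepHeat.exists_lipschitz {c d ρ : ℝ} {F : Set ℝ} (h : SepHeat u a b S) (hn : 0 < n)
    (hcd : Icc c d ⊆ Ioo a b) (hF : ControlledTimes u S K c d F) (hρ : 0 < ρ) (hK : 0 ≤ K)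
    (hd : d - c ≤ 1 / 2) (hd' : 2 * n * (d - c) ≤ ρ ^ 2) :
    ∃ C, ∀ x, ball x (5 * ρ) ⊆ S → (∀ t ∈ Icc c d, u t x ≤ C) ∧
      ∀ t ∈ F, ∀ t' ∈ Icc t d, |u t' x - u t x| ≤ C * (t' - t) := by
  obtain ⟨C, hKC, hC⟩ := Gap.exists_lipschitz (n := n) hn hρ hK
  have hgap : ∀ x, ball x (5 * ρ) ⊆ S → ∀ p ∈ F, ∀ q ∈ F, p < q → (∀ t ∈ Ioo p q, t ∉ F) →
      ∀ t ∈ Icc p q, u t x ≤ C ∧ |u t x - u p x| ≤ C * (t - p) := by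
    intro x hx p hp q hq hpq hpqF
    have hle : q - p ≤ d - c := by linarith [(hF.subset hp).1, (hF.subset hq).2]
    refine hC u p q S x (h.gap hcd hF hp hq hpq hpqF) (by linarith) (le_trans ?_ hd') hx
    gcongr
  refine ⟨C + 1, fun x hx => ⟨fun t ht => ?_, fun t ht t₁ ht₁ => ?_⟩⟩
  · have hxS : x ∈ S := hx (mem_ball_self (by positivity))
    by_cases htF : t ∈ F
    · linarith [hF.le t htF x hxS]
    obtain ⟨p, hp⟩ := (isCompact_Icc.inter_left hF.isClosed).exists_isGreatest
      (s := F ∩ Icc c t) ⟨c, hF.left_mem, left_mem_Icc.2 ht.1⟩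
    obtain ⟨q, hq⟩ := (isCompact_Icc.inter_left hF.isClosed).exists_isLeast
      (s := F ∩ Icc t d) ⟨d, hF.right_mem, right_mem_Icc.2 ht.2⟩
    have hpt : p < t := hp.1.2.2.lt_of_ne fun e => htF (e ▸ hp.1.1)
    have htq : t < q := hq.1.2.1.lt_of_ne fun e => htF (e ▸ hq.1.1)
    have := (hgap x hx p hp.1.1 q hq.1.1 (hpt.trans htq) (fun s hs hsF => ?_) t
      ⟨hpt.le, htq.le⟩).1
    · linarith
    · rcases le_total s t with hst | hst
      · exact absurd (hp.2 ⟨hsF, (hF.subset hsF).1, hst⟩) (not_le.2 hs.1)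
      · exact absurd (hq.2 ⟨hsF, hst, (hF.subset hsF).2⟩) (not_le.2 hs.2)
  · have hxS : x ∈ S := hx (mem_ball_self (by positivity))
    set Q : Set ℝ := {s | s ∈ Icc t t₁ ∧ |u s x - u t x| ≤ (C + 1) * (s - t)} with hQ
    have htc : c ≤ t := (hF.subset ht).1
    have hIt : Icc t t₁ ⊆ Ioo a b := (Icc_subset_Icc htc ht₁.2).trans hcd
    have hcont : ContinuousOn (fun s => u s x) (Icc t t₁) := (h.continuousOn_time hxS).mono hIt
    have hQc : IsClosed Q :=
      isClosed_Icc.isClosed_le (hcont.sub continuousOn_const).abs (by fun_prop)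
    have hstep : ∀ p ∈ Q, ∀ s ∈ Icc p t₁, |u s x - u p x| ≤ (C + 1) * (s - p) → s ∈ Q := by
      intro p hp s hs hle
      refine ⟨⟨hp.1.1.trans hs.1, hs.2⟩, (abs_sub_le _ (u p x) _).trans ?_⟩
      linarith [hp.2]
    have htQ : t ∈ Q := ⟨left_mem_Icc.2 ht₁.1, by simp⟩
    have hFQ : IsCompact (F ∩ Q) :=
      isCompact_Icc.of_isClosed_subset (hF.isClosed.inter hQc) fun s hs => hs.2.1
    obtain ⟨p, hp⟩ := hFQ.exists_isGreatest ⟨t, ht, htQ⟩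
    suffices t₁ ∈ Q from this.2
    rcases hp.1.2.1.2.eq_or_lt with e | hpt₁
    · exact e ▸ hp.1.2
    have hder := h.hasDerivAt (hIt hp.1.2.1) hxS
    have hlip : ∀ᶠ s in 𝓝[>] p, |u s x - u p x| ≤ (C + 1) * (s - p) := by
      have hb : ∀ᶠ s in 𝓝 p, ‖u s x - u p x‖ ≤ (C + 1) * ‖s - p‖ := by
        have ho := (hasDerivAt_iff_isLittleO.1 hder).def one_pos
        filter_upwards [ho] with s hs
        have hK' := hF.lap_le p hp.1.1 x hxS
        have e : u s x - u p x = (u s x - u p x - (s - p) • lap (u p) x)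
          + (s - p) • lap (u p) x := by ring
        rw [e]
        refine (norm_add_le _ _).trans ?_
        rw [norm_smul, Real.norm_eq_abs (lap (u p) x)]
        nlinarith [norm_nonneg (s - p)]
      filter_upwards [hb.filter_mono nhdsWithin_le_nhds, self_mem_nhdsWithin] with s hs hsp
      rwa [Real.norm_eq_abs, Real.norm_eq_abs, abs_of_pos (sub_pos.2 (mem_Ioi.1 hsp))] at hs
    obtain ⟨e, he, hes⟩ := mem_nhdsGT_iff_exists_Ioo_subset.1 hlip
    rw [mem_Ioi] at he
    set m := min ((p + e) / 2) t₁ with hm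
    have hpm : p < m := lt_min (by linarith) hpt₁
    have hme : m < e := (min_le_left _ _).trans_lt (by linarith)
    have hnoF : ∀ s ∈ Ioc p m, s ∉ F := fun s hs hsF =>
      absurd (hp.2 ⟨hsF, hstep p hp.1.2 s ⟨hs.1.le, hs.2.trans (min_le_right _ _)⟩
        (hes ⟨hs.1, hs.2.trans_lt hme⟩)⟩) (not_le.2 hs.1)
    obtain ⟨q, hq⟩ := (isCompact_Icc.inter_left hF.isClosed).exists_isLeast
      (s := F ∩ Icc m d) ⟨d, hF.right_mem, right_mem_Icc.2 ((min_le_right _ _).trans ht₁.2)⟩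
    have hpq : p < q := hpm.trans_le hq.1.2.1
    have hg := hgap x hx p hp.1.1 q hq.1.1 hpq fun s hs hsF => by
      rcases le_total s m with hsm | hsm
      · exact hnoF s ⟨hs.1, hsm⟩ hsF
      · exact absurd (hq.2 ⟨hsF, hsm, (hF.subset hsF).2⟩) (not_le.2 hs.2)
    have hg' : ∀ s ∈ Icc p q, |u s x - u p x| ≤ (C + 1) * (s - p) := fun s hs =>
      (hg s hs).2.trans (mul_le_mul_of_nonneg_right (by linarith) (sub_nonneg.2 hs.1))
    rcases le_total t₁ q with htq | htq
    · exact hstep p hp.1.2 t₁ ⟨hpt₁.le, le_rfl⟩ (hg' t₁ ⟨hpt₁.le, htq⟩)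
    · exact absurd (hp.2 ⟨hq.1.1, hstep p hp.1.2 q ⟨hpq.le, htq⟩ (hg' q ⟨hpq.le, le_rfl⟩)⟩)
        (not_le.2 hpq)

end

section

variable {u : ℝ → EuclideanSpace ℝ (Fin n) → ℝ} {a b K : ℝ} {S : Set (EuclideanSpace ℝ (Fin n))}

lemma SepHeat.continuousOn_integral {c d C : ℝ} {ψ : 𝔼 → ℝ} {L : Set 𝔼} (h : SepHeat u a b S)
    (hcd : Icc c d ⊆ Ioo a b) (hψ : Continuous ψ) (hL : IsCompact L) (hLS : L ⊆ S)
    (hψ0 : ∀ y ∉ L, ψ y = 0) (hC : ∀ t ∈ Icc c d, ∀ x ∈ L, u t x ≤ C) :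
    ContinuousOn (fun t => ∫ y, u t y * ψ y) (Icc c d) := by
  have hψi : Integrable ψ := hψ.integrable_of_hasCompactSupport (HasCompactSupport.intro hL hψ0)
  refine continuousOn_of_dominated (bound := fun y => C * ‖ψ y‖) (fun t ht => ?_) (fun t ht => ?_)
    (hψi.norm.const_mul C) (Eventually.of_forall fun y => ?_)
  · exact (integrable_mul_of_eq_zero h.isOpen (h.contDiff_space t (hcd ht)).continuousOn hψ hL hLS
      hψ0).aestronglyMeasurable
  · refine Eventually.of_forall fun y => ?_
    by_cases hy : y ∈ L
    · rw [norm_mul, Real.norm_eq_abs (u t y), abs_of_pos (h.pos t (hcd ht) y (hLS hy))]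
      exact mul_le_mul_of_nonneg_right (hC t ht y hy) (norm_nonneg _)
    · simp [hψ0 y hy]
  · by_cases hy : y ∈ L
    · exact ((h.continuousOn_time (hLS hy)).mono hcd).mul continuousOn_const
    · simpa [hψ0 y hy] using continuousOn_const

lemma SepHeat.hasDerivWithinAt_integral {t d C : ℝ} {φ : 𝔼 → ℝ} (h : SepHeat u a b S)
    (hφ : IsTest S φ) (ht : a < t) (htd : t < d) (hd : d < b)
    (hC : ∀ x ∈ tsupport φ, ∀ s ∈ Icc t d, |u s x - u t x| ≤ C * (s - t)) :
    HasDerivWithinAt (fun s => ∫ y, u s y * φ y) (∫ y, u t y * lap φ y) (Ioi t) t := by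
  have htI : t ∈ Ioo a b := ⟨ht, htd.trans hd⟩
  have hi : ∀ s ∈ Ioo a b, Integrable fun y => u s y * φ y := fun s hs =>
    integrable_mul_of_tsupport h.isOpen (h.contDiff_space s hs).continuousOn
      hφ.contDiff.continuous hφ.compact hφ.subset
  have hφi : Integrable φ := hφ.contDiff.continuous.integrable_of_hasCompactSupport hφ.compact
  rw [hasDerivWithinAt_iff_tendsto_slope' self_notMem_Ioi,
    ← integral_lap_mul h.isOpen (h.contDiff_space t htI) hφ]
  have hev : ∀ᶠ s in 𝓝[>] t, s ∈ Ioo t d := Ioo_mem_nhdsGT htd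
  have e : (fun s => ∫ y, (s - t)⁻¹ * (u s y * φ y - u t y * φ y)) =ᶠ[𝓝[>] t]
      slope (fun s => ∫ y, u s y * φ y) t := by
    filter_upwards [hev] with s hs
    rw [slope_def_module, smul_eq_mul, integral_const_mul,
      integral_sub (hi s ⟨ht.trans hs.1, hs.2.trans hd⟩) (hi t htI)]
  refine Tendsto.congr' e (tendsto_integral_filter_of_dominated_convergence
    (fun y => C * ‖φ y‖) ?_ ?_ (hφi.norm.const_mul C) (Eventually.of_forall fun y => ?_))
  · filter_upwards [hev] with s hs
    exact (((hi s ⟨ht.trans hs.1, hs.2.trans hd⟩).sub (hi t htI)).const_mul _).aestronglyMeasurable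
  · filter_upwards [hev] with s hs
    refine Eventually.of_forall fun y => ?_
    by_cases hy : y ∈ tsupport φ
    · have hst : 0 < s - t := sub_pos.2 hs.1
      rw [← sub_mul, ← mul_assoc, norm_mul]
      refine mul_le_mul_of_nonneg_right ?_ (norm_nonneg _)
      rw [norm_mul, norm_inv, Real.norm_eq_abs, Real.norm_eq_abs, abs_of_pos hst,
        inv_mul_le_iff₀ hst, mul_comm]
      exact hC y hy s (Ioo_subset_Icc_self hs)
    · simp [eq_zero_of_notMem_tsupport y hy]
  · by_cases hy : y ∈ tsupport φ
    · have h1 := (hasDerivWithinAt_iff_tendsto_slope' self_notMem_Ioi).1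
        ((h.hasDerivAt htI (hφ.subset hy)).hasDerivWithinAt (s := Ioi t))
      refine (h1.mul_const (φ y)).congr fun s => ?_
      rw [slope_def_module, smul_eq_mul]
      ring
    · simp [eq_zero_of_notMem_tsupport y hy]

lemma hasDerivAt_of_hasDerivWithinAt_Ioi {f f' : ℝ → ℝ} {c d t : ℝ} (hf : ContinuousOn f (Icc c d))
    (hf' : ContinuousOn f' (Icc c d)) (h : ∀ s ∈ Ioo c d, HasDerivWithinAt f (f' s) (Ioi s) s)
    (ht : t ∈ Ioo c d) : HasDerivAt f (f' t) t := by
  have hnt : Icc c d ∈ 𝓝 t := Icc_mem_nhds ht.1 ht.2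
  have hI : ∀ s ∈ Icc c d, IntervalIntegrable f' volume c s := fun s hs =>
    (hf'.mono (by rw [uIcc_of_le hs.1]; exact Icc_subset_Icc_right hs.2)).intervalIntegrable
  have h1 := (intervalIntegral.integral_hasDerivAt_right (hI t (Ioo_subset_Icc_self ht))
    (hf'.stronglyMeasurableAtFilter_nhdsWithin measurableSet_Icc t |>.filter_mono
      (nhdsWithin_eq_nhds.2 hnt).ge) (hf'.continuousAt hnt)).const_add (f c)
  refine h1.congr_of_eventuallyEq ?_
  filter_upwards [hnt] with s hs
  rw [intervalIntegral.integral_eq_sub_of_hasDeriv_right_of_le hs.1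
    (hf.mono (Icc_subset_Icc_right hs.2)) (fun σ hσ => h σ ⟨hσ.1, hσ.2.trans_le hs.2⟩) (hI s hs)]
  ring

/-- The weak heat equation near a time at which the exceptional times are uniformly controlled. -/
lemma SepHeat.weakHeatAt_of_isClosed {B : Set 𝔼} {Y : Set ℝ} {p q t : ℝ} {S' : Set 𝔼}
    (h : SepHeat u a b S) (hn : 0 < n) (hS' : IsOpen S') (hB : IsCompact B) (hSB : S' ⊆ B)
    (hBS : B ⊆ S) (hpq : Ioo p q ⊆ Ioo a b) (hY : IsClosed Y)
    (hle : ∀ t ∈ Y ∩ Ioo p q, ∀ x ∈ B, u t x ≤ K ∧ |lap (u t) x| ≤ K)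
    (hw : ∀ t ∈ Ioo p q, t ∉ Y → WeakHeatAt u S' t) (ht : t ∈ Ioo p q) : WeakHeatAt u S' t := by
  have h' := h.mono hS' (hSB.trans hBS)
  have hbound : ∀ s ∈ Ioo a b, ∃ M, ∀ x ∈ B, u s x ≤ M ∧ |lap (u s) x| ≤ M := fun s hs => by
    obtain ⟨M₁, h₁⟩ := hB.exists_bound_of_continuousOn
      ((h.contDiff_space s hs).continuousOn.mono hBS)
    obtain ⟨M₂, h₂⟩ := hB.exists_bound_of_continuousOn
      ((continuousOn_lap h.isOpen (h.contDiff_space s hs)).mono hBS)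
    exact ⟨max M₁ M₂, fun x hx => ⟨(le_abs_self _).trans ((h₁ x hx).trans (le_max_left _ _)),
      (h₂ x hx).trans (le_max_right _ _)⟩⟩
  have main : ∀ L, IsCompact L → L ⊆ S' → ∃ c d C, ∃ F : Set ℝ, t ∈ Ioo c d ∧ Icc c d ⊆ Ioo a b ∧
      ControlledTimes u S' C c d F ∧ ∀ x ∈ L, (∀ s ∈ Icc c d, u s x ≤ C) ∧
      ∀ s ∈ F, ∀ s' ∈ Icc s d, |u s' x - u s x| ≤ C * (s' - s) := by
    intro L hL hLS
    obtain ⟨ε, hε, hεS⟩ := hL.exists_thickening_subset_open hS' hLS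
    set ρ := ε / 5 with hρ
    have hρ0 : 0 < ρ := by positivity
    have hn' : (0 : ℝ) < n := Nat.cast_pos.2 hn
    set η := min (1 / 4) (min (ρ ^ 2 / (4 * n)) (min ((t - p) / 2) ((q - t) / 2))) with hη
    have hη0 : 0 < η := by
      have h1 := sub_pos.2 ht.1
      have h2 := sub_pos.2 ht.2
      positivity
    have hη1 : η ≤ 1 / 4 := min_le_left _ _
    have hη2 : η ≤ ρ ^ 2 / (4 * n) := (min_le_right _ _).trans (min_le_left _ _)
    have hη3 : η ≤ (t - p) / 2 :=
      (min_le_right _ _).trans ((min_le_right _ _).trans (min_le_left _ _))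
    have hη4 : η ≤ (q - t) / 2 :=
      (min_le_right _ _).trans ((min_le_right _ _).trans (min_le_right _ _))
    rw [le_div_iff₀ (by positivity)] at hη2
    have hcdpq : Icc (t - η) (t + η) ⊆ Ioo p q := fun s hs =>
      ⟨by linarith [hs.1, ht.1], by linarith [hs.2, ht.2]⟩
    have hcd := hcdpq.trans hpq
    obtain ⟨M₁, h₁⟩ := hbound (t - η) (hcd (left_mem_Icc.2 (by linarith)))
    obtain ⟨M₂, h₂⟩ := hbound (t + η) (hcd (right_mem_Icc.2 (by linarith)))
    set M := max (max 0 K) (max M₁ M₂) with hM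
    have hKM : K ≤ M := (le_max_right _ _).trans (le_max_left _ _)
    have hM₁ : M₁ ≤ M := (le_max_left _ _).trans (le_max_right _ _)
    have hM₂ : M₂ ≤ M := (le_max_right _ _).trans (le_max_right _ _)
    have hM0 : 0 ≤ M := (le_max_left _ _).trans (le_max_left _ _)
    set F := Y ∩ Icc (t - η) (t + η) ∪ {t - η, t + η} with hF
    have hbF : ∀ s ∈ F, ∀ x ∈ B, u s x ≤ M ∧ |lap (u s) x| ≤ M := by
      rintro s (hs | rfl | rfl) x hx
      · obtain ⟨i, j⟩ := hle s ⟨hs.1, hcdpq hs.2⟩ x hx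
        exact ⟨i.trans hKM, j.trans hKM⟩
      · exact ⟨(h₁ x hx).1.trans hM₁, (h₁ x hx).2.trans hM₁⟩
      · exact ⟨(h₂ x hx).1.trans hM₂, (h₂ x hx).2.trans hM₂⟩
    have hctrl : ∀ C, M ≤ C → ControlledTimes u S' C (t - η) (t + η) F := fun C hC =>
      { lt := by linarith
        isClosed := (hY.inter isClosed_Icc).union (Set.toFinite _).isClosed
        subset := by
          rintro s (hs | rfl | rfl)
          · exact hs.2
          · exact left_mem_Icc.2 (by linarith)
          · exact right_mem_Icc.2 (by linarith)
        left_mem := Or.inr (Or.inl rfl)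
        right_mem := Or.inr (Or.inr rfl)
        le := fun s hs x hx => (hbF s hs x (hSB hx)).1.trans hC
        lap_le := fun s hs x hx => (hbF s hs x (hSB hx)).2.trans hC
        weak := fun s hs hsF => hw s (hcdpq (Ioo_subset_Icc_self hs)) fun hsY =>
          hsF (Or.inl ⟨hsY, Ioo_subset_Icc_self hs⟩) }
    obtain ⟨C, hC⟩ := h'.exists_lipschitz hn hcd (hctrl M le_rfl) hρ0 hM0 (by linarith)
      (by linarith)
    refine ⟨t - η, t + η, max M C, F, ⟨by linarith, by linarith⟩, hcd, hctrl _ (le_max_left _ _),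
      fun x hx => ?_⟩
    have hx5 : ball x (5 * ρ) ⊆ S' := by
      have e : 5 * ρ = ε := by rw [hρ]; ring
      rw [e]
      exact (ball_subset_thickening hx ε).trans hεS
    obtain ⟨i, j⟩ := hC x hx5
    exact ⟨fun s hs => (i s hs).trans (le_max_right _ _), fun s hs s' hs' => (j s hs s' hs').trans
      (mul_le_mul_of_nonneg_right (le_max_right _ _) (sub_nonneg.2 hs'.1))⟩
  constructor
  · intro L hL hLS
    obtain ⟨c, d, C, F, htc, hcd, -, hC⟩ := main L hL hLS
    refine ⟨C, ?_⟩
    filter_upwards [Icc_mem_nhds htc.1 htc.2] with s hs x hx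
    rw [abs_of_pos (h'.pos s (hcd hs) x (hLS hx))]
    exact (hC x hx).1 s hs
  · intro φ hφ
    obtain ⟨c, d, C, F, htc, hcd, hF, hC⟩ := main _ hφ.compact hφ.subset
    refine hasDerivAt_of_hasDerivWithinAt_Ioi (f' := fun s => ∫ y, u s y * lap φ y)
      (h'.continuousOn_integral hcd hφ.contDiff.continuous hφ.compact hφ.subset
        eq_zero_of_notMem_tsupport fun s hs x hx => (hC x hx).1 s hs)
      (h'.continuousOn_integral hcd (continuous_lap hφ.contDiff) hφ.compact hφ.subset
        (fun y hy => eq_zero_of_notMem_tsupport y fun hy' => hy (tsupport_lap_subset φ hy'))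
        fun s hs x hx => (hC x hx).1 s hs) (fun s hs => ?_) htc
    by_cases hsF : s ∈ F
    · exact h'.hasDerivWithinAt_integral hφ (hcd (Ioo_subset_Icc_self hs)).1 hs.2
        (hcd (right_mem_Icc.2 hF.lt.le)).2 fun x hx => (hC x hx).2 s hsF
    · exact ((hF.weak s hs hsF).deriv φ hφ).hasDerivWithinAt

/-- Separately regular solutions are weak solutions on relatively compact subdomains. -/
theorem SepHeat.weakHeatAt {B S' : Set 𝔼} (h : SepHeat u a b S) (hn : 0 < n) (hS' : IsOpen S')
    (hB : IsCompact B) (hSB : S' ⊆ B) (hBS : B ⊆ S) {t : ℝ} (ht : t ∈ Ioo a b) :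
    WeakHeatAt u S' t := by
  set Y : Set ℝ := (interior {s | WeakHeatAt u S' s})ᶜ with hYdef
  have hY : IsClosed Y := isOpen_interior.isClosed_compl
  have hgood : ∀ s, s ∉ Y → WeakHeatAt u S' s := fun s hs =>
    interior_subset (s := {s | WeakHeatAt u S' s}) (not_not.1 hs)
  by_contra hcon
  set Z : Set ℝ := Y ∩ Ioo a b with hZ
  have htZ : t ∈ Z := ⟨fun h' => hcon (interior_subset h'), ht⟩
  have : Nonempty Z := ⟨⟨t, htZ⟩⟩
  have : BaireSpace Z :=
    (hY.isGδ.inter isOpen_Ioo.isGδ).baireSpace_of_t2Space_locallyCompactSpace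
  set A : ℕ → Set Z := fun k => {s | ∀ x ∈ B, u s x ≤ k ∧ |lap (u s) x| ≤ k} with hA
  have hAc : ∀ k, IsClosed (A k) := fun k => by
    have hv : ∀ s : Z, (s : ℝ) ∈ Ioo a b := fun s => s.2.2
    have e : A k = ⋂ x ∈ B, {s : Z | u s x ≤ k} ∩ {s : Z | |lap (u s) x| ≤ k} := by
      ext s
      simp [hA]
    rw [e]
    refine isClosed_biInter fun x hx => IsClosed.inter ?_ ?_
    · exact isClosed_le ((h.continuousOn_time (hBS hx)).comp_continuous continuous_subtype_val hv)
        continuous_const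
    · exact isClosed_le ((h.continuousOn_lap_time (hBS hx)).comp_continuous
        continuous_subtype_val hv).abs continuous_const
  have hAu : ⋃ k, A k = univ := by
    refine eq_univ_of_forall fun s => mem_iUnion.2 ?_
    obtain ⟨M₁, h₁⟩ := hB.exists_bound_of_continuousOn
      ((h.contDiff_space s s.2.2).continuousOn.mono hBS)
    obtain ⟨M₂, h₂⟩ := hB.exists_bound_of_continuousOn
      ((continuousOn_lap h.isOpen (h.contDiff_space s s.2.2)).mono hBS)
    obtain ⟨k, hk⟩ := exists_nat_ge (max M₁ M₂)
    exact ⟨k, fun x hx => ⟨(le_abs_self _).trans ((h₁ x hx).trans ((le_max_left _ _).trans hk)),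
      (h₂ x hx).trans ((le_max_right _ _).trans hk)⟩⟩
  obtain ⟨k, s₀, hs₀⟩ := nonempty_interior_of_iUnion_of_closed hAc hAu
  obtain ⟨V, hV, hVA⟩ := (mem_nhds_subtype Z s₀ (A k)).1 (mem_interior_iff_mem_nhds.1 hs₀)
  obtain ⟨p, q, hspq, hpqV⟩ := (mem_nhds_iff_exists_Ioo_subset).1
    (inter_mem hV (isOpen_Ioo.mem_nhds s₀.2.2))
  refine s₀.2.1 (mem_interior.2 ⟨Ioo p q, fun s hs => ?_, isOpen_Ioo, hspq⟩)
  exact h.weakHeatAt_of_isClosed hn hS' hB hSB hBS (fun s hs => (hpqV hs).2) hY (K := k)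
    (fun s hs => hVA (a := ⟨s, hs.1, (hpqV hs.2).2⟩) (hpqV hs.2).1) (fun s _ => hgood s) hs

end

end HeatHarnack

/-- Harnack-type inequality for the heat equation (paper's Theorem 12).
There is `C = C(n) > 0` such that every positive solution `u` of `∂ₜu = Δu` on
`(0,T] × B̄_R` satisfies, for `α > 1`, `x₁, x₂ ∈ B̄_{R/2}` and `0 < t₁ < t₂ ≤ T`:
`u(x₁,t₁) ≤ u(x₂,t₂) (t₂/t₁)^{nα/2}
  exp(α²‖x₁-x₂‖²/(4(t₂-t₁)) + (Cα/R²)(1 + α²/(α-1))(t₂-t₁))`. -/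
theorem heat_harnack (n : ℕ) (hn : 0 < n) :
    ∃ C : ℝ, 0 < C ∧ ∀ R T : ℝ, 0 < R → 0 < T →
      ∀ u : ℝ → EuclideanSpace ℝ (Fin n) → ℝ,
        (∀ t ∈ Set.Icc (0 : ℝ) T,
          ∀ x ∈ Metric.closedBall (0 : EuclideanSpace ℝ (Fin n)) R, 0 < u t x) →
        (∀ t ∈ Set.Icc (0 : ℝ) T,
          ContDiffOn ℝ 2 (u t) (Metric.closedBall (0 : EuclideanSpace ℝ (Fin n)) R)) →
        (∀ x ∈ Metric.closedBall (0 : EuclideanSpace ℝ (Fin n)) R,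
          ContDiffOn ℝ 1 (fun t => u t x) (Set.Icc (0 : ℝ) T)) →
        (∀ t ∈ Set.Ioc (0 : ℝ) T,
          ∀ x ∈ Metric.closedBall (0 : EuclideanSpace ℝ (Fin n)) R,
            deriv (fun τ => u τ x) t = lap (u t) x) →
        ∀ α : ℝ, 1 < α →
          ∀ x₁ ∈ Metric.closedBall (0 : EuclideanSpace ℝ (Fin n)) (R / 2),
          ∀ x₂ ∈ Metric.closedBall (0 : EuclideanSpace ℝ (Fin n)) (R / 2),
          ∀ t₁ t₂ : ℝ, 0 < t₁ → t₁ < t₂ → t₂ ≤ T →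
            u t₁ x₁ ≤ u t₂ x₂ * (t₂ / t₁) ^ ((n : ℝ) * α / 2) *
              Real.exp (α ^ 2 * ‖x₁ - x₂‖ ^ 2 / (4 * (t₂ - t₁))
                + C * α / R ^ 2 * (1 + α ^ 2 / (α - 1)) * (t₂ - t₁)) := by
  refine ⟨112 / 9 * (n * (2 * n + 13)), by positivity, ?_⟩
  intro R T hR hT u hpos hspace htime heq α hα x₁ hx₁ x₂ hx₂ t₁ t₂ ht₁ ht₁₂ ht₂
  have hI : Set.Ioo (0 : ℝ) T ⊆ Set.Icc 0 T := Set.Ioo_subset_Icc_self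
  have hsub := Metric.ball_subset_closedBall (x := (0 : EuclideanSpace ℝ (Fin n))) (ε := R)
  have hsep : SepHeat u 0 T (Metric.ball 0 R) :=
    ⟨Metric.isOpen_ball, fun t ht x hx => hpos t (hI ht) x (hsub hx),
      fun t ht => (hspace t (hI ht)).mono hsub, fun x hx => (htime x (hsub hx)).mono hI,
      fun t ht x hx => heq t (Set.Ioo_subset_Ioc_self ht) x (hsub hx)⟩
  have hr : 0 < 3 * R / 4 := by positivity
  have hrR : Metric.closedBall (0 : EuclideanSpace ℝ (Fin n)) (3 * R / 4) ⊆ Metric.ball 0 R :=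
    Metric.closedBall_subset_ball (by linarith)
  have hrR' := Metric.ball_subset_closedBall.trans hrR
  have hweak : WeakHeat u 0 T (Metric.ball 0 (3 * R / 4)) :=
    ⟨Metric.isOpen_ball, fun t ht x hx => hsep.pos t ht x (hrR' hx),
      fun t ht => (hsep.contDiff_space t ht).continuousOn.mono hrR',
      fun x hx => hsep.continuousOn_time (hrR' hx), fun t ht =>
      hsep.weakHeatAt hn Metric.isOpen_ball (isCompact_closedBall _ _)
        Metric.ball_subset_closedBall hrR ht⟩
  have e2 : 2 * (3 * R / 4) / 3 = R / 2 := by ring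
  have key : ∀ t ∈ Set.Ioo t₁ T, u t₁ x₁ ≤ u t x₂ * (t / t₁) ^ ((n : ℝ) * α / 2) *
      Real.exp (α ^ 2 * ‖x₁ - x₂‖ ^ 2 / (4 * (t - t₁))
        + 112 / 9 * (n * (2 * n + 13)) * α / R ^ 2 * (1 + α ^ 2 / (α - 1)) * (t - t₁)) := by
    intro t ht
    have h := hweak.harnack hn hr ht₁ ht.1 ht.2 hα (x₁ := x₁) (x₂ := x₂)
      (by rwa [e2]) (by rwa [e2])
    rw [sub_zero, sub_zero] at h
    have hxR : x₂ ∈ Metric.closedBall (0 : EuclideanSpace ℝ (Fin n)) R :=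
      Metric.closedBall_subset_closedBall (by linarith) hx₂
    have hu := hpos t ⟨(ht₁.trans ht.1).le, ht.2.le⟩ x₂ hxR
    have htt : 0 < t - t₁ := sub_pos.2 ht.1
    have hα1 : 0 < α - 1 := sub_pos.2 hα
    refine h.trans (mul_le_mul_of_nonneg_left (Real.exp_le_exp.2 (add_le_add ?_ (le_of_eq ?_)))
      (mul_nonneg hu.le (Real.rpow_nonneg (div_nonneg (ht₁.trans ht.1).le ht₁.le) _)))
    · gcongr
      nlinarith
    · unfold barrierConst
      field_simp
      ring
  rcases ht₂.lt_or_eq with hlt | rfl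
  · exact key t₂ ⟨ht₁₂, hlt⟩
  have hcu : Filter.Tendsto (fun t => u t x₂) (nhdsWithin t₂ (Set.Iio t₂)) (nhds (u t₂ x₂)) := by
    have hxR : x₂ ∈ Metric.closedBall (0 : EuclideanSpace ℝ (Fin n)) R :=
      Metric.closedBall_subset_closedBall (by linarith) hx₂
    refine ((htime x₂ hxR).continuousOn t₂ (Set.right_mem_Icc.2 hT.le)).mono_left
      (nhdsWithin_le_of_mem ?_)
    filter_upwards [Ioo_mem_nhdsLT hT] with t ht using hI ht
  have hne : 4 * (t₂ - t₁) ≠ 0 := by linarith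
  have hcr : ContinuousAt (fun t : ℝ => (t / t₁) ^ ((n : ℝ) * α / 2)) t₂ :=
    (continuousAt_id.div_const t₁).rpow_const (Or.inl (div_pos hT ht₁).ne')
  have hce : ContinuousAt (fun t : ℝ => Real.exp (α ^ 2 * ‖x₁ - x₂‖ ^ 2 / (4 * (t - t₁))
        + 112 / 9 * (n * (2 * n + 13)) * α / R ^ 2 * (1 + α ^ 2 / (α - 1)) * (t - t₁))) t₂ := by
    have h1 : ContinuousAt (fun t : ℝ => α ^ 2 * ‖x₁ - x₂‖ ^ 2 / (4 * (t - t₁))) t₂ :=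
      continuousAt_const.div (by fun_prop) hne
    exact (h1.add (by fun_prop)).rexp
  refine ge_of_tendsto ((hcu.mul (hcr.tendsto.mono_left nhdsWithin_le_nhds)).mul
    (hce.tendsto.mono_left nhdsWithin_le_nhds)) ?_
  filter_upwards [Ioo_mem_nhdsLT ht₁₂] with t ht using key t ht
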